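/- Let n ≥ 1 and let X be a compact metric space with finite Hausdorff n-measure whose Nagata dimension is at most N with constant c > 0, isometrically embedded in the space ℓ^∞ of bounded real sequences with the supremum norm, and let P ⊆ X be purely n-unrectifiable. Then for every ε > 0 there exist a finite simplicial complex Σ of dimension at most N, with side length ε and equipped with the ℓ²-metric, Lipschitz maps f, h : X → Σ and g : Σ → ℓ^∞, and a constant C > 0 depending only on n, N and c, such that: (1) f is C-Lipschitz and the restriction of g to each simplex of Σ is C-Lipschitz; (2) ‖x − g(f(x))‖_∞ ≤ C·ε and ‖x − g(h(x))‖_∞ ≤ C·ε for every x ∈ X; (3) the image of h is contained in the n-skeleton Σ^n of Σ; (4) for each x ∈ X there is a simplex of Σ containing both f(x) and h(x); (5) H^n(h(P)) < ε^n/(2·n!); (6) for every n-dimensional simplex Δ of Σ one has ∫_Δ N(h, y) dH^n(y) ≤ C·H^n(f⁻¹(st Δ)). -/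

import Mathlib

open Set MeasureTheory Metric Filter
open scoped NNReal ENNReal Pointwise

noncomputable section

/-- The space ℓ^∞ of bounded real sequences with the supremum norm. -/
abbrev Linf : Type := lp (fun _ : ℕ => ℝ) ⊤

/-- Nagata dimension of `X` is at most `n` with constant `c`: for every `s > 0` there is
a covering of `X` by sets of diameter at most `c·s` such that every set of diameter
less than `s` meets at most `n+1` members of the covering. -/
def NagataDimLE (X : Type*) [MetricSpace X] (n : ℕ) (c : ℝ) : Prop :=
  ∀ s : ℝ, 0 < s → ∃ 𝒰 : Set (Set X),
    (⋃₀ 𝒰 = Set.univ) ∧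
    (∀ U ∈ 𝒰, EMetric.diam U ≤ ENNReal.ofReal (c * s)) ∧
    (∀ A : Set X, EMetric.diam A < ENNReal.ofReal s →
      ({U ∈ 𝒰 | (A ∩ U).Nonempty}).Finite ∧
      ({U ∈ 𝒰 | (A ∩ U).Nonempty}).ncard ≤ n + 1)

/-- An abstract finite simplicial complex on vertex set `I`:
a nonempty family of nonempty finite subsets of `I`, closed under nonempty subsets. -/
structure SimplicialCplx (I : Type*) where
  F : Finset (Finset I)
  F_nonempty : F.Nonempty
  mem_nonempty : ∀ S ∈ F, S.Nonempty
  down_closed : ∀ S ∈ F, ∀ T : Finset I, T ⊆ S → T.Nonempty → T ∈ F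

/-- The vertex `e_i` of the standard simplex in the Euclidean space `ℝ^I`. -/
def vertex {I : Type*} [Fintype I] [DecidableEq I] (i : I) : EuclideanSpace ℝ I :=
  EuclideanSpace.single i (1 : ℝ)

/-- The closed simplex `Δ_S = (ε/√2) · convexHull {e_i : i ∈ S}`,
a Euclidean simplex of side length `ε`. -/
def simplexOf {I : Type*} [Fintype I] [DecidableEq I] (ε : ℝ) (S : Finset I) :
    Set (EuclideanSpace ℝ I) :=
  (ε / Real.sqrt 2) • convexHull ℝ (vertex '' (S : Set I))

/-- The geometric realization of a simplicial complex with side length `ε`,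
as a subset of the Euclidean space `ℝ^I` (carrying the `ℓ²`-metric). -/
def realization {I : Type*} [Fintype I] [DecidableEq I] (ε : ℝ) (K : SimplicialCplx I) :
    Set (EuclideanSpace ℝ I) :=
  ⋃ S ∈ K.F, simplexOf ε S

/-- The `k`-skeleton of the realization: the union of the simplices on at most
`k+1` vertices. -/
def skeleton {I : Type*} [Fintype I] [DecidableEq I] (ε : ℝ) (K : SimplicialCplx I) (k : ℕ) :
    Set (EuclideanSpace ℝ I) :=
  ⋃ S ∈ K.F, ⋃ (_ : S.card ≤ k + 1), simplexOf ε S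

/-- The relative interior of the simplex with vertex set `S` (side length `ε`). -/
def openSimplexOf {I : Type*} [Fintype I] [DecidableEq I] (ε : ℝ) (S : Finset I) :
    Set (EuclideanSpace ℝ I) :=
  {x | ∃ t : I → ℝ, (∀ i ∈ S, 0 < t i) ∧ (∑ i ∈ S, t i) = 1 ∧
    x = (ε / Real.sqrt 2) • ∑ i ∈ S, t i • vertex i}

/-- The open star of the simplex with vertex set `S`: the union of the relative
interiors of the simplices of `K` having `S` as a face. -/
def openStar {I : Type*} [Fintype I] [DecidableEq I] (ε : ℝ) (K : SimplicialCplx I)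
    (S : Finset I) : Set (EuclideanSpace ℝ I) :=
  ⋃ T ∈ K.F, ⋃ (_ : S ⊆ T), openSimplexOf ε T

/-- `P` is purely `n`-unrectifiable: every Lipschitz image of a subset of `ℝⁿ`
meets `P` in a set of Hausdorff `n`-measure zero. -/
def PurelyUnrectifiable (n : ℕ) {X : Type*} [MetricSpace X] [MeasurableSpace X] [BorelSpace X]
    (P : Set X) : Prop :=
  ∀ (A : Set (EuclideanSpace ℝ (Fin n))) (φ : EuclideanSpace ℝ (Fin n) → X) (L : ℝ≥0),
    LipschitzOnWith L φ A → μH[(n : ℝ)] (P ∩ φ '' A) = 0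

open scoped Topology

/-- `f` is Lipschitz, with an unspecified constant. -/
def IsLip {X E : Type*} [PseudoMetricSpace X] [PseudoMetricSpace E] (f : X → E) : Prop :=
  ∃ C : ℝ≥0, LipschitzWith C f

namespace IsLip

section Basic

variable {X E F : Type*} [PseudoMetricSpace X] [PseudoMetricSpace E] [PseudoMetricSpace F]

theorem continuous {f : X → E} (hf : IsLip f) : Continuous f :=
  let ⟨_, h⟩ := hf; h.continuous

theorem of_dist_le {f : X → E} (C : ℝ) (h : ∀ x y, dist (f x) (f y) ≤ C * dist x y) :
    IsLip f :=
  ⟨C.toNNReal, LipschitzWith.of_dist_le_mul fun x y => (h x y).trans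
    (mul_le_mul_of_nonneg_right (Real.le_coe_toNNReal C) dist_nonneg)⟩

theorem exists_pos {f : X → E} (hf : IsLip f) :
    ∃ C : ℝ, 0 < C ∧ ∀ x y, dist (f x) (f y) ≤ C * dist x y := by
  obtain ⟨C, hC⟩ := hf
  refine ⟨C + 1, by positivity, fun x y => (hC.dist_le_mul x y).trans ?_⟩
  gcongr
  simp

theorem const (a : E) : IsLip (fun _ : X => a) := ⟨0, LipschitzWith.const a⟩

theorem comp {g : E → F} {f : X → E} (hg : IsLip g) (hf : IsLip f) : IsLip (fun x => g (f x)) :=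
  let ⟨_, h⟩ := hg; let ⟨_, h'⟩ := hf; ⟨_, h.comp h'⟩

theorem dist_const (a : X) : IsLip (fun x => dist x a) := ⟨1, LipschitzWith.dist_left a⟩

theorem infDist (s : Set X) : IsLip (fun x => Metric.infDist x s) :=
  ⟨1, Metric.lipschitz_infDist_pt s⟩

theorem pi {ι : Type*} [Fintype ι] {f : X → ι → ℝ} (h : ∀ i, IsLip fun x => f x i) :
    IsLip f := by
  choose C hC hC' using fun i => (h i).exists_pos
  refine of_dist_le (∑ i, C i) fun x y => ?_
  have h0 : 0 ≤ (∑ i, C i) * dist x y :=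
    mul_nonneg (Finset.sum_nonneg fun i _ => (hC i).le) dist_nonneg
  refine (dist_pi_le_iff h0).2 fun i => (hC' i x y).trans ?_
  gcongr
  exact Finset.single_le_sum (f := C) (fun i _ => (hC i).le) (Finset.mem_univ i)

theorem eval {ι : Type*} [Fintype ι] {f : X → ι → ℝ} (h : IsLip f) (i : ι) :
    IsLip fun x => f x i :=
  let ⟨C, hC⟩ := h
  of_dist_le C fun x y => (dist_le_pi_dist _ _ i).trans (hC.dist_le_mul x y)

end Basic

section Normed

variable {X E F : Type*} [PseudoMetricSpace X] [NormedAddCommGroup E] [NormedAddCommGroup F]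

theorem add {f g : X → E} (hf : IsLip f) (hg : IsLip g) : IsLip (fun x => f x + g x) :=
  let ⟨_, h⟩ := hf; let ⟨_, h'⟩ := hg; ⟨_, h.add h'⟩

theorem neg {f : X → E} (hf : IsLip f) : IsLip (fun x => - f x) :=
  let ⟨_, h⟩ := hf; ⟨_, h.neg⟩

theorem sub {f g : X → E} (hf : IsLip f) (hg : IsLip g) : IsLip (fun x => f x - g x) :=
  let ⟨_, h⟩ := hf; let ⟨_, h'⟩ := hg; ⟨_, h.sub h'⟩

theorem sum {ι : Type*} (s : Finset ι) {f : ι → X → E} (h : ∀ i ∈ s, IsLip (f i)) :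
    IsLip (fun x => ∑ i ∈ s, f i x) := by
  classical
  induction s using Finset.induction_on with
  | empty => simpa using const (X := X) (0 : E)
  | insert a s ha ih =>
    simp only [Finset.sum_insert ha]
    exact (h a (by simp)).add (ih fun i hi => h i (by simp [hi]))

theorem norm {f : X → E} (hf : IsLip f) : IsLip (fun x => ‖f x‖) :=
  comp ⟨1, lipschitzWith_one_norm⟩ hf

theorem max {f g : X → ℝ} (hf : IsLip f) (hg : IsLip g) : IsLip (fun x => Max.max (f x) (g x)) :=
  let ⟨_, h⟩ := hf; let ⟨_, h'⟩ := hg; ⟨_, h.max h'⟩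

theorem min {f g : X → ℝ} (hf : IsLip f) (hg : IsLip g) : IsLip (fun x => Min.min (f x) (g x)) :=
  let ⟨_, h⟩ := hf; let ⟨_, h'⟩ := hg; ⟨_, h.min h'⟩

theorem exists_norm_le [CompactSpace X] {f : X → E} (hf : IsLip f) :
    ∃ B : ℝ, 0 < B ∧ ∀ x, ‖f x‖ ≤ B := by
  obtain ⟨B, hB⟩ := (isCompact_range hf.continuous).isBounded.exists_norm_le
  exact ⟨Max.max B 1, by positivity, fun x => (hB _ ⟨x, rfl⟩).trans (le_max_left _ _)⟩

variable [NormedSpace ℝ E] [NormedSpace ℝ F]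

theorem clm (T : E →L[ℝ] F) {f : X → E} (hf : IsLip f) : IsLip (fun x => T (f x)) :=
  comp ⟨_, T.lipschitz⟩ hf

theorem smul_of_bound {f : X → ℝ} {g : X → E} (hf : IsLip f) (hg : IsLip g)
    {B B' : ℝ} (hB : ∀ x, ‖f x‖ ≤ B) (hB' : ∀ x, ‖g x‖ ≤ B') :
    IsLip (fun x => f x • g x) := by
  obtain ⟨C, hC, h⟩ := hf.exists_pos
  obtain ⟨C', hC', h'⟩ := hg.exists_pos
  refine of_dist_le (B * C' + C * B') fun x y => ?_
  have e : f x • g x - f y • g y = f x • (g x - g y) + (f x - f y) • g y := by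
    simp [smul_sub, sub_smul]
  rw [dist_eq_norm, e]
  refine (norm_add_le _ _).trans ?_
  rw [norm_smul, norm_smul, ← dist_eq_norm, ← dist_eq_norm]
  have h1 := h x y
  have h2 := h' x y
  have := hB x
  have := hB' y
  calc _ ≤ B * (C' * dist x y) + C * dist x y * B' := by gcongr; exact (norm_nonneg _).trans (hB x)
    _ = _ := by ring

variable [CompactSpace X]

theorem smul {f : X → ℝ} {g : X → E} (hf : IsLip f) (hg : IsLip g) :
    IsLip (fun x => f x • g x) := by
  obtain ⟨B, -, hB⟩ := hf.exists_norm_le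
  obtain ⟨B', -, hB'⟩ := hg.exists_norm_le
  exact smul_of_bound hf hg hB hB'

theorem mul {f g : X → ℝ} (hf : IsLip f) (hg : IsLip g) : IsLip (fun x => f x * g x) := by
  simpa using hf.smul hg

theorem inv_of_le {X : Type*} [PseudoMetricSpace X] {f : X → ℝ} (hf : IsLip f) {b : ℝ} (hb : 0 < b)
    (h : ∀ x, b ≤ f x) : IsLip (fun x => (f x)⁻¹) := by
  obtain ⟨C, hC, h'⟩ := hf.exists_pos
  refine of_dist_le (C / b ^ 2) fun x y => ?_
  have hx := h x
  have hy := h y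
  have hx0 : 0 < f x := hb.trans_le hx
  have hy0 : 0 < f y := hb.trans_le hy
  rw [Real.dist_eq, inv_sub_inv hx0.ne' hy0.ne', abs_div, abs_of_pos (mul_pos hx0 hy0),
    div_mul_eq_mul_div, ← Real.dist_eq, dist_comm]
  gcongr
  · exact h' x y
  · rw [sq]; gcongr

theorem inv {f : X → ℝ} (hf : IsLip f) (h : ∀ x, 0 < f x) : IsLip (fun x => (f x)⁻¹) := by
  rcases isEmpty_or_nonempty X with hX | hX
  · exact ⟨0, fun x => (hX.false x).elim⟩
  obtain ⟨x0, -, hx0⟩ := isCompact_univ.exists_isMinOn univ_nonempty hf.continuous.continuousOn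
  exact inv_of_le hf (h x0) fun x => hx0 (mem_univ x)

theorem div {f g : X → ℝ} (hf : IsLip f) (hg : IsLip g) (h : ∀ x, 0 < g x) :
    IsLip (fun x => f x / g x) := by
  simpa [div_eq_mul_inv] using hf.mul (hg.inv h)

end Normed

/-- Lipschitz cutoff functions separating two disjoint closed sets in a compact space. -/
theorem exists_cutoff {X : Type*} [PseudoMetricSpace X] [CompactSpace X] {Z W : Set X}
    (hZ : IsClosed Z) (hW : IsClosed W) (h : Disjoint Z W) :
    ∃ χ : X → ℝ, IsLip χ ∧ (∀ x, 0 ≤ χ x ∧ χ x ≤ 1) ∧ (∀ x ∈ Z, χ x = 1) ∧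
      (∀ x ∈ W, χ x = 0) := by
  rcases Z.eq_empty_or_nonempty with rfl | hZn
  · exact ⟨fun _ => 0, const 0, by simp, by simp, by simp⟩
  rcases W.eq_empty_or_nonempty with rfl | hWn
  · exact ⟨fun _ => 1, const 1, by simp, by simp, by simp⟩
  have hp : ∀ x, 0 < Metric.infDist x W + Metric.infDist x Z := by
    intro x
    have h1 := Metric.infDist_nonneg (x := x) (s := W)
    have h2 := Metric.infDist_nonneg (x := x) (s := Z)
    rcases h1.eq_or_lt with h1 | h1
    · rcases h2.eq_or_lt with h2 | h2
      · exact (h.ne_of_mem ((hZ.mem_iff_infDist_zero hZn).2 h2.symm)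
          ((hW.mem_iff_infDist_zero hWn).2 h1.symm) rfl).elim
      · linarith
    · linarith
  refine ⟨fun x => Metric.infDist x W / (Metric.infDist x W + Metric.infDist x Z),
    (infDist W).div ((infDist W).add (infDist Z)) hp, fun x => ⟨?_, ?_⟩, fun x hx => ?_,
    fun x hx => ?_⟩
  · exact div_nonneg Metric.infDist_nonneg (hp x).le
  · exact (div_le_one (hp x)).2 (by linarith [Metric.infDist_nonneg (x := x) (s := Z)])
  · have := hp x
    beta_reduce
    rw [Metric.infDist_zero_of_mem hx, add_zero] at this ⊢
    exact div_self this.ne'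
  · simp [Metric.infDist_zero_of_mem hx]

end IsLip

theorem encard_le_of_finset_le {X : Type*} {S : Set X} {a : ℝ≥0∞}
    (h : ∀ F : Finset X, (F : Set X) ⊆ S → (F.card : ℝ≥0∞) ≤ a) : (S.encard : ℝ≥0∞) ≤ a := by
  by_cases hS : S.Finite
  · have := h hS.toFinset (by simp)
    rw [hS.encard_eq_coe_toFinset_card]
    simpa using this
  · have : a = ⊤ := by
      refine ENNReal.eq_top_of_forall_nnreal_le fun r => ?_
      obtain ⟨k, hk⟩ := exists_nat_ge r
      obtain ⟨F, hF, hFk⟩ := Set.Infinite.exists_subset_card_eq hS k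
      refine le_trans ?_ (h F hF)
      rw [hFk]
      exact_mod_cast hk
    simp [this]

/-- If a continuous map does not increase measure on sets of small diameter, then the
integral of its multiplicity is controlled. -/
theorem exists_multiplicity_majorant {X Y : Type*} [MetricSpace X]
    [TopologicalSpace.SeparableSpace X]
    [MeasurableSpace X] [BorelSpace X] [MetricSpace Y] [MeasurableSpace Y] [BorelSpace Y]
    (κ : Measure Y) (m : Measure X) (h : X → Y) (hh : Continuous h) {δ : ℝ} (hδ : 0 < δ)
    (hA : ∀ A : Set X, MeasurableSet A → (∀ x ∈ A, ∀ x' ∈ A, dist x x' ≤ δ) → κ (h '' A) ≤ m A)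
    {B : Set Y} (hB : MeasurableSet B) :
    ∃ G : Y → ℝ≥0∞, Measurable G ∧ (∀ y ∈ B, ((h ⁻¹' {y}).encard : ℝ≥0∞) ≤ G y) ∧
      ∫⁻ y, G y ∂κ ≤ m (h ⁻¹' B) := by
  have hpart : ∀ k : ℕ, ∃ As : ℕ → Set X, (∀ i, MeasurableSet (As i)) ∧
      (∀ i, ∀ x ∈ As i, ∀ x' ∈ As i, dist x x' ≤ δ / (k + 1)) ∧ (⋃ i, As i = univ) ∧
      Pairwise (fun i j => Disjoint (As i) (As j)) := by
    intro k
    obtain ⟨As, h1, h2, h3, h4, h5⟩ :=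
      SeparableSpace.exists_measurable_partition_diam_le X (ε := δ / (k + 1)) (by positivity)
    exact ⟨As, h1, fun i x hx x' hx' => (dist_le_diam_of_mem (h2 i) hx hx').trans (h3 i), h4, h5⟩
  choose As hm hd hU hdis using hpart
  have hBm : MeasurableSet (h ⁻¹' B) := hh.measurable hB
  set Gk : ℕ → Y → ℝ≥0∞ := fun k y =>
    ∑' i, (toMeasurable κ (h '' (As k i ∩ h ⁻¹' B))).indicator (fun _ => 1) y with hGk
  have hGm : ∀ k, Measurable (Gk k) := fun k => Measurable.tsum fun i =>
    measurable_const.indicator (measurableSet_toMeasurable _ _)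
  refine ⟨fun y => liminf (fun k => Gk k y) atTop, Measurable.liminf hGm, fun y hy => ?_, ?_⟩
  · refine encard_le_of_finset_le fun F hF => ?_
    refine le_liminf_of_le (by isBoundedDefault) ?_
    have hsep : ∀ᶠ k : ℕ in atTop, ∀ x ∈ F, ∀ x' ∈ F, x ≠ x' → δ / (k + 1) < dist x x' := by
      rw [Filter.eventually_all_finset]
      intro x hx
      rw [Filter.eventually_all_finset]
      intro x' hx'
      by_cases hne : x = x'
      · simp [hne]
      · have ht : Tendsto (fun k : ℕ => δ / ((k : ℝ) + 1)) atTop (𝓝 0) :=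
          tendsto_const_nhds.div_atTop
            (tendsto_atTop_add_const_right _ _ tendsto_natCast_atTop_atTop)
        filter_upwards [ht.eventually_lt_const (dist_pos.2 hne)] with k hk _ using hk
    filter_upwards [hsep] with k hk
    have hidx : ∀ x : X, ∃ i, x ∈ As k i := fun x => by
      have : x ∈ ⋃ i, As k i := by rw [hU]; trivial
      simpa using this
    choose idx hidx using hidx
    have hinj : Set.InjOn idx F := by
      intro x hx x' hx' hxx
      by_contra hne
      have h1 := hk x hx x' hx' hne
      have h2 := hd k (idx x) x (hidx x) x' (hxx ▸ hidx x')
      linarith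
    classical
    calc (F.card : ℝ≥0∞) = ∑ i ∈ F.image idx, 1 := by
          simp [Finset.card_image_of_injOn hinj]
      _ ≤ ∑ i ∈ F.image idx,
            (toMeasurable κ (h '' (As k i ∩ h ⁻¹' B))).indicator (fun _ => 1) y := by
          refine Finset.sum_le_sum fun i hi => ?_
          obtain ⟨x, hx, rfl⟩ := Finset.mem_image.1 hi
          have hxy : h x = y := hF hx
          rw [indicator_of_mem]
          exact subset_toMeasurable _ _ ⟨x, ⟨hidx x, by simpa [hxy] using hy⟩, hxy⟩
      _ ≤ Gk k y := ENNReal.sum_le_tsum _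
  · refine (lintegral_liminf_le hGm).trans ?_
    refine liminf_le_of_le (by isBoundedDefault) ?_
    intro b hb
    obtain ⟨k, hk⟩ := hb.exists
    refine hk.trans ?_
    rw [lintegral_tsum fun i =>
      (measurable_const.indicator (measurableSet_toMeasurable _ _)).aemeasurable]
    have : m (h ⁻¹' B) = ∑' i, m (As k i ∩ h ⁻¹' B) := by
      rw [← measure_iUnion]
      · rw [← iUnion_inter, hU, univ_inter]
      · intro i j hij
        exact (hdis k hij).mono inter_subset_left inter_subset_left
      · exact fun i => (hm k i).inter hBm
    rw [this]
    refine ENNReal.tsum_le_tsum fun i => ?_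
    rw [lintegral_indicator_const (measurableSet_toMeasurable _ _), one_mul, measure_toMeasurable]
    refine hA _ ((hm k i).inter hBm) fun x hx x' hx' => (hd k i x hx.1 x' hx'.1).trans ?_
    exact div_le_self hδ.le (by norm_cast; omega)

/-- Almost every fibre of a Lipschitz map from a space of finite measure is finite. -/
theorem IsLip.ae_finite_fiber {n : ℕ} {X Y : Type*} [MetricSpace X] [CompactSpace X]
    [MeasurableSpace X] [BorelSpace X] [MetricSpace Y] [MeasurableSpace Y] [BorelSpace Y]
    (hfin : μH[(n : ℝ)] (univ : Set X) < ⊤) {u : X → Y} (hu : IsLip u) :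
    ∀ᵐ y ∂(μH[(n : ℝ)] : Measure Y), (u ⁻¹' {y}).Finite := by
  obtain ⟨L, hL⟩ := hu
  obtain ⟨G, hGm, hG, hGi⟩ := exists_multiplicity_majorant (μH[(n : ℝ)] : Measure Y)
    ((L : ℝ≥0∞) ^ (n : ℝ) • (μH[(n : ℝ)] : Measure X)) u hL.continuous one_pos
    (fun A _ _ => by simpa using hL.hausdorffMeasure_image_le (Nat.cast_nonneg n) A)
    (B := univ) MeasurableSet.univ
  have : ∫⁻ y, G y ∂(μH[(n : ℝ)] : Measure Y) ≠ ⊤ := by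
    refine (hGi.trans_lt ?_).ne
    simp only [preimage_univ, Measure.smul_apply, smul_eq_mul]
    exact ENNReal.mul_lt_top (by simp) hfin
  filter_upwards [ae_lt_top hGm this] with y hy
  have := (hG y (mem_univ y)).trans_lt hy
  rw [← Set.encard_ne_top_iff]
  intro h
  simp [h] at this

/-- Multiplicity estimate for a map with a variable local Lipschitz constant. -/
theorem lintegral_multiplicity_le {n : ℕ} {X Y : Type*} [MetricSpace X] [CompactSpace X]
    [MeasurableSpace X] [BorelSpace X] [MetricSpace Y] [MeasurableSpace Y] [BorelSpace Y]
    {h : X → Y} {θ : X → ℝ} (hθ : Continuous θ) (hθ1 : ∀ x, 1 ≤ θ x) {a : ℝ} (ha : 0 ≤ a)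
    (hh : Continuous h)
    (hd : ∀ x x', dist (h x) (h x') ≤ a * θ x * dist x x') {B : Set Y} (hB : MeasurableSet B) :
    ∫⁻ y in B, ((h ⁻¹' {y}).encard : ℝ≥0∞) ∂(μH[(n : ℝ)] : Measure Y) ≤
      ENNReal.ofReal (2 * a) ^ n *
        ∫⁻ x in h ⁻¹' B, ENNReal.ofReal (θ x) ^ n ∂(μH[(n : ℝ)] : Measure X) := by
  have huc := CompactSpace.uniformContinuous_of_continuous hθ
  obtain ⟨δ, hδ, hδ'⟩ := Metric.uniformContinuous_iff.1 huc 1 one_pos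
  have hθm : Measurable fun x => ENNReal.ofReal (θ x) ^ n :=
    (hθ.measurable.ennreal_ofReal).pow_const n
  set m : Measure X := (ENNReal.ofReal (2 * a) ^ n) •
    (μH[(n : ℝ)] : Measure X).withDensity (fun x => ENNReal.ofReal (θ x) ^ n) with hmdef
  have hm : ∀ A, MeasurableSet A → m A = ENNReal.ofReal (2 * a) ^ n *
        ∫⁻ x in A, ENNReal.ofReal (θ x) ^ n ∂(μH[(n : ℝ)] : Measure X) := by
    intro A hA
    simp [m, withDensity_apply _ hA]
  obtain ⟨G, hGm, hG, hGi⟩ := exists_multiplicity_majorant (μH[(n : ℝ)] : Measure Y) m h hh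
    (half_pos hδ) (by
      intro A hA hAd
      rw [hm A hA]
      rcases A.eq_empty_or_nonempty with rfl | ⟨x0, hx0⟩
      · simp
      have hne : (θ '' A).Nonempty := ⟨_, x0, hx0, rfl⟩
      have hbdd : BddBelow (θ '' A) := ⟨1, by rintro _ ⟨x, -, rfl⟩; exact hθ1 x⟩
      set t := sInf (θ '' A) with ht
      have ht1 : 1 ≤ t := le_csInf hne (by rintro _ ⟨x, -, rfl⟩; exact hθ1 x)
      have htle : ∀ x ∈ A, t ≤ θ x := fun x hx => csInf_le hbdd ⟨x, hx, rfl⟩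
      have hθt : ∀ x ∈ A, θ x ≤ 2 * t := by
        intro x hx
        have : θ x - 1 ≤ t := by
          refine le_csInf hne ?_
          rintro _ ⟨x', hx', rfl⟩
          have := hδ' ((hAd x hx x' hx').trans_lt (half_lt_self hδ))
          rw [Real.dist_eq] at this
          linarith [(abs_lt.1 this).2]
        linarith
      have hL : LipschitzOnWith (2 * a * t).toNNReal h A := by
        refine LipschitzOnWith.of_dist_le_mul fun x hx x' hx' => (hd x x').trans ?_
        rw [Real.coe_toNNReal _ (by positivity)]
        gcongr ?_ * _
        nlinarith [hθt x hx]
      refine (hL.hausdorffMeasure_image_le (Nat.cast_nonneg n)).trans ?_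
      have e : ((2 * a * t).toNNReal : ℝ≥0∞) ^ (n : ℝ)
          = ENNReal.ofReal (2 * a) ^ n * ENNReal.ofReal t ^ n := by
        rw [ENNReal.rpow_natCast, ← mul_pow, ← ENNReal.ofReal_mul (by positivity)]
        rfl
      rw [e, mul_assoc]
      gcongr
      rw [← setLIntegral_const]
      refine setLIntegral_mono hθm fun x hx => ?_
      gcongr
      exact htle x hx) hB
  calc _ ≤ ∫⁻ y in B, G y ∂(μH[(n : ℝ)] : Measure Y) :=
        setLIntegral_mono hGm hG
    _ ≤ ∫⁻ y, G y ∂(μH[(n : ℝ)] : Measure Y) := setLIntegral_le_lintegral _ _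
    _ ≤ m (h ⁻¹' B) := hGi
    _ = _ := hm _ (hh.measurable hB)

section Mover

variable {E : Type*} [NormedAddCommGroup E] [NormedSpace ℝ E]

theorem exists_small_mover (σ : Set E) {δ : ℝ} (hδ : 0 < δ) {v : E} (hv : ‖v‖ < δ) :
    ∃ T : E → E, IsLip T ∧ Function.Injective T ∧ (∀ y, δ ≤ infDist y σ → T y = y) ∧
      (∀ y ∈ σ, T y = y + v) ∧ ∀ y, ‖T y - y‖ ≤ ‖v‖ := by
  set lam : E → ℝ := fun y => max 0 (1 - infDist y σ / δ) with hlam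
  have hl0 : ∀ y, 0 ≤ lam y := fun y => le_max_left _ _
  have hl1 : ∀ y, lam y ≤ 1 := fun y => max_le zero_le_one
    (sub_le_self _ (div_nonneg infDist_nonneg hδ.le))
  have hlip : ∀ y y', |lam y - lam y'| ≤ dist y y' / δ := by
    intro y y'
    have h1 := (lipschitz_infDist_pt σ).dist_le_mul y y'
    rw [NNReal.coe_one, one_mul, Real.dist_eq] at h1
    have h2 := abs_max_sub_max_le_max 0 (1 - infDist y σ / δ) 0 (1 - infDist y' σ / δ)
    refine h2.trans ?_
    have h3 : 1 - infDist y σ / δ - (1 - infDist y' σ / δ) = -((infDist y σ - infDist y' σ) / δ) := by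
      ring
    rw [h3, abs_neg, abs_div, abs_of_pos hδ, sub_zero, abs_zero]
    refine max_le (by positivity) ?_
    gcongr
  have hadd : ∀ y y', dist (lam y • v) (lam y' • v) ≤ ‖v‖ / δ * dist y y' := by
    intro y y'
    rw [dist_eq_norm, ← sub_smul, norm_smul, Real.norm_eq_abs]
    calc _ ≤ dist y y' / δ * ‖v‖ := by gcongr; exact hlip y y'
      _ = _ := by ring
  refine ⟨fun y => y + lam y • v, IsLip.add ⟨1, LipschitzWith.id⟩ (IsLip.of_dist_le _ hadd),
    fun y y' h => ?_, fun y hy => ?_, fun y hy => ?_, fun y => ?_⟩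
  · by_contra hne
    have h0 : 0 < dist y y' := dist_pos.2 hne
    have e : y - y' = lam y' • v - lam y • v := by
      have h : y + lam y • v = y' + lam y' • v := h
      rw [sub_eq_sub_iff_add_eq_add, h, add_comm]
    have h1 := hadd y' y
    rw [dist_eq_norm (lam y' • v), ← e, ← dist_eq_norm, dist_comm y' y] at h1
    have h2 : ‖v‖ / δ < 1 := (div_lt_one hδ).2 hv
    nlinarith
  · have : lam y = 0 := max_eq_left (by rw [sub_nonpos]; exact (one_le_div hδ).2 hy)
    simp [this]
  · have : lam y = 1 := by simp [hlam, infDist_zero_of_mem hy]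
    simp [this]
  · simp only [add_sub_cancel_left, norm_smul, Real.norm_eq_abs, abs_of_nonneg (hl0 y)]
    exact mul_le_of_le_one_left (norm_nonneg _) (hl1 y)

/-- A Lipschitz injection of a normed space moving `a` to `b` and supported near a set
containing the segment `[a, b]`. -/
theorem exists_mover {σ : Set E} {a b : E} (hσ : segment ℝ a b ⊆ σ) {δ : ℝ} (hδ : 0 < δ) :
    ∃ T : E → E, IsLip T ∧ Function.Injective T ∧ (∀ y, δ ≤ infDist y σ → T y = y) ∧
      T a = b ∧ ∀ y, ‖T y - y‖ ≤ ‖b - a‖ := by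
  obtain ⟨k, hk⟩ := exists_nat_gt (‖b - a‖ / δ)
  have hk0 : (0 : ℝ) < k := lt_of_le_of_lt (by positivity) hk
  set v : E := (k : ℝ)⁻¹ • (b - a) with hv
  have hvn : ‖v‖ = ‖b - a‖ / k := by
    rw [hv, norm_smul, norm_inv, Real.norm_natCast, div_eq_inv_mul]
  obtain ⟨T, hT, hinj, hoff, hon, hdisp⟩ := exists_small_mover σ hδ (v := v)
    (by rw [hvn, div_lt_comm₀ hk0 hδ]; exact hk)
  refine ⟨T^[k], ?_, hinj.iterate k, fun y hy => ?_, ?_, fun y => ?_⟩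
  · obtain ⟨C, hC⟩ := hT
    exact ⟨_, hC.iterate k⟩
  · exact Function.iterate_fixed (hoff y hy) k
  · have : ∀ j : ℕ, j ≤ k → T^[j] a = a + (j : ℝ) • v := by
      intro j
      induction j with
      | zero => simp
      | succ j ih =>
        intro hj
        rw [Function.iterate_succ_apply', ih (by omega), hon]
        · push_cast
          rw [add_smul, one_smul, add_assoc]
        · apply hσ
          have hjk : (j : ℝ) ≤ k := by exact_mod_cast (by omega : j ≤ k)
          refine ⟨1 - j / k, j / k, ?_, by positivity, by ring, ?_⟩
          · rw [sub_nonneg]; exact (div_le_one hk0).2 hjk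
          · rw [hv, smul_smul, ← div_eq_mul_inv, smul_sub, sub_smul, one_smul]
            abel
    rw [this k le_rfl, hv, smul_smul, mul_inv_cancel₀ hk0.ne', one_smul, add_sub_cancel]
  · have : ∀ j : ℕ, ‖T^[j] y - y‖ ≤ j * ‖v‖ := by
      intro j
      induction j with
      | zero => simp
      | succ j ih =>
        rw [Function.iterate_succ_apply']
        calc _ = ‖(T (T^[j] y) - T^[j] y) + (T^[j] y - y)‖ := by congr 1; abel
          _ ≤ ‖v‖ + j * ‖v‖ := (norm_add_le _ _).trans (add_le_add (hdisp _) ih)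
          _ = _ := by push_cast; ring
    refine (this k).trans (le_of_eq ?_)
    rw [hvn]
    field_simp

end Mover

/-- The value `y` can be avoided on `V` by a Lipschitz perturbation of `u` supported where
`u` is `r`-close to `y`. -/
def Removable {n : ℕ} {X : Type*} [MetricSpace X] (u : X → Fin n → ℝ) (V : Set X)
    (y : Fin n → ℝ) (r : ℝ) : Prop :=
  ∃ k : X → Fin n → ℝ, IsLip k ∧ ∃ r' : ℝ, 0 < r' ∧ r' < r ∧
    (∀ x ∈ V, u x ∈ ball y r' → k x ∈ ball y r' ∧ k x ≠ y) ∧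
    (∀ x, ¬ (x ∈ V ∧ u x ∈ ball y r') → k x = u x)

theorem Removable.mono {n : ℕ} {X : Type*} [MetricSpace X] {u : X → Fin n → ℝ} {V : Set X}
    {y : Fin n → ℝ} {r s : ℝ} (h : Removable u V y r) (hrs : r ≤ s) : Removable u V y s := by
  obtain ⟨k, hk, r', h1, h2, h3⟩ := h
  exact ⟨k, hk, r', h1, h2.trans_le hrs, h3⟩

/-- If no value along a broken arc from `u x₁` to `u x₀` is attained on a sphere of radius `t`
around `x₀` separating `x₀` from `x₁`, then the value `u x₀` is removable. -/
theorem removable_of_avoids {n : ℕ} {X : Type*} [MetricSpace X] [CompactSpace X]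
    {u : X → Fin n → ℝ} (hu : IsLip u) {p x₀ x₁ : X} {s t R : ℝ} {z : Fin n → ℝ}
    (hf0 : ∀ x', u x' = u x₀ → dist x' p ≤ s → x' = x₀)
    (hf1 : ∀ x', u x' = u x₁ → dist x' p ≤ s → x' = x₁)
    (hsph : ∀ x', dist (u x') (u x₀) ≤ R → dist x' p ≠ s)
    (hr0 : 0 < dist (u x₁) (u x₀)) (hrR : 8 * dist (u x₁) (u x₀) ≤ R)
    (hz : dist z (u x₀) ≤ dist (u x₁) (u x₀))
    (ht0 : 0 < t) (htD : t < dist x₁ x₀)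
    (hav : ∀ x, dist x p ≤ s → dist x x₀ = t →
      u x ∉ segment ℝ (u x₁) z ∧ u x ∉ segment ℝ z (u x₀)) :
    Removable u (ball p s) (u x₀) R := by
  set y₀ := u x₀ with hy0
  set y₁ := u x₁ with hy1
  set r := dist y₁ y₀ with hr
  set σ : Set (Fin n → ℝ) := segment ℝ y₁ z ∪ segment ℝ z y₀ with hσ
  have hy0σ : y₀ ∈ σ := Or.inr (right_mem_segment ℝ _ _)
  have hσball : σ ⊆ closedBall y₀ r := by
    have c := convex_closedBall y₀ r
    have m0 : y₀ ∈ closedBall y₀ r := mem_closedBall_self hr0.le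
    have m1 : y₁ ∈ closedBall y₀ r := mem_closedBall.2 le_rfl
    have mz : z ∈ closedBall y₀ r := mem_closedBall.2 hz
    exact union_subset (c.segment_subset m1 mz) (c.segment_subset mz m0)
  have hσc : IsCompact σ := by
    have hs : ∀ a b : Fin n → ℝ, IsCompact (segment ℝ a b) := fun a b => by
      rw [segment_eq_image_lineMap]
      exact isCompact_Icc.image (AffineMap.lineMap_continuous)
    exact (hs _ _).union (hs _ _)
  have hσn : σ.Nonempty := ⟨y₀, hy0σ⟩
  have hinf : ∀ y, infDist y σ < r → dist y y₀ < 2 * r := by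
    intro y hy
    obtain ⟨w, hw, hyw⟩ := (infDist_lt_iff hσn).1 hy
    have := hσball hw
    rw [mem_closedBall] at this
    linarith [dist_triangle y w y₀]
  -- a uniform distance between `σ` and the image of the separating sphere
  obtain ⟨δ, hδ, hδr, hδW⟩ : ∃ δ : ℝ, 0 < δ ∧ δ < r ∧
      ∀ x, dist x p ≤ s → dist x x₀ = t → δ < infDist (u x) σ := by
    set W : Set X := {x | dist x p ≤ s} ∩ {x | dist x x₀ = t} with hW
    have hWc : IsCompact W := ((isClosed_le (by fun_prop) continuous_const).inter
      (isClosed_eq (by fun_prop) continuous_const)).isCompact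
    rcases W.eq_empty_or_nonempty with hWe | hWn
    · refine ⟨r / 2, by linarith, by linarith, fun x hx hx' => ?_⟩
      have : x ∈ W := ⟨hx, hx'⟩
      simp [hWe] at this
    · obtain ⟨x, hx, hmin⟩ := hWc.exists_isMinOn hWn
        ((continuous_infDist_pt σ).comp hu.continuous).continuousOn
      have hpos : 0 < infDist (u x) σ := by
        refine (hσc.isClosed.notMem_iff_infDist_pos hσn).1 ?_
        rintro (h | h)
        · exact (hav x hx.1 hx.2).1 h
        · exact (hav x hx.1 hx.2).2 h
      refine ⟨min (r / 2) (infDist (u x) σ / 2), by positivity,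
        (min_le_left _ _).trans_lt (by linarith), fun x' hx' hx'' => ?_⟩
      have h2 : infDist (u x) σ ≤ infDist (u x') σ := hmin (show x' ∈ W from ⟨hx', hx''⟩)
      refine (min_le_right _ _).trans_lt ?_
      linarith
  obtain ⟨T1, hT1, hinj1, hoff1, hab1, hdisp1⟩ :=
    exists_mover (σ := σ) (a := y₁) (b := z) subset_union_left hδ
  obtain ⟨T2, hT2, hinj2, hoff2, hab2, hdisp2⟩ :=
    exists_mover (σ := σ) (a := z) (b := y₀) subset_union_right hδ
  set T : (Fin n → ℝ) → Fin n → ℝ := fun y => T2 (T1 y) with hT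
  have hoff : ∀ y, δ ≤ infDist y σ → T y = y := fun y hy => by
    simp only [hT, hoff1 y hy, hoff2 y hy]
  have hTinj : Function.Injective T := hinj2.comp hinj1
  have hT10 : T y₁ = y₀ := by simp only [hT, hab1, hab2]
  have hdisp : ∀ y, dist (T y) y ≤ 3 * r := by
    intro y
    have e1 := hdisp2 (T1 y)
    have e2 := hdisp1 y
    rw [← dist_eq_norm, ← dist_eq_norm] at e1 e2
    have h3 : dist z y₁ ≤ 2 * r := by
      have := dist_triangle z y₀ y₁
      rw [dist_comm y₀ y₁] at this
      linarith
    rw [dist_comm y₀ z] at e1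
    linarith [dist_triangle (T y) (T1 y) y]
  -- the cutoff
  have hcont : Continuous fun x => infDist (u x) σ :=
    (continuous_infDist_pt σ).comp hu.continuous
  obtain ⟨χ, hχ, -, hχ1, hχ0⟩ := IsLip.exists_cutoff
    (Z := ({x | dist x p ≤ s} ∩ {x | dist x x₀ ≤ t}) ∩ {x | infDist (u x) σ ≤ δ})
    (W := ({x | s ≤ dist x p} ∪ {x | t ≤ dist x x₀}) ∩ {x | infDist (u x) σ ≤ δ})
    (((isClosed_le (by fun_prop) continuous_const).inter
      (isClosed_le (by fun_prop) continuous_const)).inter (isClosed_le hcont continuous_const))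
    (((isClosed_le continuous_const (by fun_prop)).union
      (isClosed_le continuous_const (by fun_prop))).inter (isClosed_le hcont continuous_const))
    (by
      rw [Set.disjoint_left]
      rintro x ⟨⟨h1, h2⟩, h3⟩ ⟨h4 | h4, -⟩
      · exact hsph x (by linarith [hinf (u x) (h3.trans_lt hδr)]) (le_antisymm h1 h4)
      · exact (hδW x h1 (le_antisymm h2 h4)).not_ge h3)
  refine ⟨fun x => u x + χ x • (T (u x) - u x),
    hu.add (hχ.smul (((hT2.comp hT1).comp hu).sub hu)), 6 * r, by linarith, by linarith, ?_, ?_⟩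
  · intro x hxV hux
    rw [mem_ball] at hxV hux
    beta_reduce
    by_cases hx : infDist (u x) σ ≤ δ
    · by_cases hxt : dist x x₀ ≤ t
      · rw [hχ1 x ⟨⟨hxV.le, hxt⟩, hx⟩, one_smul, add_sub_cancel]
        constructor
        · rw [mem_ball]
          have h1 := hinf (u x) (hx.trans_lt hδr)
          linarith [dist_triangle (T (u x)) (u x) y₀, hdisp (u x)]
        · rw [← hT10]
          intro h
          have h2 := hf1 x (hTinj h) hxV.le
          rw [h2] at hxt
          linarith
      · rw [hχ0 x ⟨Or.inr (not_le.1 hxt).le, hx⟩, zero_smul, add_zero]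
        refine ⟨hux, fun h => hxt ?_⟩
        rw [hf0 x h hxV.le, dist_self]
        exact ht0.le
    · rw [hoff _ (not_le.1 hx).le, sub_self, smul_zero, add_zero]
      refine ⟨hux, fun h => hx ?_⟩
      rw [h, infDist_zero_of_mem hy0σ]
      exact hδ.le
  · intro x hx
    by_cases hx' : infDist (u x) σ ≤ δ
    · have h1 := hinf (u x) (hx'.trans_lt hδr)
      have hxV : x ∉ ball p s := fun h => hx ⟨h, by rw [mem_ball]; linarith⟩
      rw [mem_ball, not_lt] at hxV
      simp only [hχ0 x ⟨Or.inl hxV, hx'⟩, zero_smul, add_zero]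
    · simp only [hoff _ (not_le.1 hx').le, sub_self, smul_zero, add_zero]

/-- Directional coordinates of `u x - y` together with the distance to `x₀`. -/
def slopeMap {n : ℕ} {X : Type*} [MetricSpace X] (u : X → Fin n → ℝ) (y : Fin n → ℝ) (x₀ : X)
    (i : Fin n) (e : ℝ) (b : Fin n → ℝ) (x : X) : Fin n → ℝ :=
  fun l => if l = i then dist x x₀ else e * ((u x l - y l) / (u x i - y i)) + b l

theorem abs_div_sub_div_le {a b a' b' s d : ℝ} (hs : 0 < s) (hb : s / 2 ≤ |b|)
    (hb' : s / 2 ≤ |b'|) (ha' : |a'| ≤ 2 * |b'|) (h1 : |a - a'| ≤ d) (h2 : |b - b'| ≤ d) :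
    |s * (a / b) - s * (a' / b')| ≤ 6 * d := by
  have hb0 : 0 < |b| := by linarith
  have hb0' : 0 < |b'| := by linarith
  have hbn : b ≠ 0 := abs_pos.1 hb0
  have hbn' : b' ≠ 0 := abs_pos.1 hb0'
  have e : s * (a / b) - s * (a' / b') = (s / b) * ((a - a') - (a' / b') * (b - b')) := by
    field_simp
    ring
  rw [e, abs_mul, abs_div, abs_of_pos hs]
  have h3 : s / |b| ≤ 2 := by rw [div_le_iff₀ hb0]; linarith
  have h4 : |a' / b'| ≤ 2 := by rw [abs_div, div_le_iff₀ hb0']; exact ha'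
  have h5 : |a - a' - a' / b' * (b - b')| ≤ d + 2 * d := by
    refine (abs_sub _ _).trans ?_
    rw [abs_mul]
    gcongr
  calc _ ≤ 2 * (d + 2 * d) := by gcongr
    _ = _ := by ring

theorem volume_image_diagonal {n : ℕ} (i : Fin n) {s : ℝ} (hs : 0 < s) (S : Set (Fin n → ℝ)) :
    volume ((fun w : Fin n → ℝ => fun l => (if l = i then 1 else s⁻¹) * w l) '' S) =
      ENNReal.ofReal (s * s⁻¹ ^ n) * volume S := by
  set d : Fin n → ℝ := fun l => if l = i then 1 else s⁻¹ with hd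
  have h := Measure.addHaar_image_linearMap (volume : Measure (Fin n → ℝ))
    (Matrix.toLin' (Matrix.diagonal d)) S
  have e : (fun w : Fin n → ℝ => fun l => d l * w l) = Matrix.toLin' (Matrix.diagonal d) := by
    ext w l
    simp [Matrix.mulVec_diagonal]
  rw [← e, LinearMap.det_toLin', Matrix.det_diagonal] at h
  have hp : ∏ l, d l = s * s⁻¹ ^ n := by
    have : ∀ l, d l = (if l = i then s else 1) * s⁻¹ := by
      intro l
      simp only [hd]
      split_ifs
      · rw [mul_inv_cancel₀ hs.ne']
      · rw [one_mul]
    simp only [this, Finset.prod_mul_distrib]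
    simp
  rw [hp, abs_of_pos (by positivity)] at h
  exact h

theorem volume_slopeMap_image_le {n : ℕ} {X : Type*} [MetricSpace X]
    [MeasurableSpace X] [BorelSpace X] {u : X → Fin n → ℝ} {L : ℝ} (hL : 0 < L)
    (hu : ∀ x x', dist (u x) (u x') ≤ L * dist x x') (y : Fin n → ℝ) (x₀ : X) (i : Fin n)
    {e : ℝ} (he : |e| ≤ 1) (b : Fin n → ℝ) {M : ℝ} (hM : 0 ≤ M)
    (hν : ∀ ρ : ℝ, 0 < ρ → μH[(n : ℝ)] (u ⁻¹' closedBall y ρ) ≤ ENNReal.ofReal (M * ρ ^ n))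
    {r : ℝ} (hr : 0 < r) :
    volume (slopeMap u y x₀ i e b '' {x | (0 < |u x i - y i| ∧ |u x i - y i| ≤ r) ∧
      ∀ l, |u x l - y l| ≤ 2 * |u x i - y i|}) ≤
      ENNReal.ofReal (2 * (2 * max (6 * L) 1) ^ n * M * r) := by
  set C := max (6 * L) 1 with hC
  have hC0 : 0 < C := lt_max_of_lt_right one_pos
  set sh : ℕ → Set X := fun k => {x | (r * (1 / 2) ^ k / 2 < |u x i - y i| ∧
    |u x i - y i| ≤ r * (1 / 2) ^ k) ∧ ∀ l, |u x l - y l| ≤ 2 * |u x i - y i|} with hsh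
  have hcov : {x | (0 < |u x i - y i| ∧ |u x i - y i| ≤ r) ∧
      ∀ l, |u x l - y l| ≤ 2 * |u x i - y i|} ⊆ ⋃ k, sh k := by
    rintro x ⟨⟨h0, h1⟩, h2⟩
    have hex : ∃ k : ℕ, r * (1 / 2) ^ k / 2 < |u x i - y i| := by
      obtain ⟨k, hk⟩ := exists_pow_lt_of_lt_one (div_pos h0 hr) (show (1 / 2 : ℝ) < 1 by norm_num)
      refine ⟨k, ?_⟩
      rw [lt_div_iff₀ hr] at hk
      have : 0 < r * (1 / 2 : ℝ) ^ k := by positivity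
      linarith
    classical
    refine mem_iUnion.2 ⟨Nat.find hex, ⟨Nat.find_spec hex, ?_⟩, h2⟩
    rcases hk : Nat.find hex with _ | k
    · simpa using h1
    · have := Nat.find_min hex (m := k) (by omega)
      rw [not_lt] at this
      rw [pow_succ]
      linarith
  have hshell : ∀ k, volume (slopeMap u y x₀ i e b '' sh k) ≤
      ENNReal.ofReal ((2 * C) ^ n * M * r * (1 / 2) ^ k) := by
    intro k
    set s : ℝ := r * (1 / 2) ^ k with hs
    have hs0 : 0 < s := by positivity
    set Ψ : X → Fin n → ℝ := fun x l =>
      if l = i then dist x x₀ else s * slopeMap u y x₀ i e b x l with hΨ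
    have himg : slopeMap u y x₀ i e b '' sh k =
        (fun w : Fin n → ℝ => fun l => (if l = i then 1 else s⁻¹) * w l) '' (Ψ '' sh k) := by
      rw [image_image]
      congr 1
      ext x l
      by_cases hl : l = i
      · simp [hΨ, hl, slopeMap]
      · simp only [hΨ, hl, if_false]
        rw [inv_mul_cancel_left₀ hs0.ne']
    have hLip : LipschitzOnWith C.toNNReal Ψ (sh k) := by
      refine LipschitzOnWith.of_dist_le_mul fun x hx x' hx' => ?_
      rw [Real.coe_toNNReal _ hC0.le]
      refine (dist_pi_le_iff (by positivity)).2 fun l => ?_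
      have hco : ∀ l, |(u x l - y l) - (u x' l - y l)| ≤ L * dist x x' := fun l => by
        rw [sub_sub_sub_cancel_right, ← Real.dist_eq]
        exact (dist_le_pi_dist _ _ l).trans (hu x x')
      by_cases hl : l = i
      · simp only [hΨ, hl, if_true]
        calc dist (dist x x₀) (dist x' x₀) ≤ 1 * dist x x' := by
              rw [one_mul]; exact dist_dist_dist_le_left _ _ _
          _ ≤ C * dist x x' := by gcongr; exact le_max_right _ _
      · have h6 := abs_div_sub_div_le hs0 hx.1.1.le hx'.1.1.le (hx'.2 l) (hco l) (hco i)
        simp only [hΨ, hl, if_false, slopeMap]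
        rw [Real.dist_eq]
        have e1 : s * (e * ((u x l - y l) / (u x i - y i)) + b l) -
            s * (e * ((u x' l - y l) / (u x' i - y i)) + b l) =
            e * (s * ((u x l - y l) / (u x i - y i)) -
              s * ((u x' l - y l) / (u x' i - y i))) := by ring
        rw [e1, abs_mul]
        calc _ ≤ 1 * (6 * (L * dist x x')) := by gcongr
          _ = (6 * L) * dist x x' := by ring
          _ ≤ C * dist x x' := by gcongr; exact le_max_left _ _
    rw [himg, volume_image_diagonal i hs0]
    have hvol : volume (Ψ '' sh k) ≤ ENNReal.ofReal (C ^ n * (M * (2 * s) ^ n)) := by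
      rw [← hausdorffMeasure_pi_real, Fintype.card_fin]
      refine (hLip.hausdorffMeasure_image_le (Nat.cast_nonneg n)).trans ?_
      rw [ENNReal.ofReal_mul (by positivity), ENNReal.rpow_natCast, ENNReal.ofReal_pow hC0.le]
      gcongr
      · exact le_rfl
      refine (measure_mono ?_).trans (hν (2 * s) (by positivity))
      intro x hx
      rw [mem_preimage, mem_closedBall, dist_pi_le_iff (by positivity)]
      intro l
      rw [Real.dist_eq]
      linarith [hx.2 l, hx.1.2]
    calc _ ≤ ENNReal.ofReal (s * s⁻¹ ^ n) * ENNReal.ofReal (C ^ n * (M * (2 * s) ^ n)) := by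
          gcongr
      _ = ENNReal.ofReal ((2 * C) ^ n * M * r * (1 / 2) ^ k) := by
          rw [← ENNReal.ofReal_mul (by positivity)]
          congr 1
          have : s⁻¹ ^ n * s ^ n = 1 := by rw [← mul_pow, inv_mul_cancel₀ hs0.ne', one_pow]
          calc _ = (s⁻¹ ^ n * s ^ n) * (2 ^ n * C ^ n * M * s) := by rw [mul_pow]; ring
            _ = _ := by rw [this, hs, mul_pow]; ring
  calc _ ≤ volume (⋃ k, slopeMap u y x₀ i e b '' sh k) := by
        rw [← image_iUnion]
        exact measure_mono (image_mono hcov)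
    _ ≤ ∑' k, volume (slopeMap u y x₀ i e b '' sh k) := measure_iUnion_le _
    _ ≤ ∑' k : ℕ, ENNReal.ofReal ((2 * C) ^ n * M * r * (1 / 2) ^ k) :=
        ENNReal.tsum_le_tsum hshell
    _ = ENNReal.ofReal (2 * (2 * C) ^ n * M * r) := by
        rw [← ENNReal.ofReal_tsum_of_nonneg (fun k => by positivity)
          (summable_geometric_two.mul_left _), tsum_mul_left, tsum_geometric_two]
        congr 1
        ring

/-- The points which are alone in their fibre in `closedBall p s`, but whose value is not
removable on `ball p s`, with quantitative parameters. -/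
def stuckSet {n : ℕ} {X : Type*} [MetricSpace X] [MeasurableSpace X] [BorelSpace X]
    (u : X → Fin n → ℝ) (p : X) (s R M : ℝ) : Set X :=
  {x | dist x p < s ∧ (∀ x', u x' = u x → dist x' p ≤ s → x' = x) ∧
    (∀ x', dist (u x') (u x) ≤ R → dist x' p ≠ s) ∧ ¬ Removable u (ball p s) (u x) R ∧
    ∀ ρ : ℝ, 0 < ρ → μH[(n : ℝ)] (u ⁻¹' closedBall (u x) ρ) ≤ ENNReal.ofReal (M * ρ ^ n)}

theorem dist_le_of_mem_stuckSet {n : ℕ} {X : Type*} [MetricSpace X] [CompactSpace X]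
    [MeasurableSpace X] [BorelSpace X] {u : X → Fin n → ℝ} {L : ℝ} (hL : 0 < L)
    (hu : ∀ x x', dist (u x) (u x') ≤ L * dist x x') {p : X} {s R M : ℝ} (hM : 0 ≤ M)
    {x₀ x₁ : X} (h0 : x₀ ∈ stuckSet u p s R M) (h1 : x₁ ∈ stuckSet u p s R M)
    (hR : 8 * dist (u x₁) (u x₀) ≤ R) :
    dist x₁ x₀ ≤ 4 * (2 * max (6 * L) 1) ^ n * M * dist (u x₁) (u x₀) := by
  obtain ⟨h0p, h0f, h0s, h0r, h0ν⟩ := h0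
  obtain ⟨h1p, h1f, h1s, h1r, h1ν⟩ := h1
  set y₀ := u x₀ with hy0
  set y₁ := u x₁ with hy1
  rcases (dist_nonneg (x := x₁) (y := x₀)).eq_or_lt with hD0 | hD0
  · rw [← hD0]; positivity
  have hr0 : 0 < dist y₁ y₀ := by
    refine dist_pos.2 fun h => ?_
    rw [h0f x₁ h h1p.le, dist_self] at hD0
    exact lt_irrefl _ hD0
  set r := dist y₁ y₀ with hr
  set D := dist x₁ x₀ with hD
  obtain ⟨i, hi⟩ : ∃ i, |y₁ i - y₀ i| = r := by
    by_contra! h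
    have : dist y₁ y₀ < r := (dist_pi_lt_iff hr0).2 fun i =>
      lt_of_le_of_ne (dist_le_pi_dist _ _ i) (by rw [Real.dist_eq]; exact h i)
    exact lt_irrefl _ this
  set a := y₁ i - y₀ i with ha
  have ha0 : a ≠ 0 := by rw [← abs_pos, hi]; exact hr0
  set c : Fin n → ℝ := fun l => (y₁ l - y₀ l) / a with hc
  have hca : ∀ l, c l * a = y₁ l - y₀ l := fun l => div_mul_cancel₀ _ ha0
  have hc1 : ∀ l, |c l| ≤ 1 := fun l => by
    rw [hc, abs_div, hi, div_le_one hr0, ← Real.dist_eq]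
    exact dist_le_pi_dist _ _ l
  set A : (Fin n → ℝ) → Set X := fun y => {x | (0 < |u x i - y i| ∧ |u x i - y i| ≤ r) ∧
      ∀ l, |u x l - y l| ≤ 2 * |u x i - y i|} with hA
  set lo : Fin n → ℝ := fun l => if l = i then 0 else c l - 1 with hlo
  set hi' : Fin n → ℝ := fun l => if l = i then D else c l + 1 with hhi
  have hsub : (Set.pi univ fun l => Ioo (lo l) (hi' l)) ⊆
      slopeMap u y₀ x₀ i 1 0 '' A y₀ ∪ slopeMap u y₁ x₀ i (-1) (fun l => 2 * c l) '' A y₁ := by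
    intro w hw
    have hwi : 0 < w i ∧ w i < D := by simpa [hlo, hhi] using hw i (mem_univ i)
    have hwl : ∀ l, l ≠ i → c l - 1 < w l ∧ w l < c l + 1 := fun l hl => by
      simpa [hlo, hhi, hl] using hw l (mem_univ l)
    set κ : Fin n → ℝ := fun l => if l = i then 1 else w l with hκ
    have hκi : κ i = 1 := by simp [hκ]
    have hκl : ∀ l, l ≠ i → κ l = w l := fun l hl => by simp [hκ, hl]
    have hci : c i = 1 := div_self ha0
    have hκ1 : ∀ l, |κ l| ≤ 2 := by
      intro l
      have := abs_le.1 (hc1 l)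
      rcases eq_or_ne l i with rfl | hl
      · rw [hκi]; norm_num
      · rw [hκl l hl, abs_le]
        constructor <;> linarith [hwl l hl]
    have hκ2 : ∀ l, |κ l - 2 * c l| ≤ 2 := by
      intro l
      have := abs_le.1 (hc1 l)
      rcases eq_or_ne l i with rfl | hl
      · rw [hκi, hci]; norm_num
      · rw [hκl l hl, abs_le]
        constructor <;> linarith [hwl l hl]
    set z : Fin n → ℝ := fun l => y₀ l + κ l * (a / 2) with hz
    have hza : ∀ l, z l - y₀ l = κ l * (a / 2) := fun l => by simp [hz]
    have hzb : ∀ l, z l - y₁ l = (κ l - 2 * c l) * (a / 2) := fun l => by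
      have := hca l
      have := hza l
      linarith
    have hz0 : dist z y₀ ≤ r := by
      refine (dist_pi_le_iff hr0.le).2 fun l => ?_
      rw [Real.dist_eq, hza, abs_mul, abs_div, hi, abs_two]
      calc _ ≤ 2 * (r / 2) := by gcongr; exact hκ1 l
        _ = r := by ring
    obtain ⟨x, hxp, hxt, hx⟩ : ∃ x, dist x p ≤ s ∧ dist x x₀ = w i ∧
        (u x ∈ segment ℝ y₁ z ∨ u x ∈ segment ℝ z y₀) := by
      by_contra! h
      exact h0r (removable_of_avoids (IsLip.of_dist_le L hu) h0f h1f h0s hr0 hR hz0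
        hwi.1 hwi.2 h)
    have hxne0 : u x ≠ y₀ := fun h => by
      rw [h0f x h hxp, dist_self] at hxt
      exact hwi.1.ne hxt
    have hxne1 : u x ≠ y₁ := fun h => by
      rw [h1f x h hxp] at hxt
      exact hwi.2.ne hxt.symm
    rcases hx with ⟨α, β, hα, hβ, hαβ, hx⟩ | ⟨α, β, hα, hβ, hαβ, hx⟩
    · right
      have hxl : ∀ l, u x l - y₁ l = β * ((κ l - 2 * c l) * (a / 2)) := fun l => by
        rw [← hzb, ← hx]
        simp only [Pi.add_apply, Pi.smul_apply, smul_eq_mul]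
        linear_combination (y₁ l) * hαβ
      have hβ0 : 0 < β := by
        refine hβ.lt_of_ne fun h => hxne1 ?_
        ext l
        have := hxl l
        rw [← h, zero_mul] at this
        linarith
      have hβ1 : β ≤ 1 := by linarith
      have hxi : |u x i - y₁ i| = β * (r / 2) := by
        rw [hxl, hκi, hci, abs_mul, abs_of_pos hβ0, abs_mul, abs_div, hi]
        norm_num
      refine ⟨x, ⟨⟨?_, ?_⟩, fun l => ?_⟩, ?_⟩
      · rw [hxi]; positivity
      · rw [hxi]; nlinarith
      · rw [hxi, hxl, abs_mul, abs_of_pos hβ0, abs_mul, abs_div, hi, abs_two]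
        calc _ ≤ β * (2 * (r / 2)) := by gcongr; exact hκ2 l
          _ = _ := by ring
      · ext l
        rcases eq_or_ne l i with rfl | hl
        · simp [slopeMap, hxt]
        · simp only [slopeMap, hl, if_false]
          rw [hxl, hxl, hκi, hci, ← hκl l hl]
          field_simp
          ring
    · left
      have hxl : ∀ l, u x l - y₀ l = α * (κ l * (a / 2)) := fun l => by
        rw [← hza, ← hx]
        simp only [Pi.add_apply, Pi.smul_apply, smul_eq_mul]
        linear_combination (y₀ l) * hαβ
      have hα0 : 0 < α := by
        refine hα.lt_of_ne fun h => hxne0 ?_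
        ext l
        have := hxl l
        rw [← h, zero_mul] at this
        linarith
      have hα1 : α ≤ 1 := by linarith
      have hxi : |u x i - y₀ i| = α * (r / 2) := by
        rw [hxl, hκi, abs_mul, abs_of_pos hα0, abs_mul, abs_div, hi]
        norm_num
      refine ⟨x, ⟨⟨?_, ?_⟩, fun l => ?_⟩, ?_⟩
      · rw [hxi]; positivity
      · rw [hxi]; nlinarith
      · rw [hxi, hxl, abs_mul, abs_of_pos hα0, abs_mul, abs_div, hi, abs_two]
        calc _ ≤ α * (2 * (r / 2)) := by gcongr; exact hκ1 l
          _ = _ := by ring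
      · ext l
        rcases eq_or_ne l i with rfl | hl
        · simp [slopeMap, hxt]
        · simp only [slopeMap, hl, if_false]
          rw [hxl, hxl, hκi, ← hκl l hl, Pi.zero_apply]
          field_simp
          ring
  have hvol : ENNReal.ofReal D ≤ volume (Set.pi univ fun l => Ioo (lo l) (hi' l)) := by
    rw [Real.volume_pi_Ioo, ← Finset.mul_prod_erase _ _ (Finset.mem_univ i)]
    have e : hi' i - lo i = D := by simp [hlo, hhi]
    rw [e]
    refine le_mul_of_one_le_right (zero_le) (Finset.one_le_prod' fun l hl => ?_)
    have e : hi' l - lo l = 2 := by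
      simp only [hlo, hhi, Finset.ne_of_mem_erase hl, if_false]
      ring
    rw [e]
    simp
  have hK : 0 ≤ 2 * (2 * max (6 * L) 1) ^ n * M * r := by positivity
  have := (hvol.trans (measure_mono hsub)).trans ((measure_union_le _ _).trans (add_le_add
    (volume_slopeMap_image_le hL hu y₀ x₀ i (by simp) 0 hM h0ν hr0)
    (volume_slopeMap_image_le hL hu y₁ x₀ i (by simp) (fun l => 2 * c l) hM h1ν hr0)))
  rw [← ENNReal.ofReal_add hK hK, ENNReal.ofReal_le_ofReal_iff (by positivity)] at this
  linarith

/-- On each stuck set, `u` has a Lipschitz inverse. -/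
theorem exists_dist_le_of_mem_stuckSet {n : ℕ} {X : Type*} [MetricSpace X] [CompactSpace X]
    [MeasurableSpace X] [BorelSpace X] {u : X → Fin n → ℝ} (hu : IsLip u)
    (p : X) (s : ℝ) {R M : ℝ} (hR : 0 < R) (hM : 0 ≤ M) :
    ∃ C : ℝ, 0 ≤ C ∧ ∀ x₀ ∈ stuckSet u p s R M, ∀ x₁ ∈ stuckSet u p s R M,
      dist x₁ x₀ ≤ C * dist (u x₁) (u x₀) := by
  obtain ⟨L, hL, huL⟩ := hu.exists_pos
  refine ⟨max (4 * (2 * max (6 * L) 1) ^ n * M) (diam (univ : Set X) * (8 / R)),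
    le_max_of_le_left (by positivity), fun x₀ h0 x₁ h1 => ?_⟩
  rcases le_or_gt (8 * dist (u x₁) (u x₀)) R with h | h
  · refine (dist_le_of_mem_stuckSet hL huL hM h0 h1 h).trans ?_
    gcongr
    exact le_max_left _ _
  · have hd := dist_le_diam_of_mem (isCompact_univ (X := X)).isBounded (mem_univ x₁) (mem_univ x₀)
    have h1 : 1 ≤ 8 / R * dist (u x₁) (u x₀) := by
      rw [div_mul_eq_mul_div, one_le_div hR]
      exact h.le
    calc _ ≤ diam (univ : Set X) * 1 := by rw [mul_one]; exact hd
      _ ≤ diam (univ : Set X) * (8 / R * dist (u x₁) (u x₀)) := by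
        gcongr
      _ = (diam (univ : Set X) * (8 / R)) * dist (u x₁) (u x₀) := by ring
      _ ≤ _ := by gcongr; exact le_max_right _ _

theorem PurelyUnrectifiable.measure_inter_eq_zero {n : ℕ} {X : Type*} [MetricSpace X]
    [MeasurableSpace X] [BorelSpace X] {P : Set X} (hP : PurelyUnrectifiable n P)
    {u : X → Fin n → ℝ} {S : Set X} {C : ℝ} (hC : 0 ≤ C)
    (h : ∀ x₀ ∈ S, ∀ x₁ ∈ S, dist x₁ x₀ ≤ C * dist (u x₁) (u x₀)) :
    μH[(n : ℝ)] (P ∩ S) = 0 := by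
  classical
  rcases isEmpty_or_nonempty X with hX | hX
  · rw [eq_empty_of_isEmpty (P ∩ S), measure_empty]
  set φ : EuclideanSpace ℝ (Fin n) → X := fun e =>
    if h : ∃ x ∈ S, WithLp.toLp 2 (u x) = e then h.choose else Classical.arbitrary X with hφ
  have hφs : ∀ e, (∃ x ∈ S, WithLp.toLp 2 (u x) = e) → φ e ∈ S ∧ WithLp.toLp 2 (u (φ e)) = e := by
    intro e he
    simp only [hφ, dif_pos he]
    exact he.choose_spec
  have hlip : LipschitzOnWith C.toNNReal φ ((fun x => WithLp.toLp 2 (u x)) '' S) := by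
    refine LipschitzOnWith.of_dist_le_mul fun e he e' he' => ?_
    obtain ⟨h1, h2⟩ := hφs e he
    obtain ⟨h1', h2'⟩ := hφs e' he'
    rw [Real.coe_toNNReal _ hC]
    refine (h _ h1' _ h1).trans ?_
    gcongr
    have h3 := (PiLp.lipschitzWith_ofLp 2 (fun _ : Fin n => ℝ)).dist_le_mul
      (WithLp.toLp 2 (u (φ e))) (WithLp.toLp 2 (u (φ e')))
    rw [NNReal.coe_one, one_mul] at h3
    have h4 : dist (u (φ e)) (u (φ e')) ≤
      dist (WithLp.toLp 2 (u (φ e))) (WithLp.toLp 2 (u (φ e'))) := h3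
    rwa [h2, h2'] at h4
  refine measure_mono_null (inter_subset_inter_right P ?_) (hP _ φ _ hlip)
  intro x hx
  refine ⟨WithLp.toLp 2 (u x), ⟨x, hx, rfl⟩, ?_⟩
  obtain ⟨h1, h2⟩ := hφs (WithLp.toLp 2 (u x)) ⟨x, hx, rfl⟩
  have h3 : u (φ (WithLp.toLp 2 (u x))) = u x := (WithLp.toLp_injective 2) h2
  have h4 := h x hx _ h1
  rw [h3, dist_self, mul_zero] at h4
  exact dist_le_zero.1 h4

theorem dist_le_of_mem_closure {X E : Type*} [MetricSpace X] [MetricSpace E] {u : X → E}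
    (hu : Continuous u) {S : Set X} {C : ℝ}
    (h : ∀ x₀ ∈ S, ∀ x₁ ∈ S, dist x₁ x₀ ≤ C * dist (u x₁) (u x₀)) :
    ∀ x₀ ∈ closure S, ∀ x₁ ∈ closure S, dist x₁ x₀ ≤ C * dist (u x₁) (u x₀) := by
  intro x₀ h0 x₁ h1
  have hc : IsClosed {q : X × X | dist q.2 q.1 ≤ C * dist (u q.2) (u q.1)} :=
    isClosed_le (by fun_prop) (by fun_prop)
  have hs : S ×ˢ S ⊆ {q : X × X | dist q.2 q.1 ≤ C * dist (u q.2) (u q.1)} :=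
    fun q hq => h q.1 hq.1 q.2 hq.2
  have := closure_minimal hs hc
  rw [closure_prod_eq] at this
  exact this (show (x₀, x₁) ∈ _ from ⟨h0, h1⟩)

/-- The push-forward of the Hausdorff measure has finite upper density almost everywhere. -/
theorem ae_exists_measure_preimage_closedBall_le {n : ℕ} {X : Type*} [MetricSpace X]
    [MeasurableSpace X] [BorelSpace X] (hfin : μH[(n : ℝ)] (univ : Set X) < ⊤)
    {u : X → Fin n → ℝ} (hu : Continuous u) :
    ∀ᵐ y : Fin n → ℝ, ∃ M : ℕ, ∀ ρ : ℝ, 0 < ρ →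
      μH[(n : ℝ)] (u ⁻¹' closedBall y ρ) ≤ ENNReal.ofReal (M * ρ ^ n) := by
  have : IsFiniteMeasure (μH[(n : ℝ)] : Measure X) := ⟨hfin⟩
  set ν : Measure (Fin n → ℝ) := Measure.map u μH[(n : ℝ)] with hν
  have : IsFiniteMeasure ν := inferInstance
  have hνb : ∀ y ρ, μH[(n : ℝ)] (u ⁻¹' closedBall y ρ) = ν (closedBall y ρ) := fun y ρ => by
    rw [hν, Measure.map_apply hu.measurable measurableSet_closedBall]
  filter_upwards [Besicovitch.ae_tendsto_rnDeriv ν (volume : Measure (Fin n → ℝ)),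
    Measure.rnDeriv_lt_top ν (volume : Measure (Fin n → ℝ))] with y hy hy'
  obtain ⟨K, hK1, hK2⟩ := ENNReal.lt_iff_exists_nnreal_btwn.1 hy'
  have hev := hy.eventually_lt_const hK1
  rw [eventually_nhdsWithin_iff, Metric.eventually_nhds_iff] at hev
  obtain ⟨ρ₀, hρ₀, hev⟩ := hev
  obtain ⟨M, hM⟩ := exists_nat_ge (max ((K : ℝ) * 2 ^ n) ((ν univ).toReal / ρ₀ ^ n))
  refine ⟨M, fun ρ hρ => ?_⟩
  rw [hνb]
  rcases lt_or_ge ρ ρ₀ with h | h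
  · have h1 := hev (y := ρ) (by rw [Real.dist_eq, sub_zero, abs_of_pos hρ]; exact h) hρ
    rw [ENNReal.div_lt_iff (Or.inl (measure_closedBall_pos _ _ hρ).ne')
      (Or.inl measure_closedBall_lt_top.ne), Real.volume_pi_closedBall _ hρ.le,
      Fintype.card_fin] at h1
    refine h1.le.trans ?_
    rw [← ENNReal.ofReal_coe_nnreal, ← ENNReal.ofReal_mul K.coe_nonneg]
    refine ENNReal.ofReal_le_ofReal ?_
    rw [mul_pow, ← mul_assoc]
    gcongr
    exact (le_max_left _ _).trans hM
  · refine (measure_mono (subset_univ _)).trans ?_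
    rw [← ENNReal.ofReal_toReal (measure_ne_top ν univ)]
    refine ENNReal.ofReal_le_ofReal ?_
    have h2 := (le_max_right _ _).trans hM
    rw [div_le_iff₀ (by positivity)] at h2
    refine h2.trans ?_
    gcongr

/-- Up to a set which is negligible in purely unrectifiable sets, generic values of a Lipschitz
map can be removed locally. -/
theorem exists_removable_off {n : ℕ} {X : Type*} [MetricSpace X] [CompactSpace X]
    [MeasurableSpace X] [BorelSpace X] (hfin : μH[(n : ℝ)] (univ : Set X) < ⊤)
    {u : X → Fin n → ℝ} (hu : IsLip u) :
    ∃ A : Set X, MeasurableSet A ∧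
      (∀ P : Set X, PurelyUnrectifiable n P → μH[(n : ℝ)] (P ∩ A) = 0) ∧
      ∀ᵐ y : Fin n → ℝ, (u ⁻¹' {y}).Finite ∧ ∀ x, u x = y → x ∉ A → ∀ ρ : ℝ, 0 < ρ →
        ∃ (p : X) (s : ℝ), dist x p < s ∧ closedBall p s ⊆ ball x ρ ∧
          (∀ x', u x' = y → dist x' p ≤ s → x' = x) ∧
          ∀ r : ℝ, 0 < r → Removable u (ball p s) y r := by
  rcases isEmpty_or_nonempty X with hX | hX
  · refine ⟨∅, MeasurableSet.empty, by simp, Eventually.of_forall fun y => ⟨toFinite _, ?_⟩⟩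
    exact fun x => (hX.false x).elim
  set A : Set X := ⋃ q : ℕ × ℚ × ℕ × ℕ, closure (stuckSet u (TopologicalSpace.denseSeq X q.1)
    (q.2.1 : ℝ) (1 / ((q.2.2.1 : ℝ) + 1)) (q.2.2.2 : ℝ)) with hA
  refine ⟨A, MeasurableSet.iUnion fun q => isClosed_closure.measurableSet, fun P hP => ?_, ?_⟩
  · rw [hA, inter_iUnion]
    refine measure_iUnion_null fun q => ?_
    obtain ⟨C, hC, h⟩ := exists_dist_le_of_mem_stuckSet hu (TopologicalSpace.denseSeq X q.1)
      (q.2.1 : ℝ) (R := 1 / ((q.2.2.1 : ℝ) + 1)) (M := (q.2.2.2 : ℝ)) (by positivity)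
      (by positivity)
    exact hP.measure_inter_eq_zero hC (dist_le_of_mem_closure hu.continuous h)
  · have hfib := hu.ae_finite_fiber hfin
    have hv : (μH[(n : ℝ)] : Measure (Fin n → ℝ)) = volume := by
      rw [← hausdorffMeasure_pi_real, Fintype.card_fin]
    rw [hv] at hfib
    filter_upwards [hfib, ae_exists_measure_preimage_closedBall_le hfin hu.continuous] with y hy hM
    obtain ⟨M, hM⟩ := hM
    refine ⟨hy, fun x hx hxA ρ hρ => ?_⟩
    -- isolate `x` in its fibre
    obtain ⟨η, hη, hiso⟩ : ∃ η : ℝ, 0 < η ∧ ∀ x', u x' = y → dist x' x < η → x' = x := by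
      have hfin' : (u ⁻¹' {y} \ {x}).Finite := hy.sdiff
      have hn : (u ⁻¹' {y} \ {x})ᶜ ∈ 𝓝 x := hfin'.isClosed.isOpen_compl.mem_nhds (by simp)
      obtain ⟨η, hη, hsub⟩ := Metric.mem_nhds_iff.1 hn
      refine ⟨η, hη, fun x' h1 h2 => ?_⟩
      by_contra h3
      exact hsub (mem_ball.2 h2) ⟨h1, h3⟩
    set τ := min η ρ with hτ
    have hτ0 : 0 < τ := lt_min hη hρ
    obtain ⟨k, hk⟩ := Metric.denseRange_iff.1 (TopologicalSpace.denseRange_denseSeq X) x (τ / 4)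
      (by positivity)
    set p := TopologicalSpace.denseSeq X k with hp
    obtain ⟨s, hs1, hs2⟩ := exists_rat_btwn (show τ / 4 < τ / 2 by linarith)
    have hball : closedBall p (s : ℝ) ⊆ ball x τ := fun x' hx' => by
      rw [mem_closedBall] at hx'
      rw [mem_ball]
      linarith [dist_triangle x' p x, dist_comm p x]
    have huniq : ∀ x', u x' = y → dist x' p ≤ (s : ℝ) → x' = x := fun x' h1 h2 =>
      hiso x' h1 ((mem_ball.1 (hball (mem_closedBall.2 h2))).trans_le (min_le_left _ _))
    have hxp : dist x p < s := hk.trans hs1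
    refine ⟨p, s, hxp, hball.trans (ball_subset_ball (min_le_right _ _)), huniq, fun r hr => ?_⟩
    by_contra hrem
    -- the sphere avoids values close to `y`
    obtain ⟨R, hR, hsph⟩ : ∃ R : ℝ, 0 < R ∧ ∀ x', dist (u x') y ≤ R → dist x' p ≠ s := by
      have hc : IsCompact (u '' sphere p (s : ℝ)) := (isCompact_sphere p _).image hu.continuous
      have hy' : y ∉ u '' sphere p (s : ℝ) := by
        rintro ⟨x', h1, h2⟩
        have h3 := huniq x' h2 (le_of_eq h1)
        rw [h3, mem_sphere] at h1
        exact hxp.ne h1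
      obtain ⟨R, hR, hsub⟩ := Metric.nhds_basis_closedBall.mem_iff.1
        (hc.isClosed.isOpen_compl.mem_nhds hy')
      exact ⟨R, hR, fun x' h1 h2 => hsub (mem_closedBall.2 h1) ⟨x', h2, rfl⟩⟩
    obtain ⟨j, hj⟩ := exists_nat_one_div_lt (lt_min hR hr)
    refine hxA (mem_iUnion.2 ⟨(k, s, j, M), subset_closure ⟨hxp, ?_, ?_, ?_, ?_⟩⟩)
    · rw [hx]; exact huniq
    · rw [hx]; exact fun x' h => hsph x' (h.trans (hj.le.trans (min_le_left _ _)))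
    · rw [hx]; exact fun h => hrem (h.mono (hj.le.trans (min_le_right _ _)))
    · rw [hx]; exact hM

/-- Push the values of `u` in the ball around a removable value to its boundary sphere. -/
theorem Removable.push {n : ℕ} {X : Type*} [MetricSpace X] [CompactSpace X] {u : X → Fin n → ℝ}
    (hu : IsLip u) {p : X} {s r : ℝ} {y : Fin n → ℝ} (hr : 0 < r)
    (hrem : Removable u (ball p s) y r) (hsph : ∀ x, dist (u x) y ≤ r → dist x p ≠ s) :
    ∃ v : X → Fin n → ℝ, IsLip v ∧
      (∀ x, x ∈ ball p s → u x ∈ ball y r → v x ∈ sphere y r) ∧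
      (∀ x, ¬ (x ∈ ball p s ∧ u x ∈ ball y r) → v x = u x) := by
  obtain ⟨k, hk, r', hr'0, hr'r, hk1, hk2⟩ := hrem
  set W : Set X := {x | dist x p ≤ s} ∩ {x | dist (u x) y ≤ r} with hW
  have hucont := hu.continuous
  have hkcont := hk.continuous
  have hWc : IsClosed W := (isClosed_le (by fun_prop) continuous_const).inter
      (isClosed_le (by fun_prop) continuous_const)
  have hWb : ∀ x ∈ W, x ∈ ball p s := fun x hx =>
    mem_ball.2 (lt_of_le_of_ne hx.1 (hsph x hx.2))
  have hne : ∀ x ∈ W, 0 < dist (k x) y := by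
    intro x hx
    by_cases h : u x ∈ ball y r'
    · exact dist_pos.2 (hk1 x (hWb x hx) h).2
    · rw [hk2 x fun h' => h h'.2]
      rw [mem_ball, not_lt] at h
      linarith
  obtain ⟨η, hη, hηW⟩ : ∃ η : ℝ, 0 < η ∧ ∀ x ∈ W, η ≤ dist (k x) y := by
    rcases W.eq_empty_or_nonempty with hWe | hWn
    · exact ⟨1, one_pos, by simp [hWe]⟩
    · obtain ⟨x, hx, hmin⟩ := hWc.isCompact.exists_isMinOn hWn
        (f := fun x => dist (k x) y) (by fun_prop)
      exact ⟨dist (k x) y, hne x hx, fun x' hx' => hmin hx'⟩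
  obtain ⟨χ, hχ, -, hχ1, hχ0⟩ := IsLip.exists_cutoff (Z := W) (W := {x | s ≤ dist x p}) hWc
    (isClosed_le continuous_const (by fun_prop)) (by
      rw [Set.disjoint_left]
      exact fun x hx hx' => (mem_ball.1 (hWb x hx)).not_ge hx')
  set q : X → ℝ := fun x => min r (max η (dist (k x) y)) with hq
  have hq0 : ∀ x, 0 < q x := fun x => lt_min hr (lt_max_of_lt_left hη)
  have hqL : IsLip q := (IsLip.const r).min ((IsLip.const η).max ((IsLip.dist_const y).comp hk))
  refine ⟨fun x => y + (1 + χ x * (r / q x - 1)) • (k x - y),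
    (IsLip.const y).add (((IsLip.const 1).add
      (hχ.mul (((IsLip.const r).div hqL hq0).sub (IsLip.const 1)))).smul (hk.sub (IsLip.const y))),
    fun x hx hux => ?_, fun x hx => ?_⟩
  · have hxW : x ∈ W := ⟨(mem_ball.1 hx).le, (mem_ball.1 hux).le⟩
    have h1 : dist (k x) y ≤ r := by
      by_cases h : u x ∈ ball y r'
      · exact (mem_ball.1 (hk1 x hx h).1).le.trans hr'r.le
      · rw [hk2 x fun h' => h h'.2]
        exact hxW.2
    have h2 : q x = dist (k x) y := by
      simp only [hq]
      rw [max_eq_right (hηW x hxW), min_eq_right h1]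
    have h3 := hne x hxW
    simp only [hχ1 x hxW, one_mul, add_sub_cancel, h2]
    rw [mem_sphere, dist_eq_norm, add_sub_cancel_left, norm_smul, ← dist_eq_norm, norm_div,
      Real.norm_of_nonneg hr.le, Real.norm_of_nonneg h3.le, div_mul_cancel₀ _ h3.ne']
  · have hku : k x = u x := hk2 x fun h => hx ⟨h.1, ball_subset_ball hr'r.le h.2⟩
    by_cases h : x ∈ ball p s
    · have h1 : u x ∉ ball y r := fun h' => hx ⟨h, h'⟩
      rw [mem_ball, not_lt] at h1
      have h2 : q x = r := by
        simp only [hq, hku]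
        exact min_eq_left (h1.trans (le_max_right _ _))
      simp only [h2, div_self hr.ne', sub_self, mul_zero, add_zero, one_smul, hku,
        add_sub_cancel]
    · rw [mem_ball, not_lt] at h
      simp only [hχ0 x h, zero_mul, add_zero, one_smul, hku, add_sub_cancel]

theorem add_sum_sub_eq_self {ι E : Type*} [AddCommGroup E] (F : Finset ι) (a : E) (v : ι → E)
    (h : ∀ i ∈ F, v i = a) : a + ∑ i ∈ F, (v i - a) = a := by
  rw [Finset.sum_eq_zero fun i hi => by rw [h i hi, sub_self], add_zero]

theorem add_sum_sub_eq_single {ι E : Type*} [AddCommGroup E] (F : Finset ι) (a : E) (v : ι → E)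
    {j : ι} (hj : j ∈ F) (h : ∀ i ∈ F, i ≠ j → v i = a) : a + ∑ i ∈ F, (v i - a) = v j := by
  rw [Finset.sum_eq_single_of_mem j hj fun i hi hij => by rw [h i hi hij, sub_self],
    add_sub_cancel]

/-- The value `y` of `u` has finite fibre and can be removed locally near the points of
its fibre outside `A`. -/
def LocallyRemovable {n : ℕ} {X : Type*} [MetricSpace X] (u : X → Fin n → ℝ) (A : Set X)
    (y : Fin n → ℝ) : Prop :=
  (u ⁻¹' {y}).Finite ∧ ∀ x, u x = y → x ∉ A → ∀ ρ : ℝ, 0 < ρ →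
    ∃ (p : X) (s : ℝ), dist x p < s ∧ closedBall p s ⊆ ball x ρ ∧
      (∀ x', u x' = y → dist x' p ≤ s → x' = x) ∧
      ∀ r : ℝ, 0 < r → Removable u (ball p s) y r

theorem eventually_forall_dist_le {X E : Type*} [MetricSpace E] {u : X → E}
    {K : Set X} (hK : IsClosed (u '' K)) {y : E} (hy : ∀ x ∈ K, u x ≠ y) :
    ∀ᶠ r : ℝ in 𝓝[>] 0, ∀ x, dist (u x) y ≤ r → x ∉ K := by
  have hy' : y ∉ u '' K := by
    rintro ⟨x, h1, h2⟩
    exact hy x h1 h2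
  obtain ⟨R, hR, hsub⟩ := Metric.nhds_basis_closedBall.mem_iff.1 (hK.isOpen_compl.mem_nhds hy')
  filter_upwards [Ioo_mem_nhdsGT hR] with r hr x hx hxK
  exact hsub (mem_closedBall.2 (hx.trans hr.2.le)) ⟨x, hxK, rfl⟩

theorem LocallyRemovable.eventually_push {n : ℕ} {X : Type*} [MetricSpace X] [CompactSpace X]
    {u : X → Fin n → ℝ} (hu : IsLip u) {A : Set X} {y : Fin n → ℝ}
    (hy : LocallyRemovable u A y) {O : Set X} (hO : IsOpen O) {Ω : Set (Fin n → ℝ)}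
    (hOΩ : ∀ x ∈ closure O, u x ∈ Ω → x ∈ O) (hyΩ : y ∈ Ω) {K : Set X}
    (hK : IsCompact K) (hKA : Disjoint K A) :
    ∀ᶠ r : ℝ in 𝓝[>] 0, ∃ v : X → Fin n → ℝ, IsLip v ∧
      (∀ x, v x = u x ∨ (x ∈ O ∧ u x ∈ ball y r ∧ v x ∈ sphere y r)) ∧
      ∀ x ∈ K ∩ O, u x ∈ ball y r → v x ∈ sphere y r := by
  classical
  rcases isEmpty_or_nonempty X with hX | hX
  · exact Eventually.of_forall fun r => ⟨u, hu, fun x => (hX.false x).elim,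
      fun x => (hX.false x).elim⟩
  have hFfin : (u ⁻¹' {y} ∩ (K ∩ O)).Finite := hy.1.inter_of_left _
  set F : Finset X := hFfin.toFinset with hF
  have hFm : ∀ x, x ∈ F ↔ u x = y ∧ x ∈ K ∧ x ∈ O := fun x => by simp [hF]
  have hsep : ∀ᶠ ρ : ℝ in 𝓝[>] 0, (∀ x ∈ F, ball x ρ ⊆ O) ∧
      ∀ x ∈ F, ∀ x' ∈ F, x ≠ x' → 2 * ρ ≤ dist x x' := by
    refine Filter.Eventually.and ?_ ?_
    · rw [Filter.eventually_all_finset]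
      intro x hx
      obtain ⟨R, hR, hsub⟩ := Metric.mem_nhds_iff.1 (hO.mem_nhds ((hFm x).1 hx).2.2)
      filter_upwards [Ioo_mem_nhdsGT hR] with r hr
      exact (ball_subset_ball hr.2.le).trans hsub
    · rw [Filter.eventually_all_finset]
      intro x hx
      rw [Filter.eventually_all_finset]
      intro x' hx'
      by_cases hne : x = x'
      · exact Eventually.of_forall fun r h => (h hne).elim
      · filter_upwards [Ioo_mem_nhdsGT (half_pos (dist_pos.2 hne))] with r hr _
        linarith [hr.2]
  obtain ⟨ρ, ⟨hρO, hρsep⟩, hρ⟩ := (hsep.and self_mem_nhdsWithin).exists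
  have hρ : 0 < ρ := hρ
  have hch : ∀ x ∈ F, ∃ (p : X) (s : ℝ), dist x p < s ∧ closedBall p s ⊆ ball x ρ ∧
      (∀ x', u x' = y → dist x' p ≤ s → x' = x) ∧
      ∀ r : ℝ, 0 < r → Removable u (ball p s) y r := fun x hx =>
    hy.2 x ((hFm x).1 hx).1 (fun h => Set.disjoint_left.1 hKA ((hFm x).1 hx).2.1 h) ρ hρ
  choose! p s hxs hsub huniq hrem using hch
  have hdisj : ∀ x ∈ F, ∀ x' ∈ F, ∀ z, z ∈ ball (p x) (s x) → z ∈ ball (p x') (s x') → x = x' := by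
    intro x hx x' hx' z hz hz'
    by_contra hne
    have h1 := mem_ball.1 (hsub x hx (ball_subset_closedBall hz))
    have h2 := mem_ball.1 (hsub x' hx' (ball_subset_closedBall hz'))
    have h3 := hρsep x hx x' hx' hne
    linarith [dist_triangle_left x x' z]
  have hev1 : ∀ᶠ r : ℝ in 𝓝[>] 0, ∀ x ∈ F, ∀ z, dist (u z) y ≤ r → z ∉ sphere (p x) (s x) := by
    rw [Filter.eventually_all_finset]
    intro x hx
    refine eventually_forall_dist_le ((isCompact_sphere _ _).image hu.continuous).isClosed ?_
    intro z hz hzy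
    have h3 := huniq x hx z hzy (le_of_eq hz)
    rw [h3, mem_sphere] at hz
    exact (hxs x hx).ne hz
  have hev2 : ∀ᶠ r : ℝ in 𝓝[>] 0, ∀ z, dist (u z) y ≤ r →
      z ∉ (K ∩ closure O) \ ⋃ x ∈ F, ball (p x) (s x) := by
    refine eventually_forall_dist_le (IsCompact.isClosed (IsCompact.image ?_ hu.continuous)) ?_
    · exact (hK.inter_right isClosed_closure).diff
        (isOpen_biUnion fun x _ => isOpen_ball)
    · rintro z ⟨⟨hzK, hzO⟩, hz⟩ hzy
      refine hz (mem_iUnion₂.2 ⟨z, (hFm z).2 ⟨hzy, hzK, hOΩ z hzO (by rwa [hzy])⟩, ?_⟩)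
      exact mem_ball.2 (hxs z ((hFm z).2 ⟨hzy, hzK, hOΩ z hzO (by rwa [hzy])⟩))
  filter_upwards [hev1, hev2, self_mem_nhdsWithin] with r h1 h2 hr
  have hr : 0 < r := hr
  have hpush : ∀ x ∈ F, ∃ v : X → Fin n → ℝ, IsLip v ∧
      (∀ z, z ∈ ball (p x) (s x) → u z ∈ ball y r → v z ∈ sphere y r) ∧
      (∀ z, ¬ (z ∈ ball (p x) (s x) ∧ u z ∈ ball y r) → v z = u z) := fun x hx =>
    (hrem x hx r hr).push hu hr (fun z hz h => h1 x hx z hz (mem_sphere.2 h))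
  choose! w hwL hw1 hw2 using hpush
  have hval : ∀ x ∈ F, ∀ z, z ∈ ball (p x) (s x) → u z ∈ ball y r →
      u z + ∑ x ∈ F, (w x z - u z) ∈ sphere y r := by
    intro x hx z hz huz
    rw [add_sum_sub_eq_single F (u z) (fun x => w x z) hx fun x' hx' hne =>
      hw2 x' hx' z fun h => hne (hdisj x' hx' x hx z h.1 hz)]
    exact hw1 x hx z hz huz
  refine ⟨fun z => u z + ∑ x ∈ F, (w x z - u z),
    hu.add (IsLip.sum F fun x hx => (hwL x hx).sub hu), fun z => ?_, fun z hz huz => ?_⟩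
  · by_cases h : ∃ x ∈ F, z ∈ ball (p x) (s x) ∧ u z ∈ ball y r
    · obtain ⟨x, hx, hz, huz⟩ := h
      exact Or.inr ⟨hρO x hx (hsub x hx (ball_subset_closedBall hz)), huz, hval x hx z hz huz⟩
    · exact Or.inl (add_sum_sub_eq_self F _ _ fun x hx => hw2 x hx z fun h' => h ⟨x, hx, h'⟩)
  · have h3 := h2 z (mem_ball.1 huz).le
    have h4 : z ∈ ⋃ x ∈ F, ball (p x) (s x) := by
      by_contra h
      exact h3 ⟨⟨hz.1, subset_closure hz.2⟩, h⟩
    obtain ⟨x, hx, hzx⟩ := mem_iUnion₂.1 h4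
    exact hval x hx z hzx huz

/-- A finite family of disjoint closed balls covering an open set of finite volume up to small
measure, with radii chosen from prescribed germs at zero. -/
theorem exists_finite_disjoint_closedBall {n : ℕ} {Ω : Set (Fin n → ℝ)} (hΩ : IsOpen Ω)
    (hΩfin : volume Ω < ⊤) {good : (Fin n → ℝ) → ℝ → Prop}
    (hgood : ∀ᵐ y : Fin n → ℝ, y ∈ Ω → ∀ᶠ r : ℝ in 𝓝[>] 0, good y r) {δ : ℝ≥0∞} (hδ : 0 < δ) :
    ∃ (F : Finset (Fin n → ℝ)) (r : (Fin n → ℝ) → ℝ), (∀ y ∈ F, 0 < r y ∧ good y (r y) ∧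
      closedBall y (r y) ⊆ Ω) ∧ (∀ y ∈ F, ∀ y' ∈ F, y ≠ y' →
        Disjoint (closedBall y (r y)) (closedBall y' (r y'))) ∧
      volume (Ω \ ⋃ y ∈ F, closedBall y (r y)) < δ := by
  classical
  set f : (Fin n → ℝ) → Set ℝ := fun y => {r | good y r ∧ closedBall y r ⊆ Ω} with hf
  set s : Set (Fin n → ℝ) := {y | y ∈ Ω ∧ ∀ᶠ r : ℝ in 𝓝[>] 0, good y r} with hs
  obtain ⟨t, r, htc, hts, htr, htμ, htd⟩ := Besicovitch.exists_disjoint_closedBall_covering_ae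
    (volume : Measure (Fin n → ℝ)) f s (fun y hy d hd => by
      have h1 : ∀ᶠ r : ℝ in 𝓝[>] 0, closedBall y r ⊆ Ω := by
        obtain ⟨R, hR, hsub⟩ := Metric.nhds_basis_closedBall.mem_iff.1 (hΩ.mem_nhds hy.1)
        filter_upwards [Ioo_mem_nhdsGT hR] with r hr
        exact (closedBall_subset_closedBall hr.2.le).trans hsub
      obtain ⟨r, ⟨h2, h3⟩, h4⟩ := ((hy.2.and h1).and (Ioo_mem_nhdsGT hd)).exists
      exact ⟨r, ⟨h2, h3⟩, h4⟩) (fun _ => 1) (fun _ _ => one_pos)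
  have hcov : volume (Ω \ ⋃ y ∈ t, closedBall y (r y)) = 0 := by
    refine measure_mono_null (t := (s \ ⋃ y ∈ t, closedBall y (r y)) ∪
      {y | ¬ (y ∈ Ω → ∀ᶠ r : ℝ in 𝓝[>] 0, good y r)}) ?_ (measure_union_null htμ hgood)
    rintro y ⟨hy, hy'⟩
    by_cases h : ∀ᶠ r : ℝ in 𝓝[>] 0, good y r
    · exact Or.inl ⟨⟨hy, h⟩, hy'⟩
    · exact Or.inr fun h' => h (h' hy)
  have : Countable t := htc.to_subtype
  have hdis : Pairwise (Function.onFun Disjoint fun y : t => closedBall y.1 (r y)) :=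
    fun y y' hne => htd y.2 y'.2 fun h => hne (Subtype.ext h)
  have hsum : ∑' y : t, volume (closedBall y.1 (r y)) ≠ ⊤ := by
    rw [← measure_iUnion hdis fun y => measurableSet_closedBall]
    refine ((measure_mono ?_).trans_lt hΩfin).ne
    exact iUnion_subset fun y => (htr y y.2).1.2
  have htail := ENNReal.tendsto_tsum_compl_atTop_zero hsum
  obtain ⟨G, hG⟩ := (htail.eventually_lt_const hδ).exists
  refine ⟨G.map (Function.Embedding.subtype _), r, fun y hy => ?_, fun y hy y' hy' hne => ?_, ?_⟩
  · obtain ⟨z, hz, rfl⟩ := Finset.mem_map.1 hy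
    have := htr z z.2
    exact ⟨this.2.1, this.1.1, this.1.2⟩
  · obtain ⟨z, hz, rfl⟩ := Finset.mem_map.1 hy
    obtain ⟨z', hz', rfl⟩ := Finset.mem_map.1 hy'
    exact htd z.2 z'.2 hne
  · have hsub : (Ω \ ⋃ y ∈ G.map (Function.Embedding.subtype _), closedBall y (r y)) ⊆
        (Ω \ ⋃ y ∈ t, closedBall y (r y)) ∪
          ⋃ y : {y : t // y ∉ G}, closedBall y.1.1 (r y.1.1) := by
      rintro y ⟨hy, hy'⟩
      by_cases h : y ∈ ⋃ y ∈ t, closedBall y (r y)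
      · obtain ⟨z, hz, hyz⟩ := mem_iUnion₂.1 h
        refine Or.inr (mem_iUnion.2 ⟨⟨⟨z, hz⟩, fun hzG => hy' ?_⟩, hyz⟩)
        exact mem_iUnion₂.2 ⟨z, Finset.mem_map.2 ⟨⟨z, hz⟩, hzG, rfl⟩, hyz⟩
      · exact Or.inl ⟨hy, h⟩
    calc _ ≤ _ := measure_mono hsub
      _ ≤ 0 + ∑' y : {y : t // y ∉ G}, volume (closedBall y.1.1 (r y.1.1)) := by
        refine (measure_union_le _ _).trans (add_le_add hcov.le (measure_iUnion_le _))
      _ < δ := by rw [zero_add]; exact hG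

/-- Perturb `u` over an open set `Ω` so that most of `Ω` is not attained by points of a compact
set disjoint from the exceptional set `A`. -/
theorem exists_perturbation {n : ℕ} {X : Type*} [MetricSpace X] [CompactSpace X]
    {u : X → Fin n → ℝ} (hu : IsLip u) {A : Set X} (hA : ∀ᵐ y, LocallyRemovable u A y)
    {O : Set X} (hO : IsOpen O) {Ω : Set (Fin n → ℝ)} (hΩ : IsOpen Ω) (hΩfin : volume Ω < ⊤)
    (hOΩ : ∀ x ∈ closure O, u x ∈ Ω → x ∈ O) {K : Set X}
    (hK : IsCompact K) (hKA : Disjoint K A) {δ : ℝ≥0∞} (hδ : 0 < δ) :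
    ∃ (v : X → Fin n → ℝ) (Z W : Set (Fin n → ℝ)), IsLip v ∧ IsClosed Z ∧ volume Z = 0 ∧ Z ⊆ Ω ∧
      volume W < δ ∧ (∀ x, v x = u x ∨ (x ∈ O ∧ v x ∈ Z)) ∧
      ∀ x ∈ K ∩ O, v x ∈ Ω → v x ∈ W := by
  classical
  obtain ⟨F, r, hF1, hF2, hF3⟩ := exists_finite_disjoint_closedBall hΩ hΩfin
    (good := fun y r => ∃ v : X → Fin n → ℝ, IsLip v ∧
      (∀ x, v x = u x ∨ (x ∈ O ∧ u x ∈ ball y r ∧ v x ∈ sphere y r)) ∧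
      ∀ x ∈ K ∩ O, u x ∈ ball y r → v x ∈ sphere y r)
    (by filter_upwards [hA] with y hy hyΩ using hy.eventually_push hu hO hOΩ hyΩ hK hKA) hδ
  have hch := fun y hy => (hF1 y hy).2.1
  choose! w hwL hw1 hw2 using hch
  set Z : Set (Fin n → ℝ) := ⋃ y ∈ F, sphere y (r y) with hZ
  have hZ0 : volume Z = 0 := (measure_biUnion_null_iff F.countable_toSet).2 fun y hy =>
    Measure.addHaar_sphere_of_ne_zero _ _ (hF1 y hy).1.ne'
  have huniq : ∀ y ∈ F, ∀ y' ∈ F, ∀ z, z ∈ closedBall y (r y) → z ∈ closedBall y' (r y') →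
      y = y' := fun y hy y' hy' z hz hz' => by
    by_contra hne
    exact Set.disjoint_left.1 (hF2 y hy y' hy' hne) hz hz'
  have hoff : ∀ y ∈ F, ∀ x, u x ∉ ball y (r y) → w y x = u x := fun y hy x hx =>
    (hw1 y hy x).resolve_right fun h => hx h.2.1
  have hone : ∀ y ∈ F, ∀ x, u x ∈ ball y (r y) → u x + ∑ y ∈ F, (w y x - u x) = w y x :=
    fun y hy x hx => add_sum_sub_eq_single F (u x) (fun y => w y x) hy fun y' hy' hne =>
      hoff y' hy' x fun h => hne (huniq y' hy' y hy _ (ball_subset_closedBall h)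
        (ball_subset_closedBall hx))
  have hnone : ∀ x, (∀ y ∈ F, u x ∉ ball y (r y)) → u x + ∑ y ∈ F, (w y x - u x) = u x :=
    fun x hx => add_sum_sub_eq_self F _ _ fun y hy => hoff y hy x (hx y hy)
  refine ⟨fun x => u x + ∑ y ∈ F, (w y x - u x), Z, (Ω \ ⋃ y ∈ F, closedBall y (r y)) ∪ Z,
    hu.add (IsLip.sum F fun y hy => (hwL y hy).sub hu),
    F.finite_toSet.isClosed_biUnion fun y _ => isClosed_sphere, hZ0, ?_, ?_, fun x => ?_,
    fun x hx hxΩ => ?_⟩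
  · exact iUnion₂_subset fun y hy => sphere_subset_closedBall.trans (hF1 y hy).2.2
  · exact ((measure_union_le _ _).trans_eq (by rw [hZ0, add_zero])).trans_lt hF3
  · by_cases h : ∃ y ∈ F, u x ∈ ball y (r y)
    · obtain ⟨y, hy, hxy⟩ := h
      beta_reduce
      rw [hone y hy x hxy]
      rcases hw1 y hy x with h1 | h1
      · exact Or.inl h1
      · exact Or.inr ⟨h1.1, mem_iUnion₂.2 ⟨y, hy, h1.2.2⟩⟩
    · push Not at h
      exact Or.inl (hnone x h)
  · beta_reduce at hxΩ ⊢
    by_cases h : ∃ y ∈ F, u x ∈ ball y (r y)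
    · obtain ⟨y, hy, hxy⟩ := h
      rw [hone y hy x hxy]
      exact Or.inr (mem_iUnion₂.2 ⟨y, hy, hw2 y hy x hx hxy⟩)
    · push Not at h
      rw [hnone x h] at hxΩ ⊢
      by_cases h' : u x ∈ ⋃ y ∈ F, closedBall y (r y)
      · obtain ⟨y, hy, hxy⟩ := mem_iUnion₂.1 h'
        refine Or.inr (mem_iUnion₂.2 ⟨y, hy, ?_⟩)
        have h1 := h y hy
        rw [mem_ball, not_lt] at h1
        exact le_antisymm hxy h1
      · exact Or.inl ⟨hxΩ, h'⟩

theorem inv_ofReal_pow_le_dyadic {r : ℝ} (hr : 0 < r) (n : ℕ) :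
    (ENNReal.ofReal r)⁻¹ ^ n ≤
      1 + ∑' l : ℕ, if r ≤ (1 / 2) ^ l then (2 : ℝ≥0∞) ^ ((l + 1) * n) else 0 := by
  rcases le_or_gt 1 r with h1 | h1
  · refine le_trans (pow_le_one₀ (zero_le) ?_) le_self_add
    rw [ENNReal.inv_le_one]
    simpa using h1
  obtain ⟨l, hl, hl'⟩ := exists_nat_pow_near_of_lt_one hr h1.le (by norm_num : (0 : ℝ) < 1 / 2)
    (by norm_num)
  refine le_trans ?_ le_add_self
  refine le_trans ?_ (ENNReal.le_tsum l)
  rw [if_pos hl', pow_mul]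
  gcongr
  rw [← ENNReal.ofReal_inv_of_pos hr]
  have : r⁻¹ ≤ 2 ^ (l + 1) := by
    rw [inv_le_comm₀ hr (by positivity)]
    simpa using hl.le
  calc ENNReal.ofReal r⁻¹ ≤ ENNReal.ofReal (2 ^ (l + 1)) := ENNReal.ofReal_le_ofReal this
    _ = _ := by rw [ENNReal.ofReal_pow (by norm_num)]; norm_num

theorem lintegral_inv_norm_sub_pow_le (n : ℕ) (z : Fin (n + 1) → ℝ) :
    ∫⁻ q in Icc (0 : Fin (n + 1) → ℝ) 1, (ENNReal.ofReal ‖q - z‖)⁻¹ ^ n ≤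
      1 + 2 ^ (2 * n + 2) := by
  have h1 : ∫⁻ q in Icc (0 : Fin (n + 1) → ℝ) 1, (ENNReal.ofReal ‖q - z‖)⁻¹ ^ n ≤
      ∫⁻ q in Icc (0 : Fin (n + 1) → ℝ) 1, (1 + ∑' l : ℕ,
        (closedBall z ((1 / 2) ^ l)).indicator (fun _ => (2 : ℝ≥0∞) ^ ((l + 1) * n)) q) := by
    refine lintegral_mono_ae (ae_restrict_of_ae ?_)
    have : ∀ᵐ q : Fin (n + 1) → ℝ, q ≠ z := by
      simp [ae_iff]
    filter_upwards [this] with q hq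
    refine (inv_ofReal_pow_le_dyadic (norm_pos_iff.2 (sub_ne_zero.2 hq)) n).trans ?_
    gcongr with l
    split_ifs with h
    · rw [indicator_of_mem (by rwa [mem_closedBall, dist_eq_norm])]
    · exact zero_le
  refine h1.trans ?_
  rw [lintegral_add_left measurable_const, lintegral_tsum]
  · gcongr
    · simp [Real.volume_Icc_pi]
    · calc _ ≤ ∑' l : ℕ, (2 : ℝ≥0∞) ^ (2 * n + 1) * (2⁻¹) ^ l := by
            refine ENNReal.tsum_le_tsum fun l => ?_
            refine (lintegral_mono' Measure.restrict_le_self le_rfl).trans ?_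
            rw [lintegral_indicator measurableSet_closedBall, setLIntegral_const,
              Real.volume_pi_closedBall _ (by positivity), Fintype.card_fin,
              ENNReal.ofReal_pow (by positivity), ENNReal.ofReal_mul (by norm_num),
              ENNReal.ofReal_pow (by norm_num)]
            have e : ENNReal.ofReal (1 / 2) = 2⁻¹ := by
              rw [one_div, ENNReal.ofReal_inv_of_pos (by norm_num)]; norm_num
            have e2 : ENNReal.ofReal 2 = 2 := by norm_num
            rw [e, e2]
            have h2 : (2 : ℝ≥0∞) * 2⁻¹ = 1 := ENNReal.mul_inv_cancel (by norm_num) (by norm_num)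
            have h3 : (2 : ℝ≥0∞) ^ (l * n) * (2⁻¹) ^ (l * n) = 1 := by
              rw [← mul_pow, h2, one_pow]
            apply le_of_eq
            calc _ = ((2 : ℝ≥0∞) ^ (l * n) * (2⁻¹) ^ (l * n)) * (2 ^ (2 * n + 1) * (2⁻¹) ^ l) := by
                  ring
              _ = _ := by rw [h3, one_mul]
      _ = _ := by
            rw [ENNReal.tsum_mul_left, ENNReal.tsum_geometric, ENNReal.one_sub_inv_two, inv_inv]
            ring
  · exact fun l => (measurable_const.indicator measurableSet_closedBall).aemeasurable

/-- Averaging: the singularity of a kernel of order `n` can be placed in the unit cube of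
dimension `n + 1`, away from a given null set, so that the kernel has controlled integral. -/
theorem exists_lintegral_inv_norm_sub_pow_le {n : ℕ} {X : Type*} [MeasurableSpace X]
    (ν : Measure X) [IsFiniteMeasure ν] {z : X → Fin (n + 1) → ℝ} (hz : Measurable z)
    {s : Set (Fin (n + 1) → ℝ)} (hs : volume s = 0) :
    ∃ q : Fin (n + 1) → ℝ, (∀ j, 0 ≤ q j ∧ q j ≤ 1) ∧ q ∉ s ∧
      ∫⁻ x, (ENNReal.ofReal ‖q - z x‖)⁻¹ ^ n ∂ν ≤ (1 + 2 ^ (2 * n + 2)) * ν univ := by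
  let κ : Measure (Fin (n + 1) → ℝ) := volume.restrict (Icc 0 1)
  have hκ : IsProbabilityMeasure κ := ⟨by simp [κ, Real.volume_Icc_pi]⟩
  have hN : κ (s ∪ (Icc 0 1)ᶜ) = 0 := by
    rw [measure_union_null_iff]
    refine ⟨nonpos_iff_eq_zero.1 ((Measure.restrict_apply_le _ _).trans hs.le), ?_⟩
    simp [κ, Measure.restrict_apply measurableSet_Icc.compl]
  have hm : Measurable (Function.uncurry fun q x => (ENNReal.ofReal ‖q - z x‖)⁻¹ ^ n) :=
    (measurable_fst.sub (hz.comp measurable_snd)).norm.ennreal_ofReal.inv.pow_const n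
  have hle : ∫⁻ q, ∫⁻ x, (ENNReal.ofReal ‖q - z x‖)⁻¹ ^ n ∂ν ∂κ ≤
      (1 + 2 ^ (2 * n + 2)) * ν univ := by
    rw [lintegral_lintegral_swap hm.aemeasurable]
    refine (lintegral_mono fun x => lintegral_inv_norm_sub_pow_le n (z x)).trans ?_
    rw [lintegral_const]
  obtain ⟨q, hq, hq'⟩ := exists_notMem_null_le_lintegral (μ := κ)
    (hm.lintegral_prod_right (ν := ν)).aemeasurable hN
  simp only [mem_union, mem_compl_iff, not_or, not_not] at hq
  exact ⟨q, fun j => ⟨hq.2.1 j, hq.2.2 j⟩, hq.1, hq'.trans hle⟩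

theorem IsLip.volume_range_eq_zero {n : ℕ} {X : Type*} [MetricSpace X] [MeasurableSpace X]
    [BorelSpace X] (hfin : μH[(n : ℝ)] (univ : Set X) < ⊤) {z : X → Fin (n + 1) → ℝ}
    (hz : IsLip z) : volume (range z) = 0 := by
  obtain ⟨L, hL⟩ := hz
  have h0 : μH[((n + 1 : ℕ) : ℝ)] (univ : Set X) = 0 := by
    rcases Measure.hausdorffMeasure_zero_or_top (show (n : ℝ) < ((n + 1 : ℕ) : ℝ) by simp)
      (univ : Set X) with h | h
    · exact h
    · exact absurd h hfin.ne
  have := hL.hausdorffMeasure_image_le (d := ((n + 1 : ℕ) : ℝ)) (by positivity) univ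
  rw [h0, mul_zero, image_univ] at this
  rw [← hausdorffMeasure_pi_real, Fintype.card_fin]
  exact nonpos_iff_eq_zero.1 this

/-- The constant in the averaging argument for projecting `k`-simplices to their boundary. -/
def centerConst (n k : ℕ) : ℝ≥0 := (2 * (k + 1) * (n + 1)) ^ n * (1 + 2 ^ (2 * n + 2))

/-- Every `k`-simplex with `k > n` has a well-centred interior point missed by a given Lipschitz
map, from which the singular integral of order `n` is controlled. -/
theorem exists_center {n k : ℕ} (hnk : n + 1 ≤ k) {X I : Type*} [Fintype I] [DecidableEq I]
    [MetricSpace X] [MeasurableSpace X] [BorelSpace X]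
    (hfin : μH[(n : ℝ)] (univ : Set X) < ⊤) (ν : Measure X) [IsFiniteMeasure ν]
    {t : X → I → ℝ} (ht : IsLip t) {T : Finset I} (hT : T.card = k + 1) :
    ∃ p : I → ℝ, (∀ i ∉ T, p i = 0) ∧ (∀ i ∈ T, 1 / (2 * (k + 1)) ≤ p i) ∧ ∑ i, p i = 1 ∧
      (∀ x, t x ≠ p) ∧
      ∫⁻ x, (ENNReal.ofReal ‖p - t x‖)⁻¹ ^ n ∂ν ≤ centerConst n k * ν univ := by
  obtain ⟨b, hb⟩ : T.Nonempty := Finset.card_pos.1 (by omega)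
  obtain ⟨e⟩ : Nonempty (Fin (n + 1) ↪ T.erase b) :=
    Function.Embedding.nonempty_of_card_le (by
      rw [Fintype.card_fin, Fintype.card_coe, Finset.card_erase_of_mem hb]; omega)
  have heT : ∀ j, (e j : I) ∈ T := fun j => Finset.mem_of_mem_erase (e j).2
  have heb : ∀ j, b ≠ (e j : I) := fun j => (Finset.ne_of_mem_erase (e j).2).symm
  let η : ℝ := 1 / (2 * (k + 1) * (n + 1))
  have hη : 0 < η := by positivity
  let z : X → Fin (n + 1) → ℝ := fun x j => η⁻¹ * (t x (e j) - 1 / (k + 1))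
  have hz : IsLip z := IsLip.pi fun j =>
    ((ht.eval (e j : I)).sub (IsLip.const _)).clm (η⁻¹ • ContinuousLinearMap.id ℝ ℝ)
  obtain ⟨q, hq01, hqs, hq⟩ := exists_lintegral_inv_norm_sub_pow_le ν hz.continuous.measurable
    (hz.volume_range_eq_zero hfin)
  let p : I → ℝ := fun i => (if i ∈ T then 1 / ((k : ℝ) + 1) else 0) +
    η * ∑ j, q j * ((if i = e j then 1 else 0) - (if i = b then 1 else 0))
  have hpe : ∀ j, p (e j) = 1 / ((k : ℝ) + 1) + η * q j := by
    intro j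
    simp only [p, if_pos (heT j), if_neg (heb j).symm, sub_zero]
    congr 2
    rw [Finset.sum_eq_single j]
    · simp
    · intro j' _ hj
      rw [if_neg, mul_zero]
      intro h
      exact hj (e.injective (Subtype.ext h)).symm
    · simp
  have hd : ∀ x, η * ‖q - z x‖ ≤ ‖p - t x‖ := by
    intro x
    rw [← le_div_iff₀' hη]
    refine (pi_norm_le_iff_of_nonneg (by positivity)).2 fun j => ?_
    rw [le_div_iff₀' hη]
    refine le_trans (le_of_eq ?_) (norm_le_pi_norm (p - t x) (e j))
    rw [Pi.sub_apply, Pi.sub_apply, hpe, ← Real.norm_of_nonneg hη.le, ← norm_mul,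
      Real.norm_of_nonneg hη.le]
    congr 1
    simp only [z]
    field_simp
    ring
  refine ⟨p, fun i hi => ?_, fun i hi => ?_, ?_, fun x hx => ?_, ?_⟩
  · simp only [p, if_neg hi, zero_add]
    rw [Finset.sum_eq_zero, mul_zero]
    intro j _
    rw [if_neg, if_neg, sub_zero, mul_zero]
    · rintro rfl; exact hi hb
    · rintro rfl; exact hi (heT j)
  · simp only [p, if_pos hi]
    have h1 : -((n : ℝ) + 1) ≤ ∑ j : Fin (n + 1),
        q j * ((if i = e j then 1 else 0) - (if i = b then 1 else 0)) := by
      have : ∑ j : Fin (n + 1), (-1 : ℝ) = -((n : ℝ) + 1) := by simp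
      rw [← this]
      refine Finset.sum_le_sum fun j _ => ?_
      have := hq01 j
      split_ifs <;> nlinarith
    have h2 : η * (-((n : ℝ) + 1)) = - (1 / (2 * (k + 1))) := by
      simp only [η]; field_simp
    have h3 := mul_le_mul_of_nonneg_left h1 hη.le
    rw [h2] at h3
    have h4 : 1 / ((k : ℝ) + 1) = 1 / (2 * (k + 1)) + 1 / (2 * (k + 1)) := by
      field_simp; norm_num
    linarith
  · simp only [p, Finset.sum_add_distrib, ← Finset.mul_sum]
    rw [Finset.sum_comm]
    have h1 : ∀ j, ∑ i, q j * ((if i = (e j : I) then (1 : ℝ) else 0) -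
        (if i = b then 1 else 0)) = 0 := by
      intro j
      rw [← Finset.mul_sum, Finset.sum_sub_distrib]
      simp
    simp only [h1, Finset.sum_const_zero, mul_zero, add_zero]
    rw [Finset.sum_ite_mem]
    simp [hT]
    field_simp
  · refine hqs ⟨x, ?_⟩
    have := hd x
    rw [hx, sub_self, norm_zero] at this
    have h0 : ‖q - z x‖ = 0 := by
      have := norm_nonneg (q - z x)
      nlinarith
    exact (sub_eq_zero.1 (norm_eq_zero.1 h0)).symm
  · have hle : ∀ x, (ENNReal.ofReal ‖p - t x‖)⁻¹ ^ n ≤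
        (ENNReal.ofReal η)⁻¹ ^ n * (ENNReal.ofReal ‖q - z x‖)⁻¹ ^ n := by
      intro x
      rw [← mul_pow, ← ENNReal.mul_inv (Or.inr ENNReal.ofReal_ne_top)
        (Or.inl ENNReal.ofReal_ne_top), ← ENNReal.ofReal_mul hη.le]
      gcongr
      exact hd x
    refine (lintegral_mono hle).trans ?_
    rw [lintegral_const_mul' _ _ (ENNReal.pow_ne_top
      (ENNReal.inv_ne_top.2 (by simpa using hη)))]
    refine (mul_le_mul_right hq _).trans (le_of_eq ?_)
    rw [← mul_assoc]
    congr 1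
    rw [← ENNReal.ofReal_inv_of_pos hη]
    have : η⁻¹ = ((2 * (k + 1) * (n + 1) : ℝ≥0) : ℝ) := by simp [η]
    rw [this, ENNReal.ofReal_coe_nnreal]
    simp [centerConst]

section MinRatio

variable {I : Type*}

/-- The largest multiple of `p` that can be subtracted from `v` on the coordinates in `T`. -/
def minRatio (T : Finset I) (p v : I → ℝ) : ℝ := ⨅ i : T, v i / p i

theorem minRatio_le {T : Finset I} (p v : I → ℝ) {i : I} (hi : i ∈ T) :
    minRatio T p v ≤ v i / p i :=
  ciInf_le (f := fun i : T => v i / p i) (Set.finite_range _).bddBelow ⟨i, hi⟩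

theorem exists_minRatio_eq {T : Finset I} (hT : T.Nonempty) (p v : I → ℝ) :
    ∃ i ∈ T, minRatio T p v = v i / p i := by
  have : Nonempty T := hT.to_subtype
  obtain ⟨i, hi⟩ := exists_eq_ciInf_of_finite (f := fun i : T => v i / p i)
  exact ⟨i, i.2, hi.symm⟩

theorem minRatio_sub_le [Fintype I] {T : Finset I} (hT : T.Nonempty) {p : I → ℝ} {M : ℝ}
    (hM : 0 < M) (hp : ∀ i ∈ T, 1 / M ≤ p i) (v w : I → ℝ) :
    minRatio T p v - minRatio T p w ≤ M * ∑ i, |v i - w i| := by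
  obtain ⟨i, hi, h⟩ := exists_minRatio_eq hT p w
  have h1 := minRatio_le p v hi
  have hpi : 0 < p i := (by positivity : 0 < 1 / M).trans_le (hp i hi)
  have h2 : |v i - w i| ≤ ∑ i, |v i - w i| :=
    Finset.single_le_sum (f := fun i => |v i - w i|) (fun _ _ => abs_nonneg _) (Finset.mem_univ i)
  have h3 : (p i)⁻¹ ≤ M := by
    rw [inv_le_comm₀ hpi hM]; simpa using hp i hi
  calc _ ≤ v i / p i - w i / p i := by rw [h]; linarith
    _ = (p i)⁻¹ * (v i - w i) := by rw [← sub_div, div_eq_inv_mul]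
    _ ≤ (p i)⁻¹ * |v i - w i| := by gcongr; exact le_abs_self _
    _ ≤ _ := by gcongr

theorem abs_minRatio_sub_le [Fintype I] {T : Finset I} (hT : T.Nonempty) {p : I → ℝ} {M : ℝ}
    (hM : 0 < M) (hp : ∀ i ∈ T, 1 / M ≤ p i) (v w : I → ℝ) :
    |minRatio T p v - minRatio T p w| ≤ M * ∑ i, |v i - w i| := by
  refine abs_le.2 ⟨?_, minRatio_sub_le hT hM hp v w⟩
  have := minRatio_sub_le hT hM hp w v
  simp only [abs_sub_comm (w _)] at this
  linarith

end MinRatio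

/-- The set of coordinates at which `v` is positive. -/
def posSupp {I : Type*} [Fintype I] (v : I → ℝ) : Finset I := {i | 0 < v i}

@[simp] theorem mem_posSupp {I : Type*} [Fintype I] {v : I → ℝ} {i : I} :
    i ∈ posSupp v ↔ 0 < v i := by simp [posSupp]

/-- `v` is a system of barycentric coordinates. -/
structure IsBary {I : Type*} [Fintype I] (v : I → ℝ) : Prop where
  nonneg : ∀ i, 0 ≤ v i
  sum_eq : ∑ i, v i = 1

namespace IsBary

variable {I : Type*} [Fintype I] {v : I → ℝ}

theorem eq_zero (hv : IsBary v) {i : I} (hi : i ∉ posSupp v) : v i = 0 :=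
  le_antisymm (not_lt.1 (by simpa using hi)) (hv.nonneg i)

theorem posSupp_nonempty (hv : IsBary v) : (posSupp v).Nonempty := by
  by_contra h
  rw [Finset.not_nonempty_iff_eq_empty] at h
  have := hv.sum_eq
  rw [Finset.sum_eq_zero fun i _ => hv.eq_zero (by simp [h])] at this
  norm_num at this

theorem sum_posSupp (hv : IsBary v) {S : Finset I} (hS : posSupp v ⊆ S) : ∑ i ∈ S, v i = 1 := by
  rw [← hv.sum_eq]
  exact Finset.sum_subset (Finset.subset_univ _) fun i _ hi => hv.eq_zero fun h => hi (hS h)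

end IsBary

/-- Admissible centres for collapsing the `k`-simplices. -/
structure CenterFamily {I : Type*} [Fintype I] (k : ℕ) (p : Finset I → I → ℝ) : Prop where
  eq_zero : ∀ T : Finset I, T.card = k + 1 → ∀ i ∉ T, p T i = 0
  le : ∀ T : Finset I, T.card = k + 1 → ∀ i ∈ T, 1 / (2 * (k + 1)) ≤ p T i
  sum_eq : ∀ T : Finset I, T.card = k + 1 → ∑ i, p T i = 1

section Collapse

variable {I : Type*} [Fintype I] {k : ℕ} {p : Finset I → I → ℝ}

/-- The total mass removed by the collapse. -/
def collapseMass (k : ℕ) (p : Finset I → I → ℝ) (v : I → ℝ) : ℝ :=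
  ∑ T ∈ Finset.powersetCard (k + 1) Finset.univ, minRatio T (p T) v

/-- The unnormalized radial projection of the `k`-simplices from their centres. -/
def collapseVec (k : ℕ) (p : Finset I → I → ℝ) (v : I → ℝ) : I → ℝ :=
  v - ∑ T ∈ Finset.powersetCard (k + 1) Finset.univ, minRatio T (p T) v • p T

theorem CenterFamily.nonneg (hp : CenterFamily k p) {T : Finset I} (hT : T.card = k + 1) (i : I) :
    0 ≤ p T i := by
  by_cases hi : i ∈ T
  · exact (by positivity : (0 : ℝ) ≤ 1 / (2 * (k + 1))).trans (hp.le T hT i hi)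
  · rw [hp.eq_zero T hT i hi]

theorem CenterFamily.pos (hp : CenterFamily k p) {T : Finset I} (hT : T.card = k + 1) {i : I}
    (hi : i ∈ T) : 0 < p T i :=
  (by positivity : (0 : ℝ) < 1 / (2 * (k + 1))).trans_le (hp.le T hT i hi)

theorem CenterFamily.minRatio_eq_zero (hp : CenterFamily k p) {v : I → ℝ} (hv : IsBary v)
    (hc : (posSupp v).card ≤ k + 1) {T : Finset I} (hT : T.card = k + 1) (hne : T ≠ posSupp v) :
    minRatio T (p T) v = 0 := by
  have hTn : T.Nonempty := Finset.card_pos.1 (by omega)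
  have : ¬ T ⊆ posSupp v := fun h => hne (Finset.eq_of_subset_of_card_le h (by omega))
  obtain ⟨i, hi, hi'⟩ := Finset.not_subset.1 this
  refine le_antisymm ((minRatio_le (p T) v hi).trans_eq ?_) ?_
  · rw [hv.eq_zero hi', zero_div]
  · obtain ⟨j, hj, h⟩ := exists_minRatio_eq hTn (p T) v
    rw [h]
    exact div_nonneg (hv.nonneg j) (hp.pos hT hj).le

theorem CenterFamily.collapse_of_card_eq (hp : CenterFamily k p) {v : I → ℝ} (hv : IsBary v)
    (hc : (posSupp v).card = k + 1) :
    collapseMass k p v = minRatio (posSupp v) (p (posSupp v)) v ∧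
    collapseVec k p v = v - minRatio (posSupp v) (p (posSupp v)) v • p (posSupp v) := by
  have hm : posSupp v ∈ Finset.powersetCard (k + 1) Finset.univ := by simp [hc]
  have h0 : ∀ T ∈ Finset.powersetCard (k + 1) Finset.univ, T ≠ posSupp v →
      minRatio T (p T) v = 0 := fun T hT hne =>
    hp.minRatio_eq_zero hv hc.le (Finset.mem_powersetCard.1 hT).2 hne
  constructor
  · rw [collapseMass, Finset.sum_eq_single_of_mem _ hm h0]
  · rw [collapseVec, Finset.sum_eq_single_of_mem _ hm fun T hT hne => by
      rw [h0 T hT hne, zero_smul]]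

theorem CenterFamily.collapse_of_card_le (hp : CenterFamily k p) {v : I → ℝ} (hv : IsBary v)
    (hc : (posSupp v).card ≤ k) : collapseMass k p v = 0 ∧ collapseVec k p v = v := by
  have h0 : ∀ T ∈ Finset.powersetCard (k + 1) Finset.univ, minRatio T (p T) v = 0 := by
    intro T hT
    have hT := (Finset.mem_powersetCard.1 hT).2
    refine hp.minRatio_eq_zero hv (hc.trans k.le_succ) hT fun h => ?_
    rw [h] at hT
    omega
  constructor
  · rw [collapseMass, Finset.sum_eq_zero h0]
  · rw [collapseVec, Finset.sum_eq_zero fun T hT => by rw [h0 T hT, zero_smul], sub_zero]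

theorem CenterFamily.collapseVec_nonneg (hp : CenterFamily k p) {v : I → ℝ} (hv : IsBary v)
    (hc : (posSupp v).card ≤ k + 1) (i : I) : 0 ≤ collapseVec k p v i := by
  rcases hc.eq_or_lt with h | h
  · rw [(hp.collapse_of_card_eq hv h).2]
    simp only [Pi.sub_apply, Pi.smul_apply, smul_eq_mul, sub_nonneg]
    by_cases hi : i ∈ posSupp v
    · rw [← le_div_iff₀ (hp.pos h hi)]
      exact minRatio_le _ _ hi
    · rw [hp.eq_zero _ h i hi, mul_zero]
      exact hv.nonneg i
  · rw [(hp.collapse_of_card_le hv (by omega)).2]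
    exact hv.nonneg i

theorem CenterFamily.minRatio_nonneg (hp : CenterFamily k p) {v : I → ℝ} (hv : IsBary v)
    {T : Finset I} (hT : T.card = k + 1) : 0 ≤ minRatio T (p T) v := by
  obtain ⟨j, hj, h⟩ := exists_minRatio_eq (T := T) (Finset.card_pos.1 (by omega)) (p T) v
  rw [h]
  exact div_nonneg (hv.nonneg j) (hp.pos hT hj).le

theorem CenterFamily.collapseMass_nonneg (hp : CenterFamily k p) {v : I → ℝ} (hv : IsBary v) :
    0 ≤ collapseMass k p v :=
  Finset.sum_nonneg fun _ hT => hp.minRatio_nonneg hv (Finset.mem_powersetCard.1 hT).2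

theorem CenterFamily.collapseVec_le (hp : CenterFamily k p) {v : I → ℝ} (hv : IsBary v) (i : I) :
    collapseVec k p v i ≤ v i := by
  simp only [collapseVec, Pi.sub_apply, Finset.sum_apply, Pi.smul_apply, smul_eq_mul,
    sub_le_self_iff]
  refine Finset.sum_nonneg fun T hT => ?_
  have hT := (Finset.mem_powersetCard.1 hT).2
  exact mul_nonneg (hp.minRatio_nonneg hv hT) (hp.nonneg hT i)

theorem CenterFamily.sum_collapseVec (hp : CenterFamily k p) {v : I → ℝ} (hv : IsBary v) :
    ∑ i, collapseVec k p v i = 1 - collapseMass k p v := by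
  simp only [collapseVec, Pi.sub_apply, Finset.sum_apply, Pi.smul_apply, smul_eq_mul,
    Finset.sum_sub_distrib, hv.sum_eq]
  rw [Finset.sum_comm, collapseMass]
  congr 1
  refine Finset.sum_congr rfl fun T hT => ?_
  rw [← Finset.mul_sum, hp.sum_eq T (Finset.mem_powersetCard.1 hT).2, mul_one]

theorem CenterFamily.exists_collapseVec_eq_zero (hp : CenterFamily k p) {v : I → ℝ} (hv : IsBary v)
    (hc : (posSupp v).card = k + 1) : ∃ i ∈ posSupp v, collapseVec k p v i = 0 := by
  obtain ⟨i, hi, h⟩ := exists_minRatio_eq hv.posSupp_nonempty (p (posSupp v)) v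
  refine ⟨i, hi, ?_⟩
  rw [(hp.collapse_of_card_eq hv hc).2, Pi.sub_apply, Pi.smul_apply, smul_eq_mul, h,
    div_mul_cancel₀ _ (hp.pos hc hi).ne', sub_self]

theorem CenterFamily.norm_sub_le (hp : CenterFamily k p) {v : I → ℝ} (hv : IsBary v)
    (hc : (posSupp v).card = k + 1) : ‖p (posSupp v) - v‖ ≤ 1 - collapseMass k p v := by
  have hw := hp.collapseVec_nonneg hv hc.le
  have hs := hp.sum_collapseVec hv
  have hn : 0 ≤ 1 - collapseMass k p v := hs ▸ Finset.sum_nonneg fun i _ => hw i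
  refine (pi_norm_le_iff_of_nonneg hn).2 fun i => ?_
  have h1 : collapseVec k p v i ≤ 1 - collapseMass k p v :=
    hs ▸ Finset.single_le_sum (f := collapseVec k p v) (fun i _ => hw i) (Finset.mem_univ i)
  have h2 : p (posSupp v) i ≤ 1 := by
    rw [← hp.sum_eq _ hc]
    exact Finset.single_le_sum (f := p (posSupp v)) (fun i _ => hp.nonneg hc i)
      (Finset.mem_univ i)
  have h3 := hp.nonneg hc i
  have h4 : collapseVec k p v i = v i - collapseMass k p v * p (posSupp v) i := by
    rw [(hp.collapse_of_card_eq hv hc).2, (hp.collapse_of_card_eq hv hc).1]; rfl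
  have h5 := hw i
  rw [Pi.sub_apply, Real.norm_eq_abs, abs_le]
  constructor <;> nlinarith

theorem CenterFamily.sum_abs_minRatio_sub_le (hp : CenterFamily k p) {v w : I → ℝ} (hv : IsBary v)
    (hw : IsBary w) (hcv : (posSupp v).card ≤ k + 1) (hcw : (posSupp w).card ≤ k + 1) :
    ∑ T ∈ Finset.powersetCard (k + 1) Finset.univ, |minRatio T (p T) v - minRatio T (p T) w| ≤
      4 * (k + 1) * ∑ i, |v i - w i| := by
  classical
  have h0 : ∀ T ∈ Finset.powersetCard (k + 1) Finset.univ, T ∉ ({posSupp v, posSupp w} : Finset _) →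
      |minRatio T (p T) v - minRatio T (p T) w| = 0 := by
    intro T hT hne
    have hT := (Finset.mem_powersetCard.1 hT).2
    simp only [Finset.mem_insert, Finset.mem_singleton, not_or] at hne
    rw [hp.minRatio_eq_zero hv hcv hT hne.1, hp.minRatio_eq_zero hw hcw hT hne.2, sub_self, abs_zero]
  rw [← Finset.sum_inter_add_sum_sdiff _ {posSupp v, posSupp w}, add_comm,
    Finset.sum_eq_zero (s := _ \ _) fun T hT => by
      rw [Finset.mem_sdiff] at hT; exact h0 T hT.1 hT.2, zero_add]
  have hb : ∀ T ∈ Finset.powersetCard (k + 1) Finset.univ ∩ ({posSupp v, posSupp w} : Finset _),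
      |minRatio T (p T) v - minRatio T (p T) w| ≤ 2 * (k + 1) * ∑ i, |v i - w i| := by
    intro T hT
    have hT := (Finset.mem_powersetCard.1 (Finset.mem_inter.1 hT).1).2
    exact abs_minRatio_sub_le (Finset.card_pos.1 (by omega)) (by positivity) (hp.le T hT) v w
  refine (Finset.sum_le_card_nsmul _ _ _ hb).trans ?_
  have hcard : (Finset.powersetCard (k + 1) Finset.univ ∩
      ({posSupp v, posSupp w} : Finset (Finset I))).card ≤ 2 :=
    (Finset.card_le_card Finset.inter_subset_right).trans Finset.card_le_two
  have hs : 0 ≤ ∑ i, |v i - w i| := Finset.sum_nonneg fun i _ => abs_nonneg _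
  rw [nsmul_eq_mul]
  calc _ ≤ (2 : ℝ) * (2 * (k + 1) * ∑ i, |v i - w i|) := by
        gcongr; exact_mod_cast hcard
    _ = _ := by ring

theorem CenterFamily.sum_abs_collapseVec_sub_le (hp : CenterFamily k p) {v w : I → ℝ}
    (hv : IsBary v) (hw : IsBary w) (hcv : (posSupp v).card ≤ k + 1)
    (hcw : (posSupp w).card ≤ k + 1) :
    ∑ i, |collapseVec k p v i - collapseVec k p w i| ≤ (4 * k + 5) * ∑ i, |v i - w i| := by
  have h1 := hp.sum_abs_minRatio_sub_le hv hw hcv hcw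
  have h2 : ∀ i, |collapseVec k p v i - collapseVec k p w i| ≤ |v i - w i| +
      ∑ T ∈ Finset.powersetCard (k + 1) Finset.univ,
        |minRatio T (p T) v - minRatio T (p T) w| * p T i := by
    intro i
    simp only [collapseVec, Pi.sub_apply, Finset.sum_apply, Pi.smul_apply, smul_eq_mul]
    rw [sub_sub_sub_comm, ← Finset.sum_sub_distrib]
    refine (abs_sub _ _).trans ?_
    gcongr
    refine (Finset.abs_sum_le_sum_abs _ _).trans (Finset.sum_le_sum fun T hT => ?_)
    rw [← sub_mul, abs_mul, abs_of_nonneg (hp.nonneg (Finset.mem_powersetCard.1 hT).2 i)]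
  refine (Finset.sum_le_sum fun i _ => h2 i).trans ?_
  rw [Finset.sum_add_distrib, Finset.sum_comm]
  have h3 : ∀ T ∈ Finset.powersetCard (k + 1) Finset.univ,
      ∑ i, |minRatio T (p T) v - minRatio T (p T) w| * p T i =
        |minRatio T (p T) v - minRatio T (p T) w| := by
    intro T hT
    rw [← Finset.mul_sum, hp.sum_eq T (Finset.mem_powersetCard.1 hT).2, mul_one]
  rw [Finset.sum_congr rfl h3]
  linarith

theorem CenterFamily.abs_collapseMass_sub_le (hp : CenterFamily k p) {v w : I → ℝ}
    (hv : IsBary v) (hw : IsBary w) (hcv : (posSupp v).card ≤ k + 1)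
    (hcw : (posSupp w).card ≤ k + 1) :
    |collapseMass k p v - collapseMass k p w| ≤ (4 * k + 5) * ∑ i, |v i - w i| := by
  have h1 := hp.sum_abs_minRatio_sub_le hv hw hcv hcw
  rw [collapseMass, collapseMass, ← Finset.sum_sub_distrib]
  refine (Finset.abs_sum_le_sum_abs _ _).trans (h1.trans ?_)
  have hs : 0 ≤ ∑ i, |v i - w i| := Finset.sum_nonneg fun i _ => abs_nonneg _
  nlinarith

end Collapse

theorem sum_abs_div_sub_div_le {I : Type*} [Fintype I] {w w' : I → ℝ} {r r' : ℝ} (hr : 0 < r)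
    (hr' : 0 < r') (hw' : ∑ i, |w' i| = r') :
    ∑ i, |w i / r - w' i / r'| ≤ (∑ i, |w i - w' i| + |r - r'|) / r := by
  have h : ∀ i, |w i / r - w' i / r'| ≤ |w i - w' i| / r + |w' i| * (|r - r'| / (r * r')) := by
    intro i
    have e : w i / r - w' i / r' = (w i - w' i) / r + w' i * ((r' - r) / (r * r')) := by
      field_simp; ring
    rw [e]
    refine (abs_add_le _ _).trans (le_of_eq ?_)
    rw [abs_div, abs_mul, abs_div, abs_of_pos hr, abs_of_pos (mul_pos hr hr'), abs_sub_comm r]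
  refine (Finset.sum_le_sum fun i _ => h i).trans (le_of_eq ?_)
  rw [Finset.sum_add_distrib, ← Finset.sum_div, ← Finset.sum_mul, hw']
  field_simp

/-- A barycentric map `t` whose local Lipschitz constant at `x`, for the `ℓ¹`-distance, is at most
`a * θ x`. -/
structure BaryControl {X I : Type*} [MetricSpace X] [Fintype I] (a : ℝ) (t : X → I → ℝ)
    (θ : X → ℝ) : Prop where
  bary : ∀ x, IsBary (t x)
  cont : Continuous θ
  one_le : ∀ x, 1 ≤ θ x
  lip : ∀ x x', ∑ i, |t x i - t x' i| ≤ a * θ x * dist x x'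

section BaryControl

variable {X I : Type*} [MetricSpace X] [CompactSpace X] [Fintype I] {a : ℝ} {t : X → I → ℝ}
  {θ : X → ℝ}

theorem BaryControl.exists_lip (h : BaryControl a t θ) (ha : 0 ≤ a) :
    ∃ B : ℝ, 0 ≤ B ∧ ∀ x x', ∑ i, |t x i - t x' i| ≤ B * dist x x' := by
  obtain ⟨B, hB⟩ := (isCompact_range h.cont).isBounded.exists_norm_le
  refine ⟨a * max B 0, by positivity, fun x x' => (h.lip x x').trans ?_⟩
  gcongr
  exact ((le_abs_self _).trans (hB _ ⟨x, rfl⟩)).trans (le_max_left _ _)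

theorem BaryControl.isLip (h : BaryControl a t θ) (ha : 0 ≤ a) : IsLip t := by
  obtain ⟨B, -, hB⟩ := h.exists_lip ha
  refine IsLip.pi fun i => IsLip.of_dist_le B fun x y => le_trans ?_ (hB x y)
  exact Finset.single_le_sum (f := fun i => |t x i - t y i|) (fun _ _ => abs_nonneg _)
    (Finset.mem_univ i)

end BaryControl

theorem measurableSet_posSupp_eq {X I : Type*} [TopologicalSpace X] [MeasurableSpace X]
    [BorelSpace X] [Fintype I] {t : X → I → ℝ} (ht : Continuous t) (T : Finset I) :
    MeasurableSet {x | posSupp (t x) = T} := by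
  have : {x | posSupp (t x) = T} = ⋂ i, {x | 0 < t x i ↔ i ∈ T} := by
    ext x
    simp [Finset.ext_iff]
  rw [this]
  refine MeasurableSet.iInter fun i => ?_
  have hm : MeasurableSet {x | 0 < t x i} :=
    (isOpen_lt continuous_const ((continuous_apply i).comp ht)).measurableSet
  by_cases hi : i ∈ T
  · simpa [hi] using hm
  · have : {x | 0 < t x i ↔ i ∈ T} = {x | 0 < t x i}ᶜ := by
      ext x
      simp [hi]
    exact this ▸ hm.compl

theorem setLIntegral_subset_posSupp_eq_sum {X I : Type*} [TopologicalSpace X] [MeasurableSpace X]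
    [BorelSpace X] [Fintype I] [DecidableEq I] {t : X → I → ℝ} (ht : Continuous t)
    (μ : Measure X) (φ : X → ℝ≥0∞) (S : Finset I) :
    ∫⁻ x in {x | S ⊆ posSupp (t x)}, φ x ∂μ =
      ∑ T with S ⊆ T, ∫⁻ x in {x | posSupp (t x) = T}, φ x ∂μ := by
  rw [← lintegral_biUnion_finset]
  · congr 2
    ext x
    simp
  · intro T _ T' _ hne
    exact disjoint_left.2 fun x (hx : posSupp (t x) = T) (hx' : posSupp (t x) = T') =>
      hne (hx.symm.trans hx')
  · exact fun T _ => measurableSet_posSupp_eq ht T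

section Stage

variable {n k : ℕ} {X I : Type*} [Fintype I] [DecidableEq I] [MetricSpace X] [CompactSpace X]
  [MeasurableSpace X] [BorelSpace X] {a : ℝ} {t : X → I → ℝ} {θ : X → ℝ}

theorem one_le_centerConst (n k : ℕ) : 1 ≤ centerConst n k := by
  have h1 : (1 : ℝ≥0) ≤ 2 * (k + 1) * (n + 1) := by
    calc (1 : ℝ≥0) ≤ 2 * (0 + 1) * (0 + 1) := by norm_num
      _ ≤ _ := by gcongr <;> simp
  calc (1 : ℝ≥0) ≤ 1 * 1 := by norm_num
    _ ≤ _ := by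
      unfold centerConst
      gcongr
      · exact one_le_pow₀ h1
      · exact le_self_add

theorem BaryControl.exists_center (hnk : n + 1 ≤ k) (hfin : μH[(n : ℝ)] (univ : Set X) < ⊤)
    (h : BaryControl a t θ) (ha : 0 ≤ a) {T : Finset I} (hT : T.card = k + 1) :
    ∃ p : I → ℝ, (∀ i ∉ T, p i = 0) ∧ (∀ i ∈ T, 1 / (2 * (k + 1)) ≤ p i) ∧ ∑ i, p i = 1 ∧
      (∀ x, t x ≠ p) ∧
      ∫⁻ x in {x | posSupp (t x) = T},
        ENNReal.ofReal (θ x) ^ n * (ENNReal.ofReal ‖p - t x‖)⁻¹ ^ n ∂μH[n] ≤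
      centerConst n k * ∫⁻ x in {x | posSupp (t x) = T}, ENNReal.ofReal (θ x) ^ n ∂μH[n] := by
  have hθm : Measurable fun x => ENNReal.ofReal (θ x) ^ n :=
    h.cont.measurable.ennreal_ofReal.pow_const n
  have ht := h.isLip ha
  let ν : Measure X := (μH[n].restrict {x | posSupp (t x) = T}).withDensity
    fun x => ENNReal.ofReal (θ x) ^ n
  have hν : ν univ = ∫⁻ x in {x | posSupp (t x) = T}, ENNReal.ofReal (θ x) ^ n ∂μH[n] := by
    simp only [ν]
    rw [withDensity_apply _ MeasurableSet.univ, Measure.restrict_univ]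
  have : IsFiniteMeasure ν := by
    obtain ⟨B, hB⟩ := (isCompact_range h.cont).isBounded.exists_norm_le
    refine ⟨?_⟩
    rw [hν]
    calc _ ≤ ∫⁻ x : X, ENNReal.ofReal B ^ n ∂μH[n] := by
          refine (lintegral_mono' Measure.restrict_le_self le_rfl).trans (lintegral_mono fun x => ?_)
          gcongr
          exact (le_abs_self _).trans (hB _ ⟨x, rfl⟩)
      _ < ⊤ := by
          rw [lintegral_const]
          exact ENNReal.mul_lt_top (ENNReal.pow_lt_top ENNReal.ofReal_lt_top) hfin
  obtain ⟨p, h0, hle, hsum, hne, hp⟩ := _root_.exists_center hnk hfin ν ht hT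
  refine ⟨p, h0, hle, hsum, hne, ?_⟩
  rw [hν, lintegral_withDensity_eq_lintegral_mul _ hθm] at hp
  · exact hp
  · exact (measurable_const.sub ht.continuous.measurable).norm.ennreal_ofReal.inv.pow_const n

theorem BaryControl.exists_collapse (hnk : n + 1 ≤ k) (hfin : μH[(n : ℝ)] (univ : Set X) < ⊤)
    (h : BaryControl a t θ) (ha : 0 ≤ a) (hcard : ∀ x, (posSupp (t x)).card ≤ k + 1) :
    ∃ t' θ', BaryControl (2 * (4 * k + 5) * a) t' θ' ∧
      (∀ x, posSupp (t' x) ⊆ posSupp (t x)) ∧ (∀ x, (posSupp (t' x)).card ≤ k) ∧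
      ∀ S : Finset I, ∫⁻ x in {x | S ⊆ posSupp (t' x)}, ENNReal.ofReal (θ' x) ^ n ∂μH[n] ≤
        centerConst n k * ∫⁻ x in {x | S ⊆ posSupp (t x)}, ENNReal.ofReal (θ x) ^ n ∂μH[n] := by
  have ht := h.isLip ha
  have hex : ∀ T : Finset I, ∃ p : I → ℝ, T.card = k + 1 →
      (∀ i ∉ T, p i = 0) ∧ (∀ i ∈ T, 1 / (2 * (k + 1)) ≤ p i) ∧ ∑ i, p i = 1 ∧
      (∀ x, t x ≠ p) ∧
      ∫⁻ x in {x | posSupp (t x) = T},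
        ENNReal.ofReal (θ x) ^ n * (ENNReal.ofReal ‖p - t x‖)⁻¹ ^ n ∂μH[n] ≤
      centerConst n k * ∫⁻ x in {x | posSupp (t x) = T}, ENNReal.ofReal (θ x) ^ n ∂μH[n] := by
    intro T
    by_cases hT : T.card = k + 1
    · obtain ⟨p, hp⟩ := h.exists_center hnk hfin ha hT
      exact ⟨p, fun _ => hp⟩
    · exact ⟨0, fun h => absurd h hT⟩
  choose p hp using hex
  have hcf : CenterFamily k p :=
    ⟨fun T hT => (hp T hT).1, fun T hT => (hp T hT).2.1, fun T hT => (hp T hT).2.2.1⟩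
  let s : X → ℝ := fun x => collapseMass k p (t x)
  have hs0 : ∀ x, 0 ≤ s x := fun x => hcf.collapseMass_nonneg (h.bary x)
  have hs : ∀ x, 0 < 1 - s x := by
    intro x
    rcases (hcard x).eq_or_lt with hc | hc
    · refine lt_of_lt_of_le ?_ (hcf.norm_sub_le (h.bary x) hc)
      exact norm_pos_iff.2 (sub_ne_zero.2 ((hp _ hc).2.2.2.1 x).symm)
    · simp only [s]
      rw [(hcf.collapse_of_card_le (h.bary x) (by omega)).1]
      norm_num
  have hslip : IsLip s := by
    obtain ⟨B, -, hB⟩ := h.exists_lip ha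
    refine IsLip.of_dist_le ((4 * k + 5) * B) fun x y => ?_
    refine (hcf.abs_collapseMass_sub_le (h.bary x) (h.bary y) (hcard x) (hcard y)).trans ?_
    rw [mul_assoc]
    gcongr
    exact hB x y
  let t' : X → I → ℝ := fun x i => collapseVec k p (t x) i / (1 - s x)
  let θ' : X → ℝ := fun x => θ x / (1 - s x)
  have hc : BaryControl (2 * (4 * k + 5) * a) t' θ' := by
    refine ⟨fun x => ⟨fun i => div_nonneg (hcf.collapseVec_nonneg (h.bary x) (hcard x) i) (hs x).le,
      ?_⟩, h.cont.div (continuous_const.sub hslip.continuous) fun x => (hs x).ne', fun x => ?_,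
      fun x x' => ?_⟩
    · simp only [t']
      rw [← Finset.sum_div, hcf.sum_collapseVec (h.bary x)]
      exact div_self (hs x).ne'
    · exact (one_le_div (hs x)).2 (by linarith [h.one_le x, hs0 x])
    · have hw : ∑ i, |collapseVec k p (t x') i| = 1 - s x' := by
        rw [← hcf.sum_collapseVec (h.bary x')]
        exact Finset.sum_congr rfl fun i _ =>
          abs_of_nonneg (hcf.collapseVec_nonneg (h.bary x') (hcard x') i)
      refine (sum_abs_div_sub_div_le (hs x) (hs x') hw).trans ?_
      have h1 := hcf.sum_abs_collapseVec_sub_le (h.bary x) (h.bary x') (hcard x) (hcard x')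
      have h2 := hcf.abs_collapseMass_sub_le (h.bary x) (h.bary x') (hcard x) (hcard x')
      have h3 := mul_le_mul_of_nonneg_left (h.lip x x') (by positivity : (0 : ℝ) ≤ 4 * k + 5)
      have h4 : |1 - s x - (1 - s x')| = |collapseMass k p (t x) - collapseMass k p (t x')| := by
        rw [sub_sub_sub_cancel_left, abs_sub_comm]
      rw [h4, div_le_iff₀ (hs x)]
      have e : 2 * (4 * k + 5) * a * θ' x * dist x x' * (1 - s x) =
          2 * ((4 * k + 5) * (a * θ x * dist x x')) := by
        simp only [θ']
        have := (hs x).ne'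
        field_simp
      rw [e]
      linarith
  have hsub : ∀ x, posSupp (t' x) ⊆ posSupp (t x) := by
    intro x i hi
    rw [mem_posSupp] at hi ⊢
    have : 0 < collapseVec k p (t x) i := by
      simpa [t', hs x] using hi
    exact this.trans_le (hcf.collapseVec_le (h.bary x) i)
  refine ⟨t', θ', hc, hsub, fun x => ?_, fun S => ?_⟩
  · rcases (hcard x).eq_or_lt with hx | hx
    · obtain ⟨i, hi, hi0⟩ := hcf.exists_collapseVec_eq_zero (h.bary x) hx
      have : posSupp (t' x) ⊂ posSupp (t x) := by
        refine ⟨hsub x, fun hsup => ?_⟩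
        have := hsup hi
        rw [mem_posSupp] at this
        simp [t', hi0] at this
      have := Finset.card_lt_card this
      omega
    · have := Finset.card_le_card (hsub x)
      omega
  · refine (lintegral_mono_set (t := {x | S ⊆ posSupp (t x)})
      fun x hx => Finset.Subset.trans hx (hsub x)).trans ?_
    rw [setLIntegral_subset_posSupp_eq_sum ht.continuous,
      setLIntegral_subset_posSupp_eq_sum ht.continuous, Finset.mul_sum]
    refine Finset.sum_le_sum fun T _ => ?_
    have hTm := measurableSet_posSupp_eq ht.continuous T
    by_cases hT : T.card = k + 1
    · refine le_trans (setLIntegral_mono' hTm fun x hx => ?_) (hp T hT).2.2.2.2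
      have hx : posSupp (t x) = T := hx
      simp only [θ']
      rw [div_eq_mul_inv, ENNReal.ofReal_mul (zero_le_one.trans (h.one_le x)), mul_pow,
        ENNReal.ofReal_inv_of_pos (hs x)]
      gcongr
      rw [← hx]
      exact hcf.norm_sub_le (h.bary x) (hx ▸ hT)
    · calc _ ≤ ∫⁻ x in {x | posSupp (t x) = T}, ENNReal.ofReal (θ x) ^ n ∂μH[n] := by
            refine setLIntegral_mono' hTm fun x hx => ?_
            have hx : posSupp (t x) = T := hx
            have hx' : (posSupp (t x)).card ≠ k + 1 := hx ▸ hT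
            simp only [θ', s]
            rw [(hcf.collapse_of_card_le (h.bary x) (by have := hcard x; omega)).1, sub_zero,
              div_one]
        _ ≤ _ := le_mul_of_one_le_left' (by exact_mod_cast one_le_centerConst n k)

/-- Federer–Fleming projection onto the `n`-skeleton. -/
theorem BaryControl.exists_collapse_skeleton (hnk : n ≤ k)
    (hfin : μH[(n : ℝ)] (univ : Set X) < ⊤) (h : BaryControl a t θ) (ha : 0 ≤ a)
    (hcard : ∀ x, (posSupp (t x)).card ≤ k + 1) :
    ∃ t' θ', BaryControl ((∏ j ∈ Finset.Ioc n k, (2 * (4 * (j : ℝ) + 5))) * a) t' θ' ∧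
      (∀ x, posSupp (t' x) ⊆ posSupp (t x)) ∧ (∀ x, (posSupp (t' x)).card ≤ n + 1) ∧
      ∀ S : Finset I, ∫⁻ x in {x | S ⊆ posSupp (t' x)}, ENNReal.ofReal (θ' x) ^ n ∂μH[n] ≤
        (∏ j ∈ Finset.Ioc n k, centerConst n j : ℝ≥0) *
          ∫⁻ x in {x | S ⊆ posSupp (t x)}, ENNReal.ofReal (θ x) ^ n ∂μH[n] := by
  induction k, hnk using Nat.le_induction generalizing a t θ with
  | base => exact ⟨t, θ, by simpa using h, fun _ => subset_rfl, hcard, by simp⟩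
  | succ k hk ih =>
    obtain ⟨t₁, θ₁, h₁, hs₁, hc₁, hi₁⟩ := h.exists_collapse (by omega) hfin ha hcard
    obtain ⟨t₂, θ₂, h₂, hs₂, hc₂, hi₂⟩ := ih h₁ (by positivity) hc₁
    refine ⟨t₂, θ₂, ?_, fun x => (hs₂ x).trans (hs₁ x), hc₂, fun S => ?_⟩
    · rw [← Finset.insert_Ioc_right_eq_Ioc_add_one hk, Finset.prod_insert (by simp)]
      convert h₂ using 1
      push_cast
      ring
    · rw [← Finset.insert_Ioc_right_eq_Ioc_add_one hk, Finset.prod_insert (by simp)]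
      refine (hi₂ S).trans ?_
      rw [mul_comm (centerConst n (k + 1)), ENNReal.coe_mul, mul_assoc]
      gcongr
      exact hi₁ S

end Stage

open Classical in
theorem NagataDimLE.exists_finite_cover {X : Type*} [MetricSpace X] [CompactSpace X] {N : ℕ}
    {c : ℝ} (hc : 0 < c) (h : NagataDimLE X N c) {ε : ℝ} (hε : 0 < ε) :
    ∃ (m : ℕ) (U : Fin m → Set X), (∀ i, (U i).Nonempty) ∧ (∀ x, ∃ i, x ∈ U i) ∧
      (∀ i, ∀ x ∈ U i, ∀ y ∈ U i, dist x y ≤ c * ε) ∧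
      ∀ x, (Finset.univ.filter fun i => ∃ y ∈ U i, dist x y < ε / 3).card ≤ N + 1 := by
  obtain ⟨𝒰, hcov, hdiam, hmult⟩ := h ε hε
  have hball : ∀ x : X, Metric.ediam (ball x (ε / 3)) < ENNReal.ofReal ε := by
    intro x
    rw [← Metric.eball_ofReal]
    refine Metric.ediam_eball_le.trans_lt ?_
    rw [show (2 : ℝ≥0∞) = ENNReal.ofReal 2 by norm_num, ← ENNReal.ofReal_mul (by norm_num)]
    exact (ENNReal.ofReal_lt_ofReal_iff hε).2 (by linarith)
  have hfin : {U ∈ 𝒰 | U.Nonempty}.Finite := by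
    obtain ⟨s, -, hs, hs'⟩ := finite_cover_balls_of_compact (isCompact_univ (X := X))
      (show 0 < ε / 3 by positivity)
    refine (hs.biUnion fun x _ => (hmult (ball x (ε / 3)) (hball x)).1).subset ?_
    rintro U ⟨hU, y, hy⟩
    obtain ⟨x, hx, hyx⟩ := mem_iUnion₂.1 (hs' (mem_univ y))
    exact mem_iUnion₂.2 ⟨x, hx, hU, y, hyx, hy⟩
  have := hfin.fintype
  let e := (Fintype.equivFin {U ∈ 𝒰 | U.Nonempty}).symm
  refine ⟨_, fun i => (e i : Set X), fun i => (e i).2.2, fun x => ?_, fun i x hx y hy => ?_,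
    fun x => ?_⟩
  · obtain ⟨U, hU, hx⟩ := mem_sUnion.1 (hcov ▸ mem_univ x)
    exact ⟨e.symm ⟨U, hU, x, hx⟩, by simpa using hx⟩
  · have h1 := (Metric.edist_le_ediam_of_mem hx hy).trans (hdiam _ (e i).2.1)
    rw [edist_dist] at h1
    exact (ENNReal.ofReal_le_ofReal_iff (by positivity)).1 h1
  · obtain ⟨hf, hn⟩ := hmult (ball x (ε / 3)) (hball x)
    refine le_trans ?_ hn
    rw [← Set.ncard_coe_finset]
    refine Set.ncard_le_ncard_of_injOn (fun i => (e i : Set X)) ?_ ?_ hf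
    · intro i hi
      obtain ⟨y, hy, hxy⟩ := (Finset.mem_filter.1 (Finset.mem_coe.1 hi)).2
      exact ⟨(e i).2.1, y, mem_ball'.2 hxy, hy⟩
    · exact fun i _ j _ hij => e.injective (Subtype.ext hij)

/-- Lipschitz partitions of unity subordinate to the covers furnished by Nagata dimension. -/
theorem NagataDimLE.exists_partition {X : Type*} [MetricSpace X] [CompactSpace X] {N : ℕ}
    {c : ℝ} (hc : 0 < c) (h : NagataDimLE X N c) {ε : ℝ} (hε : 0 < ε) :
    ∃ (m : ℕ) (p : Fin m → X) (t : X → Fin m → ℝ),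
      BaryControl (12 * (N + 1) / ε) t (fun _ => 1) ∧ (∀ x, (posSupp (t x)).card ≤ N + 1) ∧
      ∀ x i, 0 < t x i → dist x (p i) ≤ (c + 1) * ε := by
  classical
  obtain ⟨m, U, hUn, hUc, hUd, hUm⟩ := h.exists_finite_cover hc hε
  choose p hp using hUn
  let τ : X → Fin m → ℝ := fun x i => max 0 (ε / 3 - infDist x (U i))
  have hτ0 : ∀ x i, 0 ≤ τ x i := fun x i => le_max_left _ _
  have hτU : ∀ x i, 0 < τ x i → ∃ y ∈ U i, dist x y < ε / 3 := by
    intro x i hi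
    refine (infDist_lt_iff ⟨p i, hp i⟩).1 ?_
    rcases lt_max_iff.1 hi with h | h
    · exact absurd h (lt_irrefl _)
    · linarith
  have hτcard : ∀ x, (posSupp (τ x)).card ≤ N + 1 := fun x =>
    (Finset.card_le_card fun i hi => Finset.mem_filter.2
      ⟨Finset.mem_univ i, hτU x i (mem_posSupp.1 hi)⟩).trans (hUm x)
  have hlip : ∀ x x' i, |τ x i - τ x' i| ≤ dist x x' := by
    intro x x' i
    have h1 := abs_max_sub_max_le_abs (ε / 3 - infDist x (U i)) (ε / 3 - infDist x' (U i)) 0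
    simp only [τ, max_comm (0 : ℝ)]
    refine h1.trans ?_
    rw [sub_sub_sub_cancel_left, ← Real.dist_eq, dist_comm]
    simpa using (lipschitz_infDist_pt (U i)).dist_le_mul x x'
  have hsum : ∀ x, ε / 3 ≤ ∑ i, τ x i := by
    intro x
    obtain ⟨i, hi⟩ := hUc x
    refine le_trans ?_ (Finset.single_le_sum (f := τ x) (fun i _ => hτ0 x i) (Finset.mem_univ i))
    simp only [τ, infDist_zero_of_mem hi, sub_zero]
    exact le_max_right _ _
  have hpos : ∀ x, 0 < ∑ i, τ x i := fun x => (by positivity : 0 < ε / 3).trans_le (hsum x)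
  have hτsum : ∀ x x', ∑ i, |τ x i - τ x' i| ≤ 2 * (N + 1) * dist x x' := by
    intro x x'
    rw [← Finset.sum_subset (Finset.subset_univ (posSupp (τ x) ∪ posSupp (τ x')))]
    · refine (Finset.sum_le_card_nsmul _ _ _ fun i _ => hlip x x' i).trans ?_
      rw [nsmul_eq_mul]
      gcongr
      have h1 := Finset.card_union_le (posSupp (τ x)) (posSupp (τ x'))
      have h2 := hτcard x
      have h3 := hτcard x'
      exact_mod_cast (by omega :
        (posSupp (τ x) ∪ posSupp (τ x')).card ≤ 2 * (N + 1))
    · intro i _ hi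
      simp only [Finset.mem_union, mem_posSupp, not_or, not_lt] at hi
      rw [le_antisymm hi.1 (hτ0 x i), le_antisymm hi.2 (hτ0 x' i), sub_zero, abs_zero]
  refine ⟨m, p, fun x i => τ x i / ∑ j, τ x j, ⟨fun x => ⟨fun i => div_nonneg (hτ0 x i)
    (hpos x).le, ?_⟩, continuous_const, fun _ => le_rfl, fun x x' => ?_⟩, fun x => ?_,
    fun x i hi => ?_⟩
  · rw [← Finset.sum_div]
    exact div_self (hpos x).ne'
  · refine (sum_abs_div_sub_div_le (hpos x) (hpos x') (Finset.sum_congr rfl fun i _ =>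
      abs_of_nonneg (hτ0 x' i))).trans ?_
    have h1 : |∑ i, τ x i - ∑ i, τ x' i| ≤ 2 * (N + 1) * dist x x' := by
      rw [← Finset.sum_sub_distrib]
      exact (Finset.abs_sum_le_sum_abs _ _).trans (hτsum x x')
    rw [div_le_iff₀ (hpos x)]
    have h2 := hτsum x x'
    calc _ ≤ 2 * (N + 1) * dist x x' + 2 * (N + 1) * dist x x' := add_le_add h2 h1
      _ = 12 * (N + 1) / ε * 1 * dist x x' * (ε / 3) := by field_simp; ring
      _ ≤ _ := by gcongr; exact hsum x
  · refine (Finset.card_le_card fun i hi => ?_).trans (hτcard x)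
    simp only [mem_posSupp] at hi ⊢
    exact (div_pos_iff_of_pos_right (hpos x)).1 hi
  · obtain ⟨y, hy, hxy⟩ := hτU x i ((div_pos_iff_of_pos_right (hpos x)).1 hi)
    have := dist_triangle x y (p i)
    have := hUd i y hy (p i) (hp i)
    nlinarith

section SimplexChart

variable {n : ℕ} {I : Type*} [DecidableEq I]

/-- The barycentric coordinates with given affine coordinates, relative to ordered vertices. -/
def simplexChart (e : Fin (n + 1) ↪ I) (a : Fin n → ℝ) : I → ℝ :=
  fun i => ∑ j, if e j = i then (Fin.cons (1 - ∑ l, a l) a : Fin (n + 1) → ℝ) j else 0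

theorem simplexChart_apply (e : Fin (n + 1) ↪ I) (a : Fin n → ℝ) (j : Fin (n + 1)) :
    simplexChart e a (e j) = (Fin.cons (1 - ∑ l, a l) a : Fin (n + 1) → ℝ) j := by
  simp [simplexChart, e.injective.eq_iff]

theorem simplexChart_of_notMem (e : Fin (n + 1) ↪ I) (a : Fin n → ℝ) {i : I} (hi : i ∉ range e) :
    simplexChart e a i = 0 :=
  Finset.sum_eq_zero fun j _ => if_neg fun h => hi ⟨j, h⟩

variable [Fintype I]

theorem isLip_simplexChart (e : Fin (n + 1) ↪ I) : IsLip (simplexChart e) := by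
  refine IsLip.pi fun i => IsLip.sum _ fun j _ => ?_
  have hid : IsLip (fun a : Fin n → ℝ => a) := ⟨1, LipschitzWith.id⟩
  split_ifs
  · refine Fin.cases ?_ (fun l => ?_) j
    · simpa using (IsLip.const (1 : ℝ)).sub (IsLip.sum Finset.univ fun l _ => hid.eval l)
    · simpa using hid.eval l
  · exact IsLip.const 0

theorem sum_simplexChart (e : Fin (n + 1) ↪ I) (a : Fin n → ℝ) :
    ∑ i, simplexChart e a i = 1 := by
  simp only [simplexChart]
  rw [Finset.sum_comm]
  simp [Fin.sum_univ_succ]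

/-- The open standard simplex, in affine coordinates. -/
def affineSimplex (n : ℕ) : Set (Fin n → ℝ) := {a | (∀ j, 0 < a j) ∧ ∑ j, a j < 1}

theorem isOpen_affineSimplex : IsOpen (affineSimplex n) := by
  have : affineSimplex n = (⋂ j, {a | 0 < a j}) ∩ {a | ∑ j, a j < 1} := by
    ext a; simp [affineSimplex]
  rw [this]
  exact (isOpen_iInter_of_finite fun j => isOpen_lt continuous_const (continuous_apply j)).inter
    (isOpen_lt (continuous_finsetSum _ fun j _ => continuous_apply j) continuous_const)

theorem volume_affineSimplex_lt_top : volume (affineSimplex n) < ⊤ := by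
  refine (measure_mono (t := Icc 0 1) fun a ha => ⟨fun j => (ha.1 j).le, fun j => ?_⟩).trans_lt
    isCompact_Icc.measure_lt_top
  exact (Finset.single_le_sum (f := a) (fun j _ => (ha.1 j).le) (Finset.mem_univ j)).trans ha.2.le

theorem isBary_simplexChart (e : Fin (n + 1) ↪ I) {a : Fin n → ℝ} (ha : a ∈ affineSimplex n) :
    IsBary (simplexChart e a) ∧ posSupp (simplexChart e a) = Finset.univ.map e := by
  have hpos : ∀ j, 0 < simplexChart e a (e j) := by
    intro j
    rw [simplexChart_apply]
    refine Fin.cases ?_ (fun l => ?_) j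
    · simpa using ha.2
    · simpa using ha.1 l
  refine ⟨⟨fun i => ?_, sum_simplexChart e a⟩, ?_⟩
  · by_cases hi : i ∈ range e
    · obtain ⟨j, rfl⟩ := hi
      exact (hpos j).le
    · rw [simplexChart_of_notMem e a hi]
  · ext i
    by_cases hi : i ∈ range e
    · obtain ⟨j, rfl⟩ := hi
      simp [hpos j]
    · rw [mem_posSupp, simplexChart_of_notMem e a hi]
      simpa using hi

theorem IsBary.simplexChart_eq {v : I → ℝ} (hv : IsBary v) (e : Fin (n + 1) ↪ I)
    (hs : posSupp v ⊆ Finset.univ.map e) : simplexChart e (fun j => v (e j.succ)) = v := by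
  have h1 := hv.sum_posSupp hs
  rw [Finset.sum_map, Fin.sum_univ_succ] at h1
  ext i
  by_cases hi : i ∈ range e
  · obtain ⟨j, rfl⟩ := hi
    rw [simplexChart_apply]
    refine Fin.cases ?_ (fun l => ?_) j
    · simp only [Fin.cons_zero]
      linarith
    · simp
  · rw [simplexChart_of_notMem e _ hi, hv.eq_zero]
    intro h
    exact hi (by simpa using hs h)

end SimplexChart

theorem IsBary.mem_affineSimplex {n : ℕ} {I : Type*} [Fintype I] {v : I → ℝ}
    (hv : IsBary v) (e : Fin (n + 1) ↪ I)
    (hs : posSupp v = Finset.univ.map e) : (fun j => v (e j.succ)) ∈ affineSimplex n := by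
  have h1 := hv.sum_posSupp hs.le
  rw [Finset.sum_map, Fin.sum_univ_succ] at h1
  have h2 : ∀ j, 0 < v (e j) := fun j => mem_posSupp.1 (hs ▸ by simp)
  refine ⟨fun j => h2 _, ?_⟩
  have := h2 0
  linarith

/-- Bary vectors supported on at most `n` vertices form a null set for `n`-dimensional measure. -/
theorem hausdorffMeasure_lowSkeleton (n : ℕ) {I : Type*} [Fintype I] :
    μH[(n : ℝ)] {v : I → ℝ | IsBary v ∧ (posSupp v).card ≤ n} = 0 := by
  classical
  have hsub : {v : I → ℝ | IsBary v ∧ (posSupp v).card ≤ n} ⊆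
      ⋃ k : Fin n, ⋃ e : Fin (k + 1) ↪ I, range (simplexChart e) := by
    rintro v ⟨hv, hc⟩
    have h0 := Finset.card_pos.2 hv.posSupp_nonempty
    let eq := (posSupp v).equivFinOfCardEq
      (show (posSupp v).card = ((posSupp v).card - 1) + 1 by omega)
    let e : Fin ((posSupp v).card - 1 + 1) ↪ I :=
      eq.symm.toEmbedding.trans (Function.Embedding.subtype _)
    refine mem_iUnion.2 ⟨⟨(posSupp v).card - 1, by omega⟩, mem_iUnion.2 ⟨e, ?_⟩⟩
    refine ⟨_, hv.simplexChart_eq e fun i hi => ?_⟩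
    exact Finset.mem_map.2 ⟨eq ⟨i, hi⟩, Finset.mem_univ _, by simp [e]⟩
  refine measure_mono_null hsub ?_
  refine (measure_iUnion_null_iff).2 fun k => (measure_iUnion_null_iff).2 fun e => ?_
  obtain ⟨L, hL⟩ := isLip_simplexChart e
  have h0 : μH[(n : ℝ)] (univ : Set (Fin k → ℝ)) = 0 := by
    have := hausdorffMeasure_of_dimH_lt (s := (univ : Set (Fin k → ℝ))) (d := (n : ℝ≥0))
      (by rw [Real.dimH_univ_pi_fin]; exact_mod_cast k.2)
    simpa using this
  have := hL.hausdorffMeasure_image_le (d := (n : ℝ)) (by positivity) univ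
  rw [h0, mul_zero, image_univ] at this
  exact nonpos_iff_eq_zero.1 this

/-- Perturb a barycentric map over one `n`-simplex, so that most of the simplex is missed by the
image of a compact set disjoint from an exceptional set `A`. -/
theorem exists_perturb_simplex {n : ℕ} {X I : Type*} [MetricSpace X] [CompactSpace X]
    [MeasurableSpace X] [BorelSpace X] [Fintype I] [DecidableEq I]
    (hfin : μH[(n : ℝ)] (univ : Set X) < ⊤) {t : X → I → ℝ} (ht : IsLip t)
    (hb : ∀ x, IsBary (t x)) (hcard : ∀ x, (posSupp (t x)).card ≤ n + 1)
    (e : Fin (n + 1) ↪ I) {δ : ℝ≥0∞} (hδ : 0 < δ) :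
    ∃ (w : X → I → ℝ) (N : Set (I → ℝ)) (A K : Set X) (W : Set (Fin n → ℝ)),
      IsLip w ∧ μH[(n : ℝ)] N = 0 ∧ volume W < δ ∧
      (∀ P, PurelyUnrectifiable n P → μH[(n : ℝ)] (P ∩ A) = 0) ∧ μH[(n : ℝ)] (Aᶜ \ K) < δ ∧
      (∀ x, w x = 0 ∨ (posSupp (t x) = Finset.univ.map e ∧ IsBary (t x + w x) ∧
        posSupp (t x + w x) = Finset.univ.map e ∧ t x + w x ∈ N)) ∧
      ∀ x ∈ K, posSupp (t x) = Finset.univ.map e → t x + w x ∈ simplexChart e '' W := by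
  have : IsFiniteMeasure (μH[(n : ℝ)] : Measure X) := ⟨hfin⟩
  let u : X → Fin n → ℝ := fun x j => t x (e j.succ)
  have hu : IsLip u := IsLip.pi fun j => ht.eval _
  let O : Set X := ⋂ j, {x | 0 < t x (e j)}
  have hO : IsOpen O := isOpen_iInter_of_finite fun j =>
    isOpen_lt continuous_const ((continuous_apply _).comp ht.continuous)
  have hmemO : ∀ x, x ∈ O ↔ posSupp (t x) = Finset.univ.map e := by
    intro x
    rw [mem_iInter]
    constructor
    · intro h
      refine (Finset.eq_of_subset_of_card_le ?_ (by simpa using hcard x)).symm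
      intro i hi
      obtain ⟨j, -, rfl⟩ := Finset.mem_map.1 hi
      exact mem_posSupp.2 (h j)
    · intro h j
      exact mem_posSupp.1 (h ▸ by simp)
  have hOΩ : ∀ x ∈ closure O, u x ∈ affineSimplex n → x ∈ O := by
    intro x hx hux
    have hcl : closure O ⊆ {x | ∑ j, t x (e j) = 1} := by
      refine closure_minimal (fun x hx => ?_) (isClosed_eq (continuous_finsetSum _ fun j _ =>
        (ht.eval (e j)).continuous) continuous_const)
      have := (hb x).sum_posSupp ((hmemO x).1 hx).le
      rwa [Finset.sum_map] at this
    have h1 : ∑ j, t x (e j) = 1 := hcl hx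
    rw [Fin.sum_univ_succ] at h1
    refine mem_iInter.2 fun j => ?_
    refine Fin.cases ?_ (fun l => ?_) j
    · have := hux.2
      simp only [u] at this
      change 0 < t x (e 0)
      linarith
    · exact hux.1 l
  obtain ⟨A, hAm, hAP, hA⟩ := exists_removable_off hfin hu
  obtain ⟨K, hKA, hK, hKδ⟩ := hAm.compl.exists_isClosed_sdiff_lt (measure_ne_top μH[(n : ℝ)] _) hδ.ne'
  obtain ⟨v, Z, W, hv, -, hZ0, hZΩ, hWδ, hvu, hvW⟩ := exists_perturbation hu hA hO
    isOpen_affineSimplex volume_affineSimplex_lt_top hOΩ hK.isCompact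
    (disjoint_left.2 fun x hx hxA => hKA hx hxA) hδ
  have hchart : ∀ x ∈ O, t x = simplexChart e (u x) := fun x hx =>
    ((hb x).simplexChart_eq e ((hmemO x).1 hx).le).symm
  have hval : ∀ x ∈ O, t x + (simplexChart e (v x) - simplexChart e (u x)) =
      simplexChart e (v x) := fun x hx => by rw [hchart x hx]; abel
  refine ⟨fun x => simplexChart e (v x) - simplexChart e (u x), simplexChart e '' Z, A, K, W,
    ((isLip_simplexChart e).comp hv).sub ((isLip_simplexChart e).comp hu), ?_, hWδ, hAP, hKδ,
    fun x => ?_, fun x hx hxS => ?_⟩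
  · obtain ⟨L, hL⟩ := isLip_simplexChart e
    have h1 := hL.hausdorffMeasure_image_le (d := (n : ℝ)) (by positivity) Z
    have h2 : μH[(n : ℝ)] Z = 0 := by
      have h3 := hausdorffMeasure_pi_real (ι := Fin n)
      rw [Fintype.card_fin] at h3
      rw [h3, hZ0]
    rw [h2, mul_zero] at h1
    exact nonpos_iff_eq_zero.1 h1
  · rcases hvu x with h | ⟨hxO, hxZ⟩
    · left
      beta_reduce
      rw [h, sub_self]
    · right
      beta_reduce
      rw [hval x hxO]
      obtain ⟨h1, h2⟩ := isBary_simplexChart e (hZΩ hxZ)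
      exact ⟨(hmemO x).1 hxO, h1, h2, v x, hxZ, rfl⟩
  · have hxO := (hmemO x).2 hxS
    refine ⟨v x, hvW x ⟨hx, hxO⟩ ?_, (hval x hxO).symm⟩
    rcases hvu x with h | ⟨-, hxZ⟩
    · rw [h]
      exact (hb x).mem_affineSimplex e hxS
    · exact hZΩ hxZ

/-- A Lipschitz map into the `n`-skeleton can be perturbed inside its `n`-simplices so that the
image of every purely unrectifiable set becomes as small as we like. -/
theorem exists_perturb_skeleton {n : ℕ} {X I : Type*} [MetricSpace X] [CompactSpace X]
    [MeasurableSpace X] [BorelSpace X] [Fintype I]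
    (hfin : μH[(n : ℝ)] (univ : Set X) < ⊤) {t : X → I → ℝ} (ht : IsLip t)
    (hb : ∀ x, IsBary (t x)) (hcard : ∀ x, (posSupp (t x)).card ≤ n + 1)
    {P : Set X} (hP : PurelyUnrectifiable n P) {η : ℝ≥0∞} (hη : 0 < η) :
    ∃ (t' : X → I → ℝ) (N : Set (I → ℝ)), IsLip t' ∧ (∀ x, IsBary (t' x)) ∧
      μH[(n : ℝ)] N = 0 ∧ (∀ x, t' x = t x ∨ (posSupp (t' x) = posSupp (t x) ∧ t' x ∈ N)) ∧
      μH[(n : ℝ)] (t' '' P) ≤ η := by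
  classical
  let J := {S : Finset I // S.card = n + 1}
  let e : J → Fin (n + 1) ↪ I := fun S =>
    (S.1.equivFinOfCardEq S.2).symm.toEmbedding.trans (Function.Embedding.subtype _)
  have he : ∀ S : J, Finset.univ.map (e S) = S.1 := by
    intro S
    refine Finset.eq_of_subset_of_card_le (fun i hi => ?_) (by simp [S.2])
    obtain ⟨j, -, rfl⟩ := Finset.mem_map.1 hi
    exact ((S.1.equivFinOfCardEq S.2).symm j).2
  obtain ⟨L₀, hL₀⟩ := ht
  choose L₁ hL₁ using fun S => isLip_simplexChart (e S)
  let L : ℝ≥0 := L₀ + ∑ S, L₁ S + 1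
  have hL₀' : LipschitzWith L t := hL₀.weaken (by simp only [L, add_assoc]; exact le_self_add)
  have hL₁' : ∀ S, LipschitzWith L (simplexChart (e S)) := fun S => (hL₁ S).weaken (by
    refine (Finset.single_le_sum (f := L₁) (fun _ _ => zero_le) (Finset.mem_univ S)).trans ?_
    simp only [L]
    rw [add_comm L₀, add_assoc]
    exact le_self_add)
  let D : ℝ≥0∞ := (Fintype.card J + 1) * (2 * (L : ℝ≥0∞) ^ n)
  have hLpos : (L : ℝ≥0∞) ≠ 0 := by simp [L]
  have hD0 : D ≠ 0 := by simp [D, hLpos]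
  have hDt : D ≠ ⊤ := ENNReal.mul_ne_top (by simp) (ENNReal.mul_ne_top (by simp) (by simp))
  let δ : ℝ≥0∞ := η / D
  have hδ : 0 < δ := ENNReal.div_pos hη.ne' hDt
  choose w N A K W hw hN hW hA hK hwx hwK using fun S : J =>
    exists_perturb_simplex hfin ⟨L₀, hL₀⟩ hb hcard (e S) hδ
  simp only [he] at hwx hwK
  let t' : X → I → ℝ := fun x => t x + ∑ S, w S x
  have ht'S : ∀ x, ∀ S : J, posSupp (t x) = S.1 → t' x = t x + w S x := by
    intro x S hS
    simp only [t']
    rw [Finset.sum_eq_single S]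
    · intro S' _ hne
      refine (hwx S' x).resolve_right fun h => hne (Subtype.ext (h.1.symm.trans hS))
    · simp
  have ht'0 : ∀ x, (posSupp (t x)).card ≠ n + 1 → t' x = t x := by
    intro x hx
    simp only [t']
    rw [Finset.sum_eq_zero, add_zero]
    intro S _
    exact (hwx S x).resolve_right fun h => hx (h.1 ▸ S.2)
  have hdich : ∀ x, t' x = t x ∨ (posSupp (t' x) = posSupp (t x) ∧ IsBary (t' x) ∧
      t' x ∈ ⋃ S, N S) := by
    intro x
    by_cases hx : (posSupp (t x)).card = n + 1
    · rw [ht'S x ⟨_, hx⟩ rfl]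
      rcases hwx ⟨_, hx⟩ x with h | ⟨h1, h2, h3, h4⟩
      · left; rw [h, add_zero]
      · exact Or.inr ⟨h3, h2, mem_iUnion.2 ⟨_, h4⟩⟩
    · exact Or.inl (ht'0 x hx)
  have hb' : ∀ x, IsBary (t' x) := fun x => by
    rcases hdich x with h | h
    · rw [h]; exact hb x
    · exact h.2.1
  have hN0 : μH[(n : ℝ)] (⋃ S, N S) = 0 := measure_iUnion_null hN
  refine ⟨t', ⋃ S, N S, IsLip.add ⟨L₀, hL₀⟩ (IsLip.sum _ fun S _ => hw S), hb', hN0,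
    fun x => (hdich x).imp id fun h => ⟨h.1, h.2.2⟩, ?_⟩
  have hcov : t' '' P ⊆ ({v : I → ℝ | IsBary v ∧ (posSupp v).card ≤ n} ∪ ⋃ S, N S) ∪
      ⋃ S : J, (t '' (P ∩ A S) ∪ (t '' ((A S)ᶜ \ K S) ∪ simplexChart (e S) '' W S)) := by
    rintro _ ⟨x, hxP, rfl⟩
    by_cases hx : (posSupp (t x)).card = n + 1
    · by_cases hxK : x ∈ K ⟨_, hx⟩
      · refine Or.inr (mem_iUnion.2 ⟨⟨_, hx⟩, Or.inr (Or.inr ?_)⟩)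
        rw [ht'S x ⟨_, hx⟩ rfl]
        exact hwK ⟨_, hx⟩ x hxK rfl
      · rcases hdich x with h | h
        · refine Or.inr (mem_iUnion.2 ⟨⟨_, hx⟩, ?_⟩)
          rw [h]
          by_cases hxA : x ∈ A ⟨_, hx⟩
          · exact Or.inl ⟨x, ⟨hxP, hxA⟩, rfl⟩
          · exact Or.inr (Or.inl ⟨x, ⟨hxA, hxK⟩, rfl⟩)
        · exact Or.inl (Or.inr h.2.2)
    · refine Or.inl (Or.inl ⟨hb' x, ?_⟩)
      rw [ht'0 x hx]
      have := hcard x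
      omega
  have himg : ∀ s : Set X, μH[(n : ℝ)] (t '' s) ≤ (L : ℝ≥0∞) ^ n * μH[(n : ℝ)] s := fun s => by
    simpa using hL₀'.hausdorffMeasure_image_le (d := (n : ℝ)) (by positivity) s
  have himg' : ∀ S, μH[(n : ℝ)] (simplexChart (e S) '' W S) ≤ (L : ℝ≥0∞) ^ n * δ := fun S => by
    have h1 := (hL₁' S).hausdorffMeasure_image_le (d := (n : ℝ)) (by positivity) (W S)
    have h3 := hausdorffMeasure_pi_real (ι := Fin n)
    rw [Fintype.card_fin] at h3
    rw [h3, ENNReal.rpow_natCast] at h1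
    exact h1.trans (mul_le_mul_right (hW S).le _)
  have hpiece : ∀ S : J, μH[(n : ℝ)] (t '' (P ∩ A S) ∪ (t '' ((A S)ᶜ \ K S) ∪
      simplexChart (e S) '' W S)) ≤ 2 * (L : ℝ≥0∞) ^ n * δ := by
    intro S
    have h1 : μH[(n : ℝ)] (t '' (P ∩ A S)) = 0 :=
      nonpos_iff_eq_zero.1 ((himg _).trans (by rw [hA S P hP, mul_zero]))
    have h2 := (himg ((A S)ᶜ \ K S)).trans (mul_le_mul_right (hK S).le _)
    calc _ ≤ 0 + ((L : ℝ≥0∞) ^ n * δ + (L : ℝ≥0∞) ^ n * δ) :=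
          (measure_union_le _ _).trans (add_le_add h1.le
            ((measure_union_le _ _).trans (add_le_add h2 (himg' S))))
      _ = _ := by ring
  calc μH[(n : ℝ)] (t' '' P) ≤ (0 + 0) + ∑ S : J, 2 * (L : ℝ≥0∞) ^ n * δ := by
        refine (measure_mono hcov).trans ((measure_union_le _ _).trans (add_le_add
          ((measure_union_le _ _).trans (add_le_add (hausdorffMeasure_lowSkeleton n).le hN0.le)) ?_))
        exact (measure_iUnion_fintype_le _ _).trans (Finset.sum_le_sum fun S _ => hpiece S)
    _ ≤ D * δ := by
        simp only [Finset.sum_const, Finset.card_univ, nsmul_eq_mul, add_zero, zero_add, D]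
        rw [← mul_assoc (Fintype.card J : ℝ≥0∞)]
        exact mul_le_mul_left (mul_le_mul_left le_self_add _) _
    _ = η := ENNReal.mul_div_cancel hD0 hDt

/-- The point with barycentric coordinates `v` in the Euclidean simplex of side length `ε`. -/
def emb {I : Type*} [Fintype I] (ε : ℝ) (v : I → ℝ) : EuclideanSpace ℝ I :=
  (ε / Real.sqrt 2) • WithLp.toLp 2 v

theorem emb_apply {I : Type*} [Fintype I] (ε : ℝ) (v : I → ℝ) (i : I) :
    emb ε v i = ε / Real.sqrt 2 * v i := rfl

theorem toLp_eq_sum_vertex {I : Type*} [Fintype I] [DecidableEq I] {v : I → ℝ} {S : Finset I}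
    (hS : ∀ i ∉ S, v i = 0) : WithLp.toLp 2 v = ∑ i ∈ S, v i • vertex i := by
  ext j
  rw [WithLp.ofLp_sum, Finset.sum_apply]
  simp only [vertex, EuclideanSpace.single, PiLp.smul_apply, PiLp.single_apply, smul_eq_mul, mul_ite, mul_one,
    mul_zero, Finset.sum_ite_eq]
  split_ifs with h
  · rfl
  · exact hS j h

theorem IsBary.emb_mem_simplexOf {I : Type*} [Fintype I] [DecidableEq I] {v : I → ℝ}
    (hv : IsBary v) {S : Finset I} (hS : posSupp v ⊆ S) (ε : ℝ) : emb ε v ∈ simplexOf ε S := by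
  refine smul_mem_smul_set ?_
  rw [toLp_eq_sum_vertex (S := S) fun i hi => hv.eq_zero fun h => hi (hS h)]
  exact (convex_convexHull ℝ _).sum_mem (fun i _ => hv.nonneg i) (hv.sum_posSupp hS)
    fun i hi => subset_convexHull ℝ _ ⟨i, hi, rfl⟩

theorem exists_isBary_of_mem_simplexOf {I : Type*} [Fintype I] [DecidableEq I] {ε : ℝ}
    {S : Finset I} {y : EuclideanSpace ℝ I} (hy : y ∈ simplexOf ε S) :
    ∃ v, IsBary v ∧ posSupp v ⊆ S ∧ emb ε v = y := by
  obtain ⟨z, hz, rfl⟩ := hy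
  have hsub : convexHull ℝ (vertex '' (S : Set I)) ⊆
      {z : EuclideanSpace ℝ I | (∀ i, 0 ≤ z i) ∧ ∑ i, z i = 1 ∧ ∀ i ∉ S, z i = 0} := by
    refine convexHull_min ?_ ?_
    · rintro _ ⟨i, hi, rfl⟩
      refine ⟨fun j => ?_, ?_, fun j hj => ?_⟩
      · simp only [vertex, EuclideanSpace.single, PiLp.single_apply]
        split_ifs <;> norm_num
      · simp [vertex]
      · simp only [vertex, EuclideanSpace.single, PiLp.single_apply]
        refine if_neg ?_
        rintro rfl
        exact hj hi
    · rintro x ⟨hx0, hx1, hxS⟩ y ⟨hy0, hy1, hyS⟩ a b ha hb hab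
      refine ⟨fun i => ?_, ?_, fun i hi => ?_⟩
      · simp only [PiLp.add_apply, PiLp.smul_apply, smul_eq_mul]
        exact add_nonneg (mul_nonneg ha (hx0 i)) (mul_nonneg hb (hy0 i))
      · simp only [PiLp.add_apply, PiLp.smul_apply, smul_eq_mul, Finset.sum_add_distrib,
          ← Finset.mul_sum, hx1, hy1, mul_one, hab]
      · simp [hxS i hi, hyS i hi]
  obtain ⟨h0, h1, hS⟩ := hsub hz
  refine ⟨fun i => z i, ⟨h0, h1⟩, fun i hi => ?_, rfl⟩
  by_contra hiS
  exact (mem_posSupp.1 hi).ne' (hS i hiS)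

theorem IsBary.emb_mem_openStar {I : Type*} [Fintype I] [DecidableEq I] {v : I → ℝ}
    (hv : IsBary v) {K : SimplicialCplx I} (hK : posSupp v ∈ K.F) {S : Finset I}
    (hS : S ⊆ posSupp v) (ε : ℝ) : emb ε v ∈ openStar ε K S := by
  refine mem_iUnion₂.2 ⟨posSupp v, hK, mem_iUnion.2 ⟨hS, v, fun i hi => mem_posSupp.1 hi,
    hv.sum_posSupp subset_rfl, ?_⟩⟩
  rw [← toLp_eq_sum_vertex fun i hi => hv.eq_zero hi]
  rfl

theorem dist_emb_le {I : Type*} [Fintype I] {ε : ℝ} (hε : 0 ≤ ε) (v w : I → ℝ) :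
    dist (emb ε v) (emb ε w) ≤ ε / Real.sqrt 2 * ∑ i, |v i - w i| := by
  classical
  have hr : 0 ≤ ε / Real.sqrt 2 := by positivity
  rw [emb, emb, dist_smul₀, Real.norm_of_nonneg hr, dist_eq_norm, ← WithLp.toLp_sub]
  refine mul_le_mul_of_nonneg_left ?_ hr
  rw [toLp_eq_sum_vertex (S := Finset.univ) fun i hi => absurd (Finset.mem_univ i) hi]
  refine (norm_sum_le _ _).trans (Finset.sum_le_sum fun i _ => ?_)
  simp [norm_smul, vertex]

theorem isLip_emb {I : Type*} [Fintype I] {ε : ℝ} (hε : 0 ≤ ε) :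
    IsLip (emb ε : (I → ℝ) → EuclideanSpace ℝ I) := by
  refine IsLip.of_dist_le (ε / Real.sqrt 2 * Fintype.card I) fun v w => ?_
  refine (dist_emb_le hε v w).trans ?_
  rw [mul_assoc]
  refine mul_le_mul_of_nonneg_left ?_ (by positivity)
  refine (Finset.sum_le_card_nsmul _ _ (dist v w) fun i _ => ?_).trans (by simp)
  rw [← Real.dist_eq]
  exact dist_le_pi_dist v w i

/-- The map on the Euclidean simplex of side length `ε` sending the vertex `i` to `q i`. -/
def vertexMap {I E : Type*} [Fintype I] [AddCommGroup E] [Module ℝ E] (ε : ℝ) (q : I → E)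
    (y : EuclideanSpace ℝ I) : E :=
  ∑ i, (Real.sqrt 2 / ε * y i) • q i

theorem vertexMap_emb {I E : Type*} [Fintype I] [AddCommGroup E] [Module ℝ E] {ε : ℝ}
    (hε : ε ≠ 0) (q : I → E) (v : I → ℝ) : vertexMap ε q (emb ε v) = ∑ i, v i • q i := by
  refine Finset.sum_congr rfl fun i _ => ?_
  have : Real.sqrt 2 ≠ 0 := by positivity
  rw [emb_apply]
  congr 1
  field_simp

theorem vertexMap_lipschitzOnWith {I E : Type*} [Fintype I] [DecidableEq I]
    [NormedAddCommGroup E] [NormedSpace ℝ E] {ε : ℝ} (hε : 0 < ε) {q : I → E} {z : E} {R : ℝ}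
    {S : Finset I} (hS : ∀ i ∈ S, ‖z - q i‖ ≤ R * ε) {C : ℝ≥0} (hC : S.card * (2 * R) ≤ C) : LipschitzOnWith C (vertexMap ε q) (simplexOf ε S) := by
  refine LipschitzOnWith.of_dist_le_mul fun y hy y' hy' => ?_
  obtain ⟨v, hv, hvS, rfl⟩ := exists_isBary_of_mem_simplexOf hy
  obtain ⟨w, hw, hwS, rfl⟩ := exists_isBary_of_mem_simplexOf hy'
  have h2 : Real.sqrt 2 ≤ 2 := Real.sqrt_le_iff.2 ⟨by norm_num, by norm_num⟩
  have h20 : 0 < Real.sqrt 2 := by positivity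
  have hkey : ∑ i, v i • q i - ∑ i, w i • q i = ∑ i ∈ S, (v i - w i) • (q i - z) := by
    have hvq : ∑ i, v i • q i = ∑ i ∈ S, v i • q i :=
      (Finset.sum_subset (Finset.subset_univ S) fun i _ hi => by
        rw [hv.eq_zero fun h => hi (hvS h), zero_smul]).symm
    have hwq : ∑ i, w i • q i = ∑ i ∈ S, w i • q i :=
      (Finset.sum_subset (Finset.subset_univ S) fun i _ hi => by
        rw [hw.eq_zero fun h => hi (hwS h), zero_smul]).symm
    have hz : ∑ i ∈ S, (v i - w i) • z = 0 := by
      rw [← Finset.sum_smul, Finset.sum_sub_distrib, hv.sum_posSupp hvS, hw.sum_posSupp hwS,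
        sub_self, zero_smul]
    simp only [smul_sub, Finset.sum_sub_distrib, sub_smul, hvq, hwq]
    simp only [sub_smul, Finset.sum_sub_distrib] at hz
    rw [hz, sub_zero]
  rw [vertexMap_emb hε.ne', vertexMap_emb hε.ne', dist_eq_norm, hkey]
  have hcoord : ∀ i, |v i - w i| ≤ 2 / ε * dist (emb ε v) (emb ε w) := fun i => by
    have h1 : |emb ε v i - emb ε w i| ≤ dist (emb ε v) (emb ε w) := by
      rw [← Real.dist_eq]
      exact PiLp.dist_apply_le _ _ i
    rw [emb_apply, emb_apply, ← mul_sub, abs_mul, abs_of_pos (by positivity)] at h1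
    calc |v i - w i| = Real.sqrt 2 / ε * (ε / Real.sqrt 2 * |v i - w i|) := by field_simp
      _ ≤ 2 / ε * dist (emb ε v) (emb ε w) := by gcongr
  calc ‖∑ i ∈ S, (v i - w i) • (q i - z)‖
      ≤ ∑ i ∈ S, (2 / ε * dist (emb ε v) (emb ε w)) * (R * ε) := by
        refine (norm_sum_le _ _).trans (Finset.sum_le_sum fun i hi => ?_)
        rw [norm_smul, Real.norm_eq_abs, norm_sub_rev]
        exact mul_le_mul (hcoord i) (hS i hi) (norm_nonneg _) (by positivity)
    _ = S.card * (2 * R) * dist (emb ε v) (emb ε w) := by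
        rw [Finset.sum_const, nsmul_eq_mul]
        field_simp
    _ ≤ C * dist (emb ε v) (emb ε w) := by gcongr

theorem IsBary.norm_sub_vertexMap_le {I E : Type*} [Fintype I]
    [NormedAddCommGroup E] [NormedSpace ℝ E] {v : I → ℝ} (hv : IsBary v) {ε : ℝ} (hε : ε ≠ 0)
    {q : I → E} {z : E} {R : ℝ} (hR : ∀ i ∈ posSupp v, ‖z - q i‖ ≤ R) :
    ‖z - vertexMap ε q (emb ε v)‖ ≤ R := by
  have hz : z - ∑ i, v i • q i = ∑ i, v i • (z - q i) := by
    simp only [smul_sub, Finset.sum_sub_distrib, ← Finset.sum_smul, hv.sum_eq, one_smul]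
  rw [vertexMap_emb hε, hz]
  calc ‖∑ i, v i • (z - q i)‖ ≤ ∑ i, v i * R := by
        refine (norm_sum_le _ _).trans (Finset.sum_le_sum fun i _ => ?_)
        rw [norm_smul, Real.norm_of_nonneg (hv.nonneg i)]
        by_cases hi : i ∈ posSupp v
        · exact mul_le_mul_of_nonneg_left (hR i hi) (hv.nonneg i)
        · rw [hv.eq_zero hi, zero_mul, zero_mul]
    _ = R := by rw [← Finset.sum_mul, hv.sum_eq, one_mul]

/-- The multiplicity of a perturbed map over an `n`-simplex is controlled by the integral of the
local Lipschitz constant of the original map over the preimage of the open star. -/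
theorem lintegral_simplexOf_multiplicity_le {n : ℕ} {X I : Type*} [MetricSpace X] [CompactSpace X]
    [MeasurableSpace X] [BorelSpace X] [Fintype I] [DecidableEq I] {ε a : ℝ} (hε : 0 < ε)
    (ha : 0 ≤ a) {t t' : X → I → ℝ} {θ : X → ℝ} (h : BaryControl a t θ) {N : Set (I → ℝ)}
    (hN : μH[(n : ℝ)] N = 0) (ht' : ∀ x, t' x = t x ∨ t' x ∈ N) {S : Finset I}
    (hS : S.card = n + 1) :
    ∫⁻ y in simplexOf ε S, (((fun x => emb ε (t' x)) ⁻¹' {y}).encard : ℝ≥0∞) ∂μH[(n : ℝ)] ≤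
      ENNReal.ofReal (2 * (ε / Real.sqrt 2 * a)) ^ n *
        ∫⁻ x in {x | S ⊆ posSupp (t x)}, ENNReal.ofReal (θ x) ^ n ∂μH[(n : ℝ)] := by
  have hr : 0 < ε / Real.sqrt 2 := by positivity
  obtain ⟨L, hL⟩ := isLip_emb (I := I) hε.le
  have hnull : ∀ Z : Set (I → ℝ), μH[(n : ℝ)] Z = 0 → μH[(n : ℝ)] (emb ε '' Z) = 0 := by
    intro Z hZ
    have h1 := hL.hausdorffMeasure_image_le (d := (n : ℝ)) (by positivity) Z
    rw [hZ, mul_zero] at h1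
    exact nonpos_iff_eq_zero.1 h1
  have hBo : IsOpen (⋂ i ∈ S, {y : EuclideanSpace ℝ I | 0 < y i}) :=
    isOpen_biInter_finset fun i _ => isOpen_lt continuous_const (by fun_prop)
  set B : Set (EuclideanSpace ℝ I) := ⋂ i ∈ S, {y : EuclideanSpace ℝ I | 0 < y i} with hB
  have hSB : simplexOf ε S ≤ᵐ[μH[(n : ℝ)]] B := by
    refine ae_le_set.2 (measure_mono_null ?_ (hnull _ (hausdorffMeasure_lowSkeleton n)))
    rintro y ⟨hy, hyB⟩
    obtain ⟨v, hv, hvS, rfl⟩ := exists_isBary_of_mem_simplexOf hy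
    refine ⟨v, ⟨hv, ?_⟩, rfl⟩
    have hne : posSupp v ≠ S := by
      rintro rfl
      exact hyB (mem_iInter₂.2 fun i hi => mul_pos hr (mem_posSupp.1 hi))
    have := Finset.card_lt_card (hvS.ssubset_of_ne hne)
    omega
  have hmult : ∀ᵐ y ∂(μH[(n : ℝ)] : Measure (EuclideanSpace ℝ I)),
      (((fun x => emb ε (t' x)) ⁻¹' {y}).encard : ℝ≥0∞) ≤
        (((fun x => emb ε (t x)) ⁻¹' {y}).encard : ℝ≥0∞) := by
    refine measure_mono_null (fun y hy => ?_) (hnull N hN)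
    by_contra hyN
    refine hy (ENat.toENNReal_le.2 (encard_le_encard fun x hx => ?_))
    rcases ht' x with h1 | h1
    · have h2 : emb ε (t' x) = y := hx
      rw [h1] at h2
      exact h2
    · exact absurd ⟨t' x, h1, hx⟩ hyN
  refine (lintegral_mono_ae (ae_restrict_of_ae hmult)).trans
    ((lintegral_mono' (Measure.restrict_mono_ae hSB) le_rfl).trans ?_)
  have hpre : (fun x => emb ε (t x)) ⁻¹' B = {x | S ⊆ posSupp (t x)} := by
    ext x
    simp only [hB, mem_preimage, mem_iInter, mem_ofPred_eq, emb_apply, mul_pos_iff_of_pos_left hr]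
    exact forall₂_congr fun i _ => mem_posSupp.symm
  obtain ⟨L', hL'⟩ := (isLip_emb (I := I) hε.le).comp (h.isLip ha)
  have := lintegral_multiplicity_le (n := n) h.cont h.one_le (a := ε / Real.sqrt 2 * a)
    (by positivity) hL'.continuous (fun x x' => ?_) hBo.measurableSet
  · rw [← hpre]
    exact this
  · refine (dist_emb_le hε.le _ _).trans ?_
    rw [mul_assoc, mul_assoc, ← mul_assoc a]
    exact mul_le_mul_of_nonneg_left (h.lip x x') hr.le

/-- The nerve of a family of barycentric coordinates: a set of indices spans a simplex when all
its coordinates are simultaneously positive at some point. -/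
def nerve {X I : Type*} [Fintype I] [Nonempty X] (t : X → I → ℝ) (ht : ∀ x, IsBary (t x)) :
    SimplicialCplx I where
  F := {S : Finset I | S.Nonempty ∧ ∃ x, S ⊆ posSupp (t x)}.toFinite.toFinset
  F_nonempty := by
    obtain ⟨x⟩ := ‹Nonempty X›
    exact ⟨posSupp (t x), by simpa using ⟨(ht x).posSupp_nonempty, x, subset_rfl⟩⟩
  mem_nonempty S hS := by
    simp only [Finite.mem_toFinset, mem_ofPred_eq] at hS
    exact hS.1
  down_closed S hS T hT hTn := by
    simp only [Finite.mem_toFinset, mem_ofPred_eq] at hS ⊢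
    exact ⟨hTn, hS.2.imp fun x hx => hT.trans hx⟩

theorem mem_nerve {X I : Type*} [Fintype I] [Nonempty X] {t : X → I → ℝ}
    {ht : ∀ x, IsBary (t x)} {S : Finset I} :
    S ∈ (nerve t ht).F ↔ S.Nonempty ∧ ∃ x, S ⊆ posSupp (t x) := by
  simp [nerve]

theorem IsBary.posSupp_mem_nerve {X I : Type*} [Fintype I] [Nonempty X] {t : X → I → ℝ}
    {ht : ∀ x, IsBary (t x)} {v : I → ℝ} (hv : IsBary v) {x : X} (h : posSupp v ⊆ posSupp (t x)) :
    posSupp v ∈ (nerve t ht).F :=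
  mem_nerve.2 ⟨hv.posSupp_nonempty, x, h⟩

/-- (The setup lemma for the approximation by Lipschitz manifolds.)
Let `n ≥ 1` and let `X` be a compact metric space with finite Hausdorff `n`-measure and
Nagata dimension at most `N` with constant `c`, isometrically embedded in `ℓ^∞`, and let
`P ⊆ X` be purely `n`-unrectifiable. Then for every `ε > 0` there are a finite simplicial
complex `Σ` of dimension at most `N` with side length `ε` (with the `ℓ²`-metric),
Lipschitz maps `f, h : X → Σ` and `g : Σ → ℓ^∞`, and a constant `C` depending only on
`n, N, c`, satisfying properties (1)–(6). -/
theorem stmt4 (n N : ℕ) (hn : 1 ≤ n) (c : ℝ) (hc : 0 < c) :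
    ∃ C : ℝ≥0, 0 < C ∧
      ∀ (X : Type) [MetricSpace X] [CompactSpace X] [MeasurableSpace X] [BorelSpace X]
        (ι : X → Linf), Isometry ι → NagataDimLE X N c →
        μH[(n : ℝ)] (Set.univ : Set X) < ⊤ →
        ∀ (P : Set X), PurelyUnrectifiable n P →
        ∀ (ε : ℝ), 0 < ε →
          ∃ (m : ℕ) (K : SimplicialCplx (Fin m))
            (f h : X → EuclideanSpace ℝ (Fin m)) (g : EuclideanSpace ℝ (Fin m) → Linf),
            -- `Σ` has dimension at most `N`
            (∀ S ∈ K.F, S.card ≤ N + 1) ∧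
            -- `f` and `h` map into the realization of `Σ` (side length `ε`)
            (∀ x, f x ∈ realization ε K) ∧
            (∀ x, h x ∈ realization ε K) ∧
            -- `h` is Lipschitz
            (∃ Lh : ℝ≥0, LipschitzWith Lh h) ∧
            -- (1) `f` is `C`-Lipschitz and `g` is `C`-Lipschitz on each simplex
            LipschitzWith C f ∧
            (∀ S ∈ K.F, LipschitzOnWith C g (simplexOf ε S)) ∧
            -- (2) `g ∘ f` and `g ∘ h` move points at most `C·ε`
            (∀ x, ‖ι x - g (f x)‖ ≤ (C : ℝ) * ε) ∧
            (∀ x, ‖ι x - g (h x)‖ ≤ (C : ℝ) * ε) ∧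
            -- (3) the image of `h` lies in the `n`-skeleton
            (∀ x, h x ∈ skeleton ε K n) ∧
            -- (4) `f(x)` and `h(x)` lie in a common simplex
            (∀ x, ∃ S ∈ K.F, f x ∈ simplexOf ε S ∧ h x ∈ simplexOf ε S) ∧
            -- (5) `H^n(h(P)) < ε^n / (2·n!)`
            μH[(n : ℝ)] (h '' P) < ENNReal.ofReal (ε ^ n / (2 * (n.factorial : ℝ))) ∧
            -- (6) multiplicity bound over each `n`-dimensional simplex
            (∀ S ∈ K.F, S.card = n + 1 →
              ∫⁻ y in simplexOf ε S, ((h ⁻¹' {y}).encard : ℝ≥0∞)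
                  ∂(μH[(n : ℝ)] : Measure (EuclideanSpace ℝ (Fin m))) ≤
                (C : ℝ≥0∞) * μH[(n : ℝ)] (f ⁻¹' openStar ε K S)) := by
  set k := max N n with hk
  set A : ℝ := ∏ j ∈ Finset.Ioc n k, (2 * (4 * (j : ℝ) + 5)) with hA
  set D : ℝ≥0 := ∏ j ∈ Finset.Ioc n k, centerConst n j with hD
  have hA0 : 0 < A := Finset.prod_pos fun j _ => by positivity
  let C₁ : ℝ≥0 := 12 * (N + 1)
  let C₂ : ℝ≥0 := (N + 1) * (2 * (c.toNNReal + 1))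
  let C₃ : ℝ≥0 := (2 * (A.toNNReal * (12 * (N + 1)))) ^ n * D
  have hC₂ : (C₂ : ℝ) = (N + 1) * (2 * (c + 1)) := by
    simp [C₂, Real.coe_toNNReal c hc.le]
  have h1C : C₁ ≤ C₁ + C₂ + C₃ := by rw [add_assoc]; exact le_self_add
  have h2C : C₂ ≤ C₁ + C₂ + C₃ := by rw [add_comm C₁, add_assoc]; exact le_self_add
  have h3C : C₃ ≤ C₁ + C₂ + C₃ := le_add_self
  have hcC : c + 1 ≤ ((C₁ + C₂ + C₃ : ℝ≥0) : ℝ) := by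
    refine le_trans ?_ (NNReal.coe_le_coe.2 h2C)
    rw [hC₂]
    have : (0 : ℝ) ≤ N := Nat.cast_nonneg N
    nlinarith
  refine ⟨C₁ + C₂ + C₃, lt_of_lt_of_le (by positivity) h1C, ?_⟩
  generalize C₁ + C₂ + C₃ = C at h1C h2C h3C hcC
  intro X _ _ _ _ ι hι hX hfin P hP ε hε
  have hη₀ : 0 < ENNReal.ofReal (ε ^ n / (2 * (n.factorial : ℝ))) :=
    ENNReal.ofReal_pos.2 (by positivity)
  rcases isEmpty_or_nonempty X with hXe | hXn
  · refine ⟨1, ⟨{{0}}, by simp, by simp, fun S hS T hTS hT => ?_⟩, fun _ => 0, fun _ => 0,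
      fun _ => 0, by simp, fun x => isEmptyElim x, fun x => isEmptyElim x,
      ⟨0, LipschitzWith.const _⟩, LipschitzWith.of_dist_le_mul fun x => isEmptyElim x,
      fun S _ => (LipschitzWith.const' _).lipschitzOnWith, fun x => isEmptyElim x,
      fun x => isEmptyElim x, fun x => isEmptyElim x, fun x => isEmptyElim x, ?_, ?_⟩
    · rw [Finset.mem_singleton] at hS ⊢
      subst hS
      exact (Finset.subset_singleton_iff.1 hTS).resolve_left hT.ne_empty
    · rw [eq_empty_of_isEmpty P, image_empty, measure_empty]
      exact hη₀
    · intro S hS hcard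
      rw [Finset.mem_singleton] at hS
      subst hS
      simp at hcard
      omega
  obtain ⟨m, p, t, ht, htN, htp⟩ := hX.exists_partition hc hε
  have ha : (0 : ℝ) ≤ 12 * (N + 1) / ε := by positivity
  obtain ⟨t₀, θ, ht₀, hs₀, hc₀, hi₀⟩ := ht.exists_collapse_skeleton (n := n) (k := k)
    (le_max_right _ _) hfin ha fun x => (htN x).trans (by omega)
  rw [← hA] at ht₀
  have ha₀ : 0 ≤ A * (12 * (N + 1) / ε) := by positivity
  have hemb := isLip_emb (I := Fin m) hε.le
  obtain ⟨L, hL⟩ := hemb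
  obtain ⟨η, hη, hηL⟩ : ∃ η : ℝ≥0∞, 0 < η ∧
      (L : ℝ≥0∞) ^ n * η < ENNReal.ofReal (ε ^ n / (2 * (n.factorial : ℝ))) := by
    have h1 : Tendsto (fun η : ℝ≥0∞ => (L : ℝ≥0∞) ^ n * η) (𝓝[>] 0) (𝓝 ((L : ℝ≥0∞) ^ n * 0)) :=
      (ENNReal.Tendsto.const_mul tendsto_id (Or.inr (by simp))).mono_left nhdsWithin_le_nhds
    rw [mul_zero] at h1
    obtain ⟨η, h2, h3⟩ := ((h1.eventually (gt_mem_nhds hη₀)).and self_mem_nhdsWithin).exists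
    exact ⟨η, h3, h2⟩
  obtain ⟨t', Z, ht', hb', hZ, hd', hP'⟩ := exists_perturb_skeleton hfin (ht₀.isLip ha₀)
    ht₀.bary hc₀ hP hη
  have hs' : ∀ x, posSupp (t' x) = posSupp (t₀ x) := fun x => by
    rcases hd' x with h | h
    · rw [h]
    · exact h.1
  have hst : ∀ x, posSupp (t' x) ⊆ posSupp (t x) := fun x => (hs' x).trans_subset (hs₀ x)
  have hq : ∀ x, ∀ i ∈ posSupp (t x), ‖ι x - ι (p i)‖ ≤ (c + 1) * ε := fun x i hi => by
    rw [← dist_eq_norm, hι.dist_eq]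
    exact htp x i (mem_posSupp.1 hi)
  have hcε : (c + 1) * ε ≤ C * ε := mul_le_mul_of_nonneg_right hcC hε.le
  have hsqrt : 1 ≤ Real.sqrt 2 := Real.one_le_sqrt.2 (by norm_num)
  refine ⟨m, nerve t ht.bary, fun x => emb ε (t x), fun x => emb ε (t' x),
    vertexMap ε fun i => ι (p i), ?_, ?_, ?_, IsLip.comp ⟨L, hL⟩ ht', ?_, ?_, ?_, ?_, ?_, ?_, ?_, ?_⟩
  · intro S hS
    obtain ⟨-, x, hx⟩ := mem_nerve.1 hS
    exact (Finset.card_le_card hx).trans (htN x)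
  · exact fun x => mem_iUnion₂.2 ⟨_, (ht.bary x).posSupp_mem_nerve subset_rfl,
      (ht.bary x).emb_mem_simplexOf subset_rfl ε⟩
  · exact fun x => mem_iUnion₂.2 ⟨_, (hb' x).posSupp_mem_nerve (hst x),
      (hb' x).emb_mem_simplexOf subset_rfl ε⟩
  · refine LipschitzWith.of_dist_le_mul fun x x' => (dist_emb_le hε.le _ _).trans ?_
    calc ε / Real.sqrt 2 * ∑ i, |t x i - t x' i|
        ≤ ε / 1 * (12 * (N + 1) / ε * 1 * dist x x') := by
          gcongr
          exact ht.lip x x'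
      _ = C₁ * dist x x' := by
          simp only [C₁]
          push_cast
          field_simp
      _ ≤ C * dist x x' := by gcongr
  · intro S hS
    obtain ⟨-, x, hx⟩ := mem_nerve.1 hS
    refine vertexMap_lipschitzOnWith hε (fun i hi => hq x i (hx hi))
      (le_trans ?_ (NNReal.coe_le_coe.2 h2C))
    rw [hC₂]
    have : (S.card : ℝ) ≤ N + 1 := by exact_mod_cast (Finset.card_le_card hx).trans (htN x)
    gcongr
  · exact fun x => ((ht.bary x).norm_sub_vertexMap_le hε.ne' (hq x)).trans hcε
  · exact fun x => ((hb' x).norm_sub_vertexMap_le hε.ne' fun i hi => hq x i (hst x hi)).trans hcε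
  · exact fun x => mem_iUnion₂.2 ⟨_, (hb' x).posSupp_mem_nerve (hst x), mem_iUnion.2
      ⟨(hs' x).symm ▸ hc₀ x, (hb' x).emb_mem_simplexOf subset_rfl ε⟩⟩
  · exact fun x => ⟨_, (ht.bary x).posSupp_mem_nerve subset_rfl,
      (ht.bary x).emb_mem_simplexOf subset_rfl ε, (hb' x).emb_mem_simplexOf (hst x) ε⟩
  · have h1 := hL.hausdorffMeasure_image_le (d := (n : ℝ)) (by positivity) (t' '' P)
    rw [image_image, ENNReal.rpow_natCast] at h1
    exact (h1.trans (mul_le_mul_right hP' _)).trans_lt hηL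
  · intro S hS hcard
    refine (lintegral_simplexOf_multiplicity_le hε ha₀ ht₀ hZ
      (fun x => (hd' x).imp id And.right) hcard).trans ?_
    have h1 : {x | S ⊆ posSupp (t x)} ⊆ (fun x => emb ε (t x)) ⁻¹' openStar ε (nerve t ht.bary) S :=
      fun x hx => (ht.bary x).emb_mem_openStar ((ht.bary x).posSupp_mem_nerve subset_rfl) hx ε
    have h2 : ENNReal.ofReal (2 * (ε / Real.sqrt 2 * (A * (12 * (N + 1) / ε)))) ≤
        ((2 * (A.toNNReal * (12 * (N + 1))) : ℝ≥0) : ℝ≥0∞) := by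
      rw [← ENNReal.ofReal_coe_nnreal]
      refine ENNReal.ofReal_le_ofReal ?_
      push_cast
      rw [Real.coe_toNNReal A hA0.le]
      calc 2 * (ε / Real.sqrt 2 * (A * (12 * (N + 1) / ε)))
          ≤ 2 * (ε / 1 * (A * (12 * (N + 1) / ε))) := by gcongr
        _ = 2 * (A * (12 * (N + 1))) := by field_simp
    calc _ ≤ ((2 * (A.toNNReal * (12 * (N + 1))) : ℝ≥0) : ℝ≥0∞) ^ n *
          ((D : ℝ≥0∞) * ∫⁻ x in {x | S ⊆ posSupp (t x)}, ENNReal.ofReal 1 ^ n ∂μH[(n : ℝ)]) :=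
          mul_le_mul' (pow_le_pow_left' h2 n) (hi₀ S)
      _ = (C₃ : ℝ≥0∞) * μH[(n : ℝ)] {x | S ⊆ posSupp (t x)} := by
          simp only [ENNReal.ofReal_one, one_pow, lintegral_one, Measure.restrict_apply_univ, C₃]
          push_cast
          rw [mul_assoc]
      _ ≤ _ := mul_le_mul' (ENNReal.coe_le_coe.2 h3C) (measure_mono h1)
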